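/- Let p be a prime. For almost every pair (z, w) ∈ ℍ × ℍ the following holds: for every real ζ > 1 there exists ε₀ > 0 such that for every ε with 0 < ε < ε₀ there is a matrix γ ∈ SL₂(ℚ) all of whose entries lie in ℤ[1/p], satisfying dist(γ⁻¹ · z, w) ≤ ε and ht(γ) ≤ ζ · log(ε⁻¹)/log p. (This is the n = 2 case of the paper's main theorem: the Diophantine exponent of the SL₂(ℤ[1/p])-action on the hyperbolic plane satisfies κ ≤ 1; note that for n = 2 the normalizing factor (n+2)/(2n) equals 1.) -/

import Mathlib

open MeasureTheory UpperHalfPlane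
open scoped MatrixGroups

noncomputable section

/-- `q` lies in `ℤ[1/p]`, i.e. is of the form `a / p ^ m`. -/
def IsZInvP (p : ℕ) (q : ℚ) : Prop := ∃ (a : ℤ) (m : ℕ), q = (a : ℚ) / (p : ℚ) ^ m

/-- A rational matrix has integer entries. -/
def IsIntMat {n : ℕ} (A : Matrix (Fin n) (Fin n) ℚ) : Prop := ∀ i j, ∃ z : ℤ, A i j = (z : ℚ)

/-- The height of a matrix with entries in `ℤ[1/p]`: the least `k` such that `p ^ k • γ`
is an integer matrix. -/
def ht (p : ℕ) {n : ℕ} (γ : Matrix (Fin n) (Fin n) ℚ) : ℕ :=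
  sInf {k : ℕ | IsIntMat ((p : ℚ) ^ k • γ)}

/-- Divisor bound. -/
lemma divisor_bound (δ : ℝ) (hδ : 0 < δ) : ∃ C : ℝ, 1 ≤ C ∧ ∀ n : ℕ, n ≠ 0 →
    (n.divisors.card : ℝ) ≤ C * (n : ℝ) ^ δ := by
  obtain ⟨A, hA1, hA2⟩ : ∃ A : ℝ, 1 ≤ A ∧ 1 ≤ A * (δ * Real.log 2) := by
    have h2 : 0 < δ * Real.log 2 := mul_pos hδ (Real.log_pos (by norm_num))
    refine ⟨max 1 (1 / (δ * Real.log 2)), le_max_left _ _, ?_⟩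
    calc 1 = 1 / (δ * Real.log 2) * (δ * Real.log 2) := by field_simp
      _ ≤ _ := by gcongr; exact le_max_right _ _
  have hsmall : ∀ q e : ℕ, 2 ≤ q → ((e : ℝ) + 1) ≤ A * (q : ℝ) ^ ((e : ℝ) * δ) := by
    intro q e hq
    have h1 : (2 : ℝ) ^ ((e : ℝ) * δ) ≤ (q : ℝ) ^ ((e : ℝ) * δ) := by
      apply Real.rpow_le_rpow (by norm_num) (by exact_mod_cast hq) (by positivity)
    have h2 : 1 + (e : ℝ) * (δ * Real.log 2) ≤ (2 : ℝ) ^ ((e : ℝ) * δ) := by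
      rw [Real.rpow_def_of_pos (by norm_num)]
      have := Real.add_one_le_exp (Real.log 2 * ((e : ℝ) * δ))
      linarith [mul_comm (Real.log 2) ((e : ℝ) * δ), mul_assoc (e : ℝ) δ (Real.log 2)]
    have h3 : (e : ℝ) ≤ e * (A * (δ * Real.log 2)) := by
      have : (0 : ℝ) ≤ e := by positivity
      nlinarith
    calc (e : ℝ) + 1 ≤ A * (1 + (e : ℝ) * (δ * Real.log 2)) := by nlinarith
      _ ≤ A * (q : ℝ) ^ ((e : ℝ) * δ) := by gcongr; linarith
  obtain ⟨Q, hQ⟩ : ∃ Q : ℕ, ∀ q : ℕ, Q ≤ q → (2 : ℝ) ≤ (q : ℝ) ^ δ := by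
    have := (tendsto_rpow_atTop hδ).comp (tendsto_natCast_atTop_atTop (R := ℝ))
    have := (Filter.tendsto_atTop.1 this) 2
    exact Filter.eventually_atTop.1 this
  have hlarge : ∀ q e : ℕ, Q ≤ q → 2 ≤ q → ((e : ℝ) + 1) ≤ (q : ℝ) ^ ((e : ℝ) * δ) := by
    intro q e hq _
    have : ((e : ℝ) + 1) ≤ 2 ^ e := by
      have := @one_add_mul_le_pow ℝ _ _ _ 1 (by norm_num) e
      norm_num at this; linarith
    calc ((e : ℝ) + 1) ≤ 2 ^ e := this
      _ ≤ ((q : ℝ) ^ δ) ^ e := by gcongr; exact hQ q hq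
      _ = _ := by rw [← Real.rpow_natCast, ← Real.rpow_mul (by positivity), mul_comm]
  refine ⟨A ^ Q, one_le_pow₀ hA1, fun n hn => ?_⟩
  rw [Nat.card_divisors hn]
  have hn' : (n : ℝ) ^ δ = ∏ q ∈ n.primeFactors, (q : ℝ) ^ ((n.factorization q : ℝ) * δ) := by
    conv_lhs => rw [← Nat.prod_factorization_pow_eq_self hn]
    rw [Finsupp.prod, Nat.support_factorization]
    push_cast
    rw [← Real.finsetProd_rpow _ _ (fun i _ => by positivity)]
    refine Finset.prod_congr rfl fun q hq => ?_
    rw [← Real.rpow_natCast, ← Real.rpow_mul (by positivity)]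
  rw [hn']
  push_cast
  have key : ∏ q ∈ n.primeFactors, ((n.factorization q : ℝ) + 1) ≤
      ∏ q ∈ n.primeFactors, ((if q < Q then A else 1) *
        (q : ℝ) ^ ((n.factorization q : ℝ) * δ)) := by
    refine Finset.prod_le_prod (fun _ _ => by positivity) fun q hq => ?_
    have hq2 := (Nat.prime_of_mem_primeFactors hq).two_le
    split_ifs with h
    · exact hsmall _ _ hq2
    · rw [one_mul]; exact hlarge _ _ (by omega) hq2
  refine key.trans ?_
  rw [Finset.prod_mul_distrib]
  gcongr
  rw [Finset.prod_ite, Finset.prod_const, Finset.prod_const_one, mul_one]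
  apply pow_le_pow_right₀ hA1
  calc _ ≤ (Finset.range Q).card := by
        apply Finset.card_le_card
        intro q hq
        simp at hq ⊢
        exact hq.2
    _ = Q := by simp

/-- `φ(c) d(c) ≥ c`. -/
lemma le_totient_mul_divisors (c : ℕ) (hc : c ≠ 0) : c ≤ c.totient * c.divisors.card := by
  rw [mul_comm, ← smul_eq_mul, ← Finset.sum_const]
  conv_lhs => rw [← Nat.sum_totient c]
  refine Finset.sum_le_sum fun d hd => ?_
  exact Nat.le_of_dvd (Nat.totient_pos.2 (Nat.pos_of_ne_zero hc))
    (Nat.totient_dvd_of_dvd (Nat.dvd_of_mem_divisors hd))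

/-- Kloosterman sum. -/
def kloos (c : ℕ) [NeZero c] (a b : ZMod c) : ℂ :=
  ∑ x : (ZMod c)ˣ, ZMod.stdAddChar (a * (x : ZMod c) + b * ((x⁻¹ : (ZMod c)ˣ) : ZMod c))

lemma kloos_unit (c : ℕ) [NeZero c] (a b : ZMod c) (u : (ZMod c)ˣ) :
    kloos c (a * u) (b * (u⁻¹ : (ZMod c)ˣ)) = kloos c a b := by
  unfold kloos
  refine Fintype.sum_equiv (Equiv.mulLeft u) _ _ fun x => ?_
  simp only [Equiv.coe_mulLeft, mul_inv, Units.val_mul]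
  congr 1; ring

lemma card_mul_eq_zero_le (c : ℕ) [NeZero c] (a : ZMod c) (g : ℕ) (hg : g ≠ 0)
    (h : Nat.gcd a.val c ∣ g) :
    (Finset.univ.filter fun v : ZMod c => a * v = 0).card ≤ g := by
  have hsub : (Finset.univ.filter fun v : ZMod c => a * v = 0) ⊆
      Finset.univ.filter fun v : ZMod c => g • v = 0 := by
    intro v hv
    simp only [Finset.mem_filter, Finset.mem_univ, true_and] at hv ⊢
    obtain ⟨k, rfl⟩ := h
    have hb : ((Nat.gcd a.val c : ℤ) : ZMod c) = a * ((Nat.gcdA a.val c : ℤ) : ZMod c) := by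
      rw [Nat.gcd_eq_gcd_ab]
      push_cast
      simp
    have : ((Nat.gcd a.val c : ℕ) : ZMod c) * v = 0 := by
      have h2 : ((Nat.gcd a.val c : ℕ) : ZMod c) = ((Nat.gcd a.val c : ℤ) : ZMod c) := by push_cast; rfl
      rw [h2, hb]
      linear_combination ((Nat.gcdA a.val c : ℤ) : ZMod c) * hv
    rw [nsmul_eq_mul]
    push_cast
    linear_combination (k : ZMod c) * this
  refine (Finset.card_le_card hsub).trans ?_
  exact IsAddCyclic.card_nsmul_eq_zero_le (Nat.pos_of_ne_zero hg)

/-- `∑_u gcd(u,c) ≤ c d(c)`. -/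
lemma sum_gcd_le (c : ℕ) [NeZero c] :
    ∑ u : ZMod c, Nat.gcd u.val c ≤ c * c.divisors.card := by
  have hc : c ≠ 0 := NeZero.ne c
  have h1 : ∑ u : ZMod c, Nat.gcd u.val c = ∑ u ∈ Finset.range c, Nat.gcd u c := by
    refine Finset.sum_bij (fun u _ => u.val) (fun u _ => by simpa using ZMod.val_lt u)
      (fun u _ v _ h => ZMod.val_injective c h) (fun k hk => ?_) (fun _ _ => rfl)
    exact ⟨(k : ZMod c), Finset.mem_univ _, ZMod.val_cast_of_lt (by simpa using hk)⟩
  rw [h1]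
  calc ∑ u ∈ Finset.range c, Nat.gcd u c
      ≤ ∑ u ∈ Finset.range c, ∑ d ∈ c.divisors, if d ∣ u then d else 0 := by
        refine Finset.sum_le_sum fun u hu => ?_
        have hd : Nat.gcd u c ∈ c.divisors := Nat.mem_divisors.2 ⟨Nat.gcd_dvd_right _ _, hc⟩
        have := Finset.single_le_sum (f := fun d => if d ∣ u then d else 0)
          (fun _ _ => Nat.zero_le _) hd
        simpa [Nat.gcd_dvd_left] using this
    _ = ∑ d ∈ c.divisors, ∑ u ∈ Finset.range c, if d ∣ u then d else 0 := Finset.sum_comm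
    _ ≤ ∑ d ∈ c.divisors, c := by
        refine Finset.sum_le_sum fun d hd => ?_
        obtain ⟨k, rfl⟩ := Nat.dvd_of_mem_divisors hd
        rw [← Finset.sum_filter, Finset.sum_const, smul_eq_mul, mul_comm]
        refine Nat.mul_le_mul_left d ?_
        calc _ ≤ ((Finset.range k).image (fun i => d * i)).card := by
              apply Finset.card_le_card
              intro u hu
              simp only [Finset.mem_filter, Finset.mem_range, Finset.mem_image] at hu ⊢
              obtain ⟨hu1, j, rfl⟩ := hu
              exact ⟨j, lt_of_mul_lt_mul_left hu1 (Nat.zero_le _), rfl⟩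
          _ ≤ k := by simpa using Finset.card_image_le (s := Finset.range k) (f := fun i => d * i)
    _ = c * c.divisors.card := by simp [mul_comm]

lemma parseval_zmod (c : ℕ) [NeZero c] {ι : Type*} [Fintype ι] (f g : ι → ZMod c) :
    ∑ a : ZMod c, ∑ b : ZMod c, ‖∑ i, (ZMod.stdAddChar (a * f i + b * g i) : ℂ)‖ ^ 2 =
      (c : ℝ) ^ 2 * ((Finset.univ.filter fun q : ι × ι => f q.1 = f q.2 ∧ g q.1 = g q.2).card : ℝ) := by
  have hprim := ZMod.isPrimitive_stdAddChar c
  have e1 : ∀ a b : ZMod c, (((‖∑ i, (ZMod.stdAddChar (a * f i + b * g i) : ℂ)‖ ^ 2 : ℝ)) : ℂ) =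
      ∑ q : ι × ι, (ZMod.stdAddChar (a * (f q.1 - f q.2)) : ℂ) *
        (ZMod.stdAddChar (b * (g q.1 - g q.2)) : ℂ) := by
    intro a b
    rw [Fintype.sum_prod_type]
    push_cast
    rw [← Complex.mul_conj', map_sum, Finset.sum_mul_sum]
    refine Finset.sum_congr rfl fun i _ => Finset.sum_congr rfl fun j _ => ?_
    have hconj : (starRingEnd ℂ) (ZMod.stdAddChar (a * f j + b * g j) : ℂ) =
        ZMod.stdAddChar (-(a * f j + b * g j)) := by
      rw [ZMod.stdAddChar_apply, ZMod.stdAddChar_apply, AddChar.map_neg_eq_inv, Circle.coe_inv_eq_conj]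
    rw [hconj, ← AddChar.map_add_eq_mul, ← AddChar.map_add_eq_mul]
    congr 1; ring
  have e2 : ∀ q : ι × ι, ∑ a : ZMod c, ∑ b : ZMod c, (ZMod.stdAddChar (a * (f q.1 - f q.2)) : ℂ) *
        (ZMod.stdAddChar (b * (g q.1 - g q.2)) : ℂ) =
        if f q.1 = f q.2 ∧ g q.1 = g q.2 then (c : ℂ) ^ 2 else 0 := by
    intro q
    rw [← Finset.sum_mul_sum, AddChar.sum_mulShift _ hprim, AddChar.sum_mulShift _ hprim]
    simp only [sub_eq_zero, ZMod.card]
    split_ifs <;> simp_all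
    ring
  have : ((∑ a : ZMod c, ∑ b : ZMod c, ‖∑ i, (ZMod.stdAddChar (a * f i + b * g i) : ℂ)‖ ^ 2 : ℝ) : ℂ) =
      (((c : ℝ) ^ 2 * ((Finset.univ.filter fun q : ι × ι => f q.1 = f q.2 ∧ g q.1 = g q.2).card : ℝ) : ℝ) : ℂ) := by
    rw [Complex.ofReal_sum]
    simp_rw [Complex.ofReal_sum, e1]
    rw [Finset.sum_congr rfl fun a _ => Finset.sum_comm, Finset.sum_comm]
    simp_rw [e2]
    rw [← Finset.sum_filter, Finset.sum_const]
    push_cast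
    rw [nsmul_eq_mul]; ring
  exact_mod_cast this

lemma gcd_val_mul_dvd (c : ℕ) [NeZero c] (u v : ZMod c) :
    Nat.gcd (u * v).val c ∣ Nat.gcd u.val c * Nat.gcd v.val c := by
  have h : Nat.gcd (u.val * v.val % c) c = Nat.gcd c (u.val * v.val) := (Nat.gcd_rec c _).symm
  rw [ZMod.val_mul, h, Nat.gcd_comm u.val, Nat.gcd_comm v.val]
  exact Nat.gcd_mul_right_dvd_mul_gcd c u.val v.val

lemma card_triple_le (c : ℕ) [NeZero c] :
    (Finset.univ.filter fun q : (ZMod c × ZMod c) × ZMod c => q.1.1 * q.1.2 * q.2 = 0).card ≤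
      (c * c.divisors.card) ^ 2 := by
  have hc : c ≠ 0 := NeZero.ne c
  calc _ = ∑ q : ZMod c × ZMod c, (Finset.univ.filter fun w : ZMod c => q.1 * q.2 * w = 0).card := by
        rw [Finset.card_filter, Fintype.sum_prod_type]
        refine Finset.sum_congr rfl fun q _ => ?_
        rw [Finset.card_filter]
    _ ≤ ∑ q : ZMod c × ZMod c, Nat.gcd q.1.val c * Nat.gcd q.2.val c := by
        refine Finset.sum_le_sum fun q _ => ?_
        refine card_mul_eq_zero_le c _ _ ?_ (gcd_val_mul_dvd c _ _)
        have h : ∀ x : ZMod c, Nat.gcd x.val c ≠ 0 := fun x => Nat.gcd_ne_zero_right hc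
        exact mul_ne_zero (h _) (h _)
    _ = (∑ u : ZMod c, Nat.gcd u.val c) ^ 2 := by
        rw [sq, Finset.sum_mul_sum, Fintype.sum_prod_type]
    _ ≤ _ := Nat.pow_le_pow_left (sum_gcd_le c) 2

lemma card_lin_le (c : ℕ) [NeZero c] :
    (Finset.univ.filter fun q : (ZMod c × ZMod c) × ZMod c =>
      (q.1.1 + q.1.2) * (q.2 - q.1.1) * (q.1.2 - q.2) = 0).card ≤
      2 * (c * c.divisors.card) ^ 2 := by
  classical
  set s := (Finset.univ.filter fun q : (ZMod c × ZMod c) × ZMod c =>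
      (q.1.1 + q.1.2) * (q.2 - q.1.1) * (q.1.2 - q.2) = 0) with hs
  let L : (ZMod c × ZMod c) × ZMod c → (ZMod c × ZMod c) × ZMod c :=
    fun q => ((q.1.1 + q.1.2, q.2 - q.1.1), q.1.2 - q.2)
  have h1 := Finset.card_le_mul_card_image (f := L) s 2 (by
    intro y hy
    obtain ⟨q0, hq0, rfl⟩ := Finset.mem_image.1 hy
    calc _ ≤ (Finset.univ.filter fun h : ZMod c => 2 • h = 0).card := by
          apply Finset.card_le_card_of_injOn (fun q => q.1.1 - q0.1.1)
          · intro q hq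
            simp only [Finset.coe_filter, Set.mem_ofPred_eq, L, Prod.mk.injEq] at hq
            obtain ⟨-, ⟨e1, e2⟩, e3⟩ := hq
            simp only [Finset.coe_filter, Set.mem_ofPred_eq, Finset.mem_univ, true_and, nsmul_eq_mul]
            push_cast
            linear_combination e1 - e2 - e3
          · intro q hq q' hq' hqq
            simp only [Finset.coe_filter, Set.mem_ofPred_eq, L, Prod.mk.injEq] at hq hq'
            obtain ⟨-, ⟨e1, e2⟩, e3⟩ := hq
            obtain ⟨-, ⟨e1', e2'⟩, e3'⟩ := hq'
            simp only at hqq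
            refine Prod.ext (Prod.ext ?_ ?_) ?_
            · linear_combination hqq
            · linear_combination e1 - e1' - hqq
            · linear_combination e2 - e2' + hqq
      _ ≤ 2 := IsAddCyclic.card_nsmul_eq_zero_le (by norm_num))
  refine h1.trans (Nat.mul_le_mul_left 2 ?_)
  refine le_trans (Finset.card_le_card ?_) (card_triple_le c)
  intro y hy
  obtain ⟨q0, hq0, rfl⟩ := Finset.mem_image.1 hy
  simp only [hs, Finset.mem_filter, Finset.mem_univ, true_and] at hq0 ⊢
  exact hq0

lemma card_quad_le (c : ℕ) [NeZero c] :
    (Finset.univ.filter fun q : ((ZMod c)ˣ × (ZMod c)ˣ) × ((ZMod c)ˣ × (ZMod c)ˣ) =>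
      ((q.1.1 : ZMod c) + q.1.2 = q.2.1 + q.2.2) ∧
      (((q.1.1⁻¹ : (ZMod c)ˣ) : ZMod c) + (q.1.2⁻¹ : (ZMod c)ˣ) =
        (q.2.1⁻¹ : (ZMod c)ˣ) + (q.2.2⁻¹ : (ZMod c)ˣ))).card ≤
      2 * (c * c.divisors.card) ^ 2 := by
  refine le_trans ?_ (card_lin_le c)
  apply Finset.card_le_card_of_injOn (fun q => (((q.1.1 : ZMod c), (q.1.2 : ZMod c)), (q.2.1 : ZMod c)))
  · rintro ⟨⟨x1, x2⟩, ⟨x3, x4⟩⟩ hq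
    simp only [Finset.coe_filter, Set.mem_ofPred_eq, Finset.mem_univ, true_and] at hq ⊢
    obtain ⟨e1, e2⟩ := hq
    have i1 := x1.mul_inv
    have i2 := x2.mul_inv
    have i3 := x3.mul_inv
    have i4 := x4.mul_inv
    generalize ((x1⁻¹ : (ZMod c)ˣ) : ZMod c) = y1 at *
    generalize ((x2⁻¹ : (ZMod c)ˣ) : ZMod c) = y2 at *
    generalize ((x3⁻¹ : (ZMod c)ˣ) : ZMod c) = y3 at *
    generalize ((x4⁻¹ : (ZMod c)ˣ) : ZMod c) = y4 at *
    generalize (x1 : ZMod c) = z1 at *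
    generalize (x2 : ZMod c) = z2 at *
    generalize (x3 : ZMod c) = z3 at *
    generalize (x4 : ZMod c) = z4 at *
    have e3 : (z1 + z2) * z3 * z4 = (z3 + z4) * z1 * z2 := by
      have := congrArg (fun t => t * (z1 * z2 * z3 * z4)) e2
      have l : (y1 + y2) * (z1 * z2 * z3 * z4) = (z1 + z2) * z3 * z4 := by
        linear_combination (z2 * z3 * z4) * i1 + (z1 * z3 * z4) * i2
      have r : (y3 + y4) * (z1 * z2 * z3 * z4) = (z3 + z4) * z1 * z2 := by
        linear_combination (z1 * z2 * z4) * i3 + (z1 * z2 * z3) * i4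
      rw [← l, ← r, this]
    have e4 : z4 = z1 + z2 - z3 := by linear_combination -e1
    subst e4
    linear_combination e3
  · rintro ⟨⟨x1, x2⟩, ⟨x3, x4⟩⟩ hq ⟨⟨x1', x2'⟩, ⟨x3', x4'⟩⟩ hq' h
    simp only [Finset.coe_filter, Set.mem_ofPred_eq, Finset.mem_univ, true_and, Prod.mk.injEq] at hq hq' h ⊢
    obtain ⟨⟨h1, h2⟩, h3⟩ := h
    refine ⟨⟨Units.ext h1, Units.ext h2⟩, Units.ext h3, Units.ext ?_⟩
    linear_combination hq'.1 - hq.1 + h1 + h2 - h3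

lemma kloos_fourth_moment (c : ℕ) [NeZero c] :
    ∑ a : ZMod c, ∑ b : ZMod c, ‖kloos c a b‖ ^ 4 ≤
      (c : ℝ) ^ 2 * (2 * (c * c.divisors.card) ^ 2) := by
  have h := parseval_zmod c (ι := (ZMod c)ˣ × (ZMod c)ˣ)
    (fun x => (x.1 : ZMod c) + x.2)
    (fun x => ((x.1⁻¹ : (ZMod c)ˣ) : ZMod c) + (x.2⁻¹ : (ZMod c)ˣ))
  have e : ∀ a b : ZMod c, ‖kloos c a b‖ ^ 4 = ‖∑ x : (ZMod c)ˣ × (ZMod c)ˣ,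
      (ZMod.stdAddChar (a * ((x.1 : ZMod c) + (x.2 : ZMod c)) +
        b * (((x.1⁻¹ : (ZMod c)ˣ) : ZMod c) + ((x.2⁻¹ : (ZMod c)ˣ) : ZMod c))) : ℂ)‖ ^ 2 := by
    intro a b
    have : kloos c a b ^ 2 = ∑ x : (ZMod c)ˣ × (ZMod c)ˣ,
      (ZMod.stdAddChar (a * ((x.1 : ZMod c) + (x.2 : ZMod c)) +
        b * (((x.1⁻¹ : (ZMod c)ˣ) : ZMod c) + ((x.2⁻¹ : (ZMod c)ˣ) : ZMod c))) : ℂ) := by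
      rw [Fintype.sum_prod_type, sq, kloos, Finset.sum_mul_sum]
      refine Finset.sum_congr rfl fun i _ => Finset.sum_congr rfl fun j _ => ?_
      rw [← AddChar.map_add_eq_mul]
      congr 1; ring
    rw [← this, norm_pow]; ring
  simp_rw [e]
  rw [h]
  gcongr
  exact_mod_cast card_quad_le c

lemma sum_comp_le_of_fiber {α β : Type*} [Fintype α] [Fintype β] [DecidableEq β] (h : α → β) (F : β → ℝ)
    (hF : ∀ b, 0 ≤ F b) (n : ℕ)
    (hn : ∀ a0, (Finset.univ.filter fun a => h a = h a0).card ≤ n) :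
    ∑ a, F (h a) ≤ n * ∑ b, F b := by
  classical
  rw [Finset.sum_comp F h, Finset.mul_sum]
  refine (Finset.sum_le_sum (g := fun q => (n : ℝ) * F q) ?_).trans
      (Finset.sum_le_sum_of_subset_of_nonneg (Finset.subset_univ _) fun b _ _ =>
        mul_nonneg (Nat.cast_nonneg _) (hF b))
  intro y hy
  obtain ⟨u0, -, rfl⟩ := Finset.mem_image.1 hy
  rw [nsmul_eq_mul]
  exact mul_le_mul_of_nonneg_right (by exact_mod_cast hn u0) (hF _)

lemma kloos_bound (c : ℕ) [NeZero c] (a : ZMod c) (b : ℤ) (hb : b ≠ 0) :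
    ‖kloos c a b‖ ^ 4 ≤ 2 * |(b : ℝ)| * (c : ℝ) ^ 3 * (c.divisors.card : ℝ) ^ 3 := by
  classical
  have hc : c ≠ 0 := NeZero.ne c
  have h1 : (c.totient : ℝ) * ‖kloos c a b‖ ^ 4 =
      ∑ u : (ZMod c)ˣ, ‖kloos c (a * u) ((b : ZMod c) * (u⁻¹ : (ZMod c)ˣ))‖ ^ 4 := by
    simp_rw [kloos_unit]
    rw [Finset.sum_const, Finset.card_univ, ZMod.card_units_eq_totient, nsmul_eq_mul]
  have h2 : ∑ u : (ZMod c)ˣ, ‖kloos c (a * u) ((b : ZMod c) * (u⁻¹ : (ZMod c)ˣ))‖ ^ 4 ≤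
      (b.natAbs : ℝ) * ∑ q : ZMod c × ZMod c, ‖kloos c q.1 q.2‖ ^ 4 := by
    refine sum_comp_le_of_fiber
      (fun u : (ZMod c)ˣ => (a * (u : ZMod c), (b : ZMod c) * ((u⁻¹ : (ZMod c)ˣ) : ZMod c)))
      (fun q : ZMod c × ZMod c => ‖kloos c q.1 q.2‖ ^ 4) (fun q => pow_nonneg (norm_nonneg _) 4) b.natAbs ?_
    intro u0
    refine le_trans ?_ (card_mul_eq_zero_le c (b : ZMod c) b.natAbs (by simpa using hb) ?_)
    · apply Finset.card_le_card_of_injOn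
        (fun u : (ZMod c)ˣ => ((u⁻¹ : (ZMod c)ˣ) : ZMod c) - (u0⁻¹ : (ZMod c)ˣ))
      · intro u hu
        simp only [Finset.coe_filter, Set.mem_ofPred_eq, Finset.mem_univ, true_and, Prod.mk.injEq] at hu ⊢
        linear_combination hu.2
      · intro u hu v hv huv
        simp only at huv
        have : ((u⁻¹ : (ZMod c)ˣ) : ZMod c) = (v⁻¹ : (ZMod c)ˣ) := by linear_combination huv
        exact inv_injective (Units.ext this)
    · have h3 : ((Nat.gcd (b : ZMod c).val c : ℕ) : ℤ) ∣ b := by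
        have e1 : (((b : ZMod c).val : ℕ) : ℤ) = b % c := ZMod.val_intCast b
        have d1 : ((Nat.gcd (b : ZMod c).val c : ℕ) : ℤ) ∣ b % c := by
          rw [← e1]; exact_mod_cast Nat.gcd_dvd_left _ _
        have d2 : ((Nat.gcd (b : ZMod c).val c : ℕ) : ℤ) ∣ c := by exact_mod_cast Nat.gcd_dvd_right _ _
        have d3 := dvd_add d1 (d2.mul_right (b / c))
        rwa [Int.emod_add_mul_ediv b c] at d3
      exact Int.natCast_dvd.1 h3
  have h3 := kloos_fourth_moment c
  rw [Fintype.sum_prod_type] at h2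
  have h4 : (c.totient : ℝ) * ‖kloos c a b‖ ^ 4 ≤
      (b.natAbs : ℝ) * ((c : ℝ) ^ 2 * (2 * (c * c.divisors.card) ^ 2)) := by
    rw [h1]; exact h2.trans (by gcongr)
  have h5 : (c : ℝ) ≤ c.totient * c.divisors.card := by exact_mod_cast le_totient_mul_divisors c hc
  have hcp : (0 : ℝ) < c := by exact_mod_cast Nat.pos_of_ne_zero hc
  have hb' : (b.natAbs : ℝ) = |(b : ℝ)| := by
    rw [← Int.cast_abs, Int.abs_eq_natAbs]; simp
  rw [hb'] at h4
  have : (c : ℝ) * ‖kloos c a b‖ ^ 4 ≤ c * (2 * |(b : ℝ)| * (c : ℝ) ^ 3 * (c.divisors.card : ℝ) ^ 3) := by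
    calc (c : ℝ) * ‖kloos c a b‖ ^ 4 ≤ (c.totient * c.divisors.card) * ‖kloos c a b‖ ^ 4 := by gcongr
      _ = c.divisors.card * (c.totient * ‖kloos c a b‖ ^ 4) := by ring
      _ ≤ c.divisors.card * (|(b : ℝ)| * ((c : ℝ) ^ 2 * (2 * (c * c.divisors.card) ^ 2))) := by gcongr
      _ = _ := by ring
  exact le_of_mul_le_mul_left this hcp

/-- integer matrices as elements of GL2(R) (junk value `1` when the determinant vanishes). -/
def iGL (A : Matrix (Fin 2) (Fin 2) ℤ) : GL (Fin 2) ℝ :=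
  if h : (A.map (Int.cast : ℤ → ℝ)).det ≠ 0 then Matrix.GeneralLinearGroup.mkOfDetNeZero _ h else 1

lemma det_map_cast (A : Matrix (Fin 2) (Fin 2) ℤ) : (A.map (Int.cast : ℤ → ℝ)).det = (A.det : ℝ) := by
  simp [Matrix.det_fin_two]

lemma iGL_val {A : Matrix (Fin 2) (Fin 2) ℤ} (h : A.det ≠ 0) :
    (iGL A).val = A.map (Int.cast : ℤ → ℝ) := by
  have : (A.map (Int.cast : ℤ → ℝ)).det ≠ 0 := by rw [det_map_cast]; exact_mod_cast h
  rw [iGL, dif_pos this]; rfl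

lemma iGL_mul {A B : Matrix (Fin 2) (Fin 2) ℤ} (hA : A.det ≠ 0) (hB : B.det ≠ 0) :
    iGL (A * B) = iGL A * iGL B := by
  have h : (A * B).det ≠ 0 := by rw [Matrix.det_mul]; exact mul_ne_zero hA hB
  apply Units.ext
  rw [Units.val_mul, iGL_val h, iGL_val hA, iGL_val hB]
  exact Matrix.map_mul_intCast ..

lemma iGL_SL (γ : SL(2, ℤ)) (z : ℍ) : iGL γ.1 • z = γ • z := by
  rw [ModularGroup.sl_moeb]
  congr 1
  apply Units.ext
  rw [iGL_val (by rw [γ.2]; exact one_ne_zero)]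
  rfl

lemma coe_iGL_smul {A : Matrix (Fin 2) (Fin 2) ℤ} (h : 0 < A.det) (z : ℍ) :
    ((iGL A • z : ℍ) : ℂ) = (A 0 0 * z + A 0 1) / (A 1 0 * z + A 1 1) := by
  have hv := iGL_val h.ne'
  rw [coe_smul_of_det_pos]
  · simp [num, denom, hv]
  · rw [Matrix.GeneralLinearGroup.val_det_apply, hv, det_map_cast]; exact_mod_cast h

lemma im_iGL_smul {A : Matrix (Fin 2) (Fin 2) ℤ} (h : 0 < A.det) (z : ℍ) :
    (iGL A • z : ℍ).im = A.det * z.im / Complex.normSq (A 1 0 * z + A 1 1) := by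
  have hv := iGL_val h.ne'
  rw [im_smul_eq_div_normSq]
  rw [Matrix.GeneralLinearGroup.val_det_apply, hv, det_map_cast, abs_of_pos (by exact_mod_cast h)]
  simp [denom, hv]

lemma iGL_adj_smul {A : Matrix (Fin 2) (Fin 2) ℤ} (h : 0 < A.det) (z : ℍ) :
    iGL A.adjugate • iGL A • z = z := by
  have h' : A.adjugate.det ≠ 0 := by
    rw [Matrix.det_adjugate]; exact pow_ne_zero _ h.ne'
  rw [← mul_smul, ← iGL_mul h' h.ne', Matrix.adjugate_mul]
  have h2 : (A.det • (1 : Matrix (Fin 2) (Fin 2) ℤ)).det = A.det ^ 2 := by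
    rw [Matrix.det_smul]; simp
  ext
  rw [coe_iGL_smul (by rw [h2]; positivity)]
  have : (A.det : ℂ) ≠ 0 := by exact_mod_cast h.ne'
  simp [this]

lemma iGL_inv_smul {A : Matrix (Fin 2) (Fin 2) ℤ} (h : 0 < A.det) (z : ℍ) :
    (iGL A)⁻¹ • z = iGL A.adjugate • z := by
  rw [inv_smul_eq_iff]
  have h' : 0 < A.adjugate.det := by
    rw [Matrix.det_adjugate]; simpa using h
  have := iGL_adj_smul h' z
  rw [Matrix.adjugate_adjugate _ (by simp)] at this
  simpa using this.symm

instance : MeasurableConstSMul (GL (Fin 2) ℝ) ℍ := inferInstance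

instance : MeasurableConstSMul SL(2, ℤ) ℍ :=
  ⟨fun c => measurable_const_smul (Matrix.SpecialLinearGroup.map (Int.castRingHom ℝ) c : GL (Fin 2) ℝ)⟩

instance : SMulInvariantMeasure SL(2, ℤ) ℍ volume :=
  ⟨fun c _ hs => SMulInvariantMeasure.measure_preimage_smul
    (Matrix.SpecialLinearGroup.map (Int.castRingHom ℝ) c : GL (Fin 2) ℝ) hs⟩

/-- coordinates -/
def mkH (q : ℝ × ℝ) : ℍ := if h : 0 < q.2 then ⟨⟨q.1, q.2⟩, h⟩ else I

lemma mkH_of_pos {q : ℝ × ℝ} (h : 0 < q.2) : ((mkH q : ℍ) : ℂ) = ⟨q.1, q.2⟩ := by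
  rw [mkH, dif_pos h]

lemma mkH_re {q : ℝ × ℝ} (h : 0 < q.2) : (mkH q).re = q.1 := by
  have := congrArg Complex.re (mkH_of_pos h); exact this
lemma mkH_im {q : ℝ × ℝ} (h : 0 < q.2) : (mkH q).im = q.2 := by
  have := congrArg Complex.im (mkH_of_pos h); exact this

lemma measurable_mkH : Measurable mkH := by
  have : Measurable (fun q : ℝ × ℝ => ((mkH q : ℍ) : ℂ)) := by
    have e : (fun q : ℝ × ℝ => ((mkH q : ℍ) : ℂ)) = fun q : ℝ × ℝ =>
        if 0 < q.2 then (q.1 + q.2 * Complex.I : ℂ) else Complex.I := by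
      ext q
      split_ifs with h
      · rw [mkH_of_pos h]; apply Complex.ext <;> simp
      · simp [mkH, h]
    rw [e]
    refine Measurable.ite (measurableSet_lt measurable_const measurable_snd) ?_ measurable_const
    fun_prop
  exact measurableEmbedding_coe.measurable_comp_iff.1 this

/-- the measure `dy / y^2` on the positive half-line -/
def nuY : Measure ℝ := (volume.restrict (Set.Ioi 0)).withDensity fun y => ENNReal.ofReal (1 / y ^ 2)

instance : SFinite nuY := by unfold nuY; infer_instance

lemma lintegral_nuY (f : ℝ → ENNReal) (hf : Measurable f) :
    ∫⁻ y, f y ∂nuY = ∫⁻ y in Set.Ioi 0, ENNReal.ofReal (1 / y ^ 2) * f y := by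
  rw [nuY, lintegral_withDensity_eq_lintegral_mul _ (by fun_prop) hf]
  rfl

lemma volume_eq_map : (volume : Measure ℍ) = (volume.prod nuY).map mkH := by
  ext s hs
  rw [Measure.map_apply measurable_mkH hs, volume_eq_lintegral]
  have hms : MeasurableSet ((UpperHalfPlane.coe) '' s : Set ℂ) :=
    measurableEmbedding_coe.measurableSet_image.2 hs
  rw [← lintegral_indicator hms]
  have h1 := Complex.volume_preserving_equiv_real_prod.symm.lintegral_comp_emb
    Complex.measurableEquivRealProd.symm.measurableEmbedding
    (((UpperHalfPlane.coe) '' s).indicator fun z : ℂ => (((1 / ‖z.im‖₊) ^ 2 : NNReal) : ENNReal))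
  rw [← h1]
  rw [nuY, Measure.prod_apply (measurable_mkH hs)]
  have hmeas : Measurable fun q : ℝ × ℝ => (((UpperHalfPlane.coe) '' s).indicator
      (fun z : ℂ => (((1 / ‖z.im‖₊) ^ 2 : NNReal) : ENNReal)) (Complex.measurableEquivRealProd.symm q)) := by
    refine (Measurable.indicator ?_ hms).comp Complex.measurableEquivRealProd.symm.measurable
    fun_prop
  rw [Measure.volume_eq_prod, lintegral_prod _ hmeas.aemeasurable]
  refine lintegral_congr fun x => ?_
  have hmx : MeasurableSet (Prod.mk x ⁻¹' (mkH ⁻¹' s)) := measurable_prodMk_left (measurable_mkH hs)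
  rw [withDensity_apply _ hmx, Measure.restrict_restrict hmx, ← lintegral_indicator (hmx.inter measurableSet_Ioi)]
  refine lintegral_congr fun y => ?_
  have e : Complex.measurableEquivRealProd.symm (x, y) = (⟨x, y⟩ : ℂ) := rfl
  rw [e]
  by_cases hy : 0 < y
  · have : (⟨x, y⟩ : ℂ) = ((mkH (x, y) : ℍ) : ℂ) := (mkH_of_pos (q := (x, y)) hy).symm
    by_cases hm : mkH (x, y) ∈ s
    · rw [Set.indicator_of_mem, Set.indicator_of_mem]
      · rw [ENNReal.ofReal]
        congr 1
        apply NNReal.eq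
        simp [abs_of_pos hy, Real.coe_toNNReal']
        positivity
      · exact ⟨hm, hy⟩
      · rw [this]; exact ⟨_, hm, rfl⟩
    · rw [Set.indicator_of_notMem, Set.indicator_of_notMem]
      · exact fun h => hm h.1
      · rw [this]; rintro ⟨w, hw, hw'⟩
        exact hm (UpperHalfPlane.ext hw' ▸ hw)
  · rw [Set.indicator_of_notMem, Set.indicator_of_notMem]
    · exact fun h => hy h.2
    · rintro ⟨w, hw, hw'⟩
      have h2 : w.im = y := congrArg Complex.im hw'
      exact hy (h2 ▸ w.im_pos)

def box (α : ℝ) : Set ℍ := {z | 0 ≤ z.re ∧ z.re < 1 ∧ α ≤ z.im}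

lemma measurable_re : Measurable UpperHalfPlane.re := Complex.measurable_re.comp measurable_coe
lemma measurable_im : Measurable UpperHalfPlane.im := Complex.measurable_im.comp measurable_coe

lemma measurableSet_box (α : ℝ) : MeasurableSet (box α) :=
  (measurableSet_le measurable_const measurable_re).inter
    ((measurableSet_lt measurable_re measurable_const).inter
      (measurableSet_le measurable_const measurable_im))

lemma SL_im (γ : SL(2, ℤ)) (z : ℍ) :
    (γ • z).im = z.im / ((γ 1 0 * z.re + γ 1 1) ^ 2 + (γ 1 0 * z.im) ^ 2) := by
  rw [ModularGroup.im_smul_eq_div_normSq, ModularGroup.denom_apply, Complex.normSq_apply]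
  simp
  ring

lemma SL_eq_T_zpow_mul {γ γ' : SL(2, ℤ)} (h0 : γ 1 0 = γ' 1 0) (h1 : γ 1 1 = γ' 1 1) :
    ∃ n : ℤ, γ' = ModularGroup.T ^ n * γ := by
  refine ⟨γ' 0 1 * γ 0 0 - γ' 0 0 * γ 0 1, ?_⟩
  have d1 := γ.2
  have d2 := γ'.2
  rw [Matrix.det_fin_two] at d1 d2
  have hA : γ 0 0 * γ 1 1 - γ 0 1 * γ 1 0 = 1 := d1
  have hB : γ' 0 0 * γ' 1 1 - γ' 0 1 * γ' 1 0 = 1 := d2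
  rw [← h0, ← h1] at hB
  ext i j
  rw [Matrix.SpecialLinearGroup.coe_mul, ModularGroup.coe_T_zpow]
  fin_cases i <;> fin_cases j <;> simp [Matrix.mul_apply, Fin.sum_univ_two]
  · linear_combination -γ' 0 0 * hA + γ 0 0 * hB
  · linear_combination -γ' 0 1 * hA + γ 0 1 * hB
  · exact h0.symm
  · exact h1.symm

instance countable_SL2Z : Countable SL(2, ℤ) :=
  Function.Injective.countable (β := Fin 2 → Fin 2 → ℤ) (f := fun γ : SL(2, ℤ) => fun i j => γ.1 i j)
    fun γ γ' h => by ext i j; exact congrFun (congrFun h i) j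

lemma row_inj {α : ℝ} {z : ℍ} {γ γ' : SL(2, ℤ)} (h : γ • z ∈ box α) (h' : γ' • z ∈ box α)
    (h0 : γ 1 0 = γ' 1 0) (h1 : γ 1 1 = γ' 1 1) : γ = γ' := by
  obtain ⟨n, rfl⟩ := SL_eq_T_zpow_mul h0 h1
  rw [mul_smul] at h'
  obtain ⟨a1, a2, -⟩ := h
  obtain ⟨b1, b2, -⟩ := h'
  rw [ModularGroup.re_T_zpow_smul] at b1 b2
  have c1 : ((-1 : ℤ) : ℝ) < n := by push_cast; linarith
  have c2 : (n : ℝ) < ((1 : ℤ) : ℝ) := by push_cast; linarith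
  have c1' := Int.cast_lt.1 c1
  have c2' := Int.cast_lt.1 c2
  have : n = 0 := by omega
  simp [this]

lemma row_surj {α : ℝ} {z : ℍ} (γ : SL(2, ℤ)) (h : α ≤ (γ • z).im) :
    ∃ γ' : SL(2, ℤ), γ' • z ∈ box α ∧ γ' 1 0 = γ 1 0 ∧ γ' 1 1 = γ 1 1 ∧
      ∃ n : ℤ, γ' = ModularGroup.T ^ n * γ := by
  refine ⟨ModularGroup.T ^ (-⌊(γ • z).re⌋) * γ, ?_, ?_, ?_, _, rfl⟩
  · rw [mul_smul]
    refine ⟨?_, ?_, ?_⟩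
    · rw [ModularGroup.re_T_zpow_smul]; push_cast; linarith [Int.floor_le (γ • z).re]
    · rw [ModularGroup.re_T_zpow_smul]; push_cast; linarith [Int.lt_floor_add_one (γ • z).re]
    · rwa [ModularGroup.im_T_zpow_smul]
  · simp [Matrix.SpecialLinearGroup.coe_mul, ModularGroup.coe_T_zpow, Matrix.mul_apply, Fin.sum_univ_two]
  · simp [Matrix.SpecialLinearGroup.coe_mul, ModularGroup.coe_T_zpow, Matrix.mul_apply, Fin.sum_univ_two]

def cntB (α : ℝ) : ℕ := (2 * (⌈2 / α⌉₊ + 3) + 1) ^ 2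

lemma card_box_le_aux {α : ℝ} (hα : 0 < α) {z : ℍ} (hz : 1 / 2 ≤ z.im) (s : Finset SL(2, ℤ))
    (hs : ∀ γ ∈ s, γ • z ∈ box α) : s.card ≤ cntB α := by
  set M : ℤ := ⌈2 / α⌉₊ + 3 with hM
  have hMr : 2 / α + 3 ≤ (M : ℝ) := by
    rw [hM]; push_cast; linarith [Nat.le_ceil (2 / α)]
  have hcard : ((Finset.Icc (-M) M) ×ˢ (Finset.Icc (-M) M)).card = cntB α := by
    rw [Finset.card_product, Int.card_Icc, cntB, sq]
    congr 1 <;> omega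
  rw [← hcard]
  apply Finset.card_le_card_of_injOn (fun γ => (γ 1 0, γ 1 1 + ⌊(γ 1 0 : ℝ) * z.re⌋))
  · intro γ hγ
    obtain ⟨-, -, h⟩ := hs γ hγ
    rw [SL_im] at h
    have hpos : 0 < ((γ 1 0 * z.re + γ 1 1) ^ 2 + (γ 1 0 * z.im) ^ 2 : ℝ) := by
      by_contra hne
      have : ((γ 1 0 * z.re + γ 1 1) ^ 2 + (γ 1 0 * z.im) ^ 2 : ℝ) = 0 :=
        le_antisymm (not_lt.1 hne) (by positivity)
      rw [this, div_zero] at h; linarith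
    rw [le_div_iff₀ hpos] at h
    have hy : 0 < z.im := z.im_pos
    set c : ℝ := ((γ 1 0 : ℤ) : ℝ)
    set d : ℝ := ((γ 1 1 : ℤ) : ℝ)
    have hc : c ^ 2 * α ≤ 2 := by
      have : α * c ^ 2 * z.im ≤ 1 := by
        have : α * (c * z.im) ^ 2 ≤ z.im := by nlinarith [mul_nonneg hα.le (sq_nonneg (c * z.re + d))]
        have : (α * c ^ 2 * z.im) * z.im ≤ 1 * z.im := by linarith
        exact le_of_mul_le_mul_right this hy
      nlinarith [mul_nonneg hα.le (sq_nonneg c)]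
    have hc2 : c ^ 2 ≤ 2 / α := by rw [le_div_iff₀ hα]; exact hc
    have hcabs : |c| ≤ M := by
      have : |c| ^ 2 = c ^ 2 := sq_abs c
      nlinarith [abs_nonneg c]
    have hcd : |c * z.re + d| ≤ 1 / α + 1 := by
      by_cases hc0 : (γ 1 0 : ℤ) = 0
      · have hd := γ.2
        rw [Matrix.det_fin_two, hc0] at hd
        have hd' : (γ 1 1 : ℤ) * γ 0 0 = 1 := by linarith
        have : |(γ 1 1 : ℤ)| = 1 := Int.isUnit_iff_abs_eq.1 (IsUnit.of_mul_eq_one _ hd')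
        have e : |d| = 1 := by simp only [d]; exact_mod_cast this
        have : c = 0 := by simp [c, hc0]
        rw [this, zero_mul, zero_add, e]
        have : 0 < 1 / α := by positivity
        linarith
      · have h1 : 1 ≤ c ^ 2 := by
          have : 1 ≤ (γ 1 0 : ℤ) ^ 2 := by
            have := sq_nonneg (γ 1 0 : ℤ)
            have := pow_ne_zero 2 hc0
            omega
          simp only [c]; exact_mod_cast this
        have h2 : α * z.im ≤ 1 := by
          have : (α * z.im) * z.im ≤ 1 * z.im := by
            have : α * (c * z.im) ^ 2 ≤ z.im := by nlinarith [mul_nonneg hα.le (sq_nonneg (c * z.re + d))]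
            have : α * z.im ^ 2 * c ^ 2 ≤ z.im := by linarith
            have : α * z.im ^ 2 * 1 ≤ α * z.im ^ 2 * c ^ 2 := by gcongr
            linarith
          exact le_of_mul_le_mul_right this hy
        have h3 : (α * (c * z.re + d)) ^ 2 ≤ 1 := by
          have : α * (c * z.re + d) ^ 2 ≤ z.im := by nlinarith [mul_nonneg hα.le (sq_nonneg (c * z.im))]
          nlinarith
        have h4 : |α * (c * z.re + d)| ≤ 1 := by
          rwa [← sq_le_one_iff_abs_le_one]
        rw [abs_mul, abs_of_pos hα] at h4
        have : |c * z.re + d| ≤ 1 / α := by rw [le_div_iff₀ hα]; linarith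
        linarith
    have hfl1 := Int.floor_le (c * z.re)
    have hfl2 := Int.lt_floor_add_one (c * z.re)
    rw [abs_le] at hcd hcabs
    have h12 : 1 / α ≤ 2 / α := by gcongr; norm_num
    simp only [Finset.coe_product, Finset.coe_Icc, Set.mem_prod, Set.mem_Icc]
    refine ⟨⟨?_, ?_⟩, ?_, ?_⟩
    · have := hcabs.1; simp only [c] at this; exact_mod_cast this
    · have := hcabs.2; simp only [c] at this; exact_mod_cast this
    · have : -(M : ℝ) ≤ d + ⌊c * z.re⌋ := by linarith
      simp only [c, d] at this; exact_mod_cast this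
    · have : d + ⌊c * z.re⌋ ≤ (M : ℝ) := by linarith
      simp only [c, d] at this; exact_mod_cast this
  · intro γ hγ γ' hγ' he
    simp only [Prod.mk.injEq] at he
    have h0 := he.1
    have h1 := he.2
    rw [h0] at h1
    exact row_inj (hs γ hγ) (hs γ' hγ') h0 (by omega)

lemma card_box_le {α : ℝ} (hα : 0 < α) (z : ℍ) (s : Finset SL(2, ℤ))
    (hs : ∀ γ ∈ s, γ • z ∈ box α) : s.card ≤ cntB α := by
  classical
  obtain ⟨g, hg⟩ := ModularGroup.exists_one_half_le_im_smul z
  have := card_box_le_aux hα hg (s.map (Equiv.mulRight g⁻¹).toEmbedding) (by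
    intro γ hγ
    obtain ⟨δ, hδ, rfl⟩ := Finset.mem_map.1 hγ
    simp only [Equiv.coe_toEmbedding, Equiv.coe_mulRight]
    rw [← mul_smul]; simpa using hs δ hδ)
  simpa using this

lemma finite_box {α : ℝ} (hα : 0 < α) (z : ℍ) : {γ : SL(2, ℤ) | γ • z ∈ box α}.Finite := by
  by_contra h
  obtain ⟨s, hs, hc⟩ := Set.Infinite.exists_subset_card_eq h (cntB α + 1)
  have := card_box_le hα z s (fun γ hγ => hs hγ)
  omega

/-- number of translates in the box -/
def cnt (α : ℝ) (z : ℍ) : ENNReal := ∑' γ : SL(2, ℤ), (box α).indicator 1 (γ • z)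

lemma cnt_le {α : ℝ} (hα : 0 < α) (z : ℍ) : cnt α z ≤ cntB α := by
  classical
  rw [cnt, ENNReal.tsum_eq_iSup_sum]
  refine iSup_le fun s => ?_
  have : ∑ γ ∈ s, (box α).indicator (1 : ℍ → ENNReal) (γ • z) = ((s.filter fun γ => γ • z ∈ box α).card : ENNReal) := by
    rw [Finset.card_filter]; push_cast
    refine Finset.sum_congr rfl fun γ _ => ?_
    by_cases h : γ • z ∈ box α <;> simp [h, -ModularGroup.sl_moeb]
  rw [this]
  exact_mod_cast card_box_le hα z _ (fun γ hγ => (Finset.mem_filter.1 hγ).2)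

lemma cnt_smul (α : ℝ) (g : SL(2, ℤ)) (z : ℍ) : cnt α (g • z) = cnt α z := by
  rw [cnt, cnt, ← (Equiv.mulRight g).tsum_eq (fun γ => (box α).indicator (1 : ℍ → ENNReal) (γ • z))]
  simp only [Equiv.coe_mulRight, mul_smul]

lemma one_le_cnt (z : ℍ) : 1 ≤ cnt (1 / 2) z := by
  obtain ⟨g, hg⟩ := ModularGroup.exists_one_half_le_im_smul z
  obtain ⟨γ, hγ, -⟩ := row_surj g hg
  refine le_trans ?_ (ENNReal.le_tsum γ)
  rw [Set.indicator_of_mem hγ]; rfl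

lemma measurable_cnt (α : ℝ) : Measurable (cnt α) := by
  unfold cnt
  refine Measurable.tsum fun γ => ?_
  exact (measurable_one.indicator (measurableSet_box α)).comp (measurable_const_smul γ)

def phi (z : ℍ) : ENNReal := (box (1 / 2)).indicator 1 z / cnt (1 / 2) z

lemma measurable_phi : Measurable phi :=
  (measurable_one.indicator (measurableSet_box _)).div (measurable_cnt _)

lemma tsum_phi (z : ℍ) : ∑' γ : SL(2, ℤ), phi (γ • z) = 1 := by
  simp only [phi, cnt_smul, div_eq_mul_inv]
  rw [ENNReal.tsum_mul_right]
  have h1 := one_le_cnt z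
  have h2 := cnt_le (α := 1 / 2) (by norm_num) z
  exact ENNReal.mul_inv_cancel (by positivity) (ne_top_of_le_ne_top (by simp) h2)

lemma phi_le (z : ℍ) : phi z ≤ (box (1 / 2)).indicator 1 z := by
  unfold phi
  exact ENNReal.div_le_of_le_mul (le_mul_of_one_le_right zero_le (one_le_cnt z))

/-- unfolding -/
lemma unfold_lintegral (h : ℍ → ENNReal) (hh : Measurable h) :
    ∫⁻ z, phi z * ∑' γ : SL(2, ℤ), h (γ • z) = ∫⁻ z, h z := by
  have hm : ∀ γ : SL(2, ℤ), Measurable fun z : ℍ => γ • z := fun γ => measurable_const_smul γ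
  calc _ = ∫⁻ z, ∑' γ : SL(2, ℤ), phi z * h (γ • z) := by
        refine lintegral_congr fun z => ?_
        rw [ENNReal.tsum_mul_left]
    _ = ∑' γ : SL(2, ℤ), ∫⁻ z, phi z * h (γ • z) := by
        rw [lintegral_tsum]
        exact fun γ => (measurable_phi.mul (hh.comp (hm γ))).aemeasurable
    _ = ∑' γ : SL(2, ℤ), ∫⁻ z, phi (γ⁻¹ • z) * h z := by
        refine tsum_congr fun γ => ?_
        have := (measurePreserving_smul γ⁻¹ (volume : Measure ℍ)).lintegral_comp
          (f := fun z => phi z * h (γ • z)) (measurable_phi.mul (hh.comp (hm γ)))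
        rw [← this]
        simp only [smul_inv_smul]
    _ = ∑' γ : SL(2, ℤ), ∫⁻ z, phi (γ • z) * h z :=
        (Equiv.inv SL(2, ℤ)).tsum_eq (fun γ => ∫⁻ z, phi (γ • z) * h z)
    _ = ∫⁻ z, ∑' γ : SL(2, ℤ), phi (γ • z) * h z := by
        rw [lintegral_tsum]
        exact fun γ => ((measurable_phi.comp (hm γ)).mul hh).aemeasurable
    _ = _ := by
        refine lintegral_congr fun z => ?_
        rw [ENNReal.tsum_mul_right, tsum_phi, one_mul]

/-- the modular surface -/
abbrev XX : Type := Quotient (MulAction.orbitRel SL(2, ℤ) ℍ)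

def mkX (z : ℍ) : XX := Quotient.mk (MulAction.orbitRel SL(2, ℤ) ℍ) z

lemma mkX_smul (γ : SL(2, ℤ)) (z : ℍ) : mkX (γ • z) = mkX z :=
  Quotient.sound (s := MulAction.orbitRel SL(2, ℤ) ℍ) (MulAction.mem_orbit z γ)

lemma mkX_eq {z w : ℍ} (h : mkX z = mkX w) : ∃ γ : SL(2, ℤ), γ • w = z :=
  Quotient.exact (s := MulAction.orbitRel SL(2, ℤ) ℍ) h

lemma mkX_surj (x : XX) : ∃ z, mkX z = x := Quotient.exists_rep x

lemma measurable_mkX : Measurable mkX := measurable_quotient_mk''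

lemma measurable_X {E : Type*} [MeasurableSpace E] {f : XX → E} : Measurable f ↔ Measurable fun z => f (mkX z) :=
  measurable_from_quotient

def nuH : Measure ℍ := volume.withDensity phi

def muX : Measure XX := nuH.map mkX

lemma nuY_pos : ∀ᵐ y ∂nuY, 0 < y := by
  have h : ∀ᵐ y ∂(volume.restrict (Set.Ioi (0 : ℝ))), 0 < y := ae_restrict_mem measurableSet_Ioi
  exact (withDensity_absolutelyContinuous _ _).ae_le h

lemma prod_pos : ∀ᵐ q ∂((volume : Measure ℝ).prod nuY), 0 < q.2 :=
  Measure.quasiMeasurePreserving_snd.ae nuY_pos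

lemma restrict_box (α : ℝ) : volume.restrict (box α) =
    ((volume.restrict (Set.Ico (0 : ℝ) 1)).prod (nuY.restrict (Set.Ici α))).map mkH := by
  rw [volume_eq_map, Measure.restrict_map measurable_mkH (measurableSet_box α), Measure.prod_restrict]
  congr 1
  apply Measure.restrict_congr_set
  filter_upwards [prod_pos] with q hq
  apply propext
  show (0 ≤ (mkH q).re ∧ (mkH q).re < 1 ∧ α ≤ (mkH q).im) ↔ ((0 ≤ q.1 ∧ q.1 < 1) ∧ α ≤ q.2)
  rw [mkH_re hq, mkH_im hq]; tauto

lemma nuY_Ici {α : ℝ} (hα : 0 < α) : nuY (Set.Ici α) = ENNReal.ofReal (1 / α) := by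
  have hsub : Set.Ici α ∩ Set.Ioi 0 = Set.Ici α :=
    Set.inter_eq_left.2 (fun y (hy : α ≤ y) => lt_of_lt_of_le hα hy)
  rw [nuY, withDensity_apply _ measurableSet_Ici, Measure.restrict_restrict measurableSet_Ici,
    hsub, ← Measure.restrict_congr_set (Ioi_ae_eq_Ici (a := α) (μ := volume))]
  have h1 : ∀ y ∈ Set.Ioi α, (1 / y ^ 2 : ℝ) = y ^ (-2 : ℝ) := by
    intro y hy
    have hy : 0 < y := hα.trans hy
    rw [Real.rpow_neg hy.le]; norm_num
  rw [setLIntegral_congr_fun measurableSet_Ioi (fun y hy => by rw [h1 y hy]),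
    ← ofReal_integral_eq_lintegral_ofReal, integral_Ioi_rpow_of_lt (by norm_num) hα]
  · congr 1; norm_num; rw [Real.rpow_neg_one]
  · exact integrableOn_Ioi_rpow_of_lt (by norm_num) hα
  · filter_upwards [ae_restrict_mem measurableSet_Ioi] with y hy
    have hy : 0 < y := hα.trans hy
    positivity

lemma volume_box {α : ℝ} (hα : 0 < α) : volume (box α) = ENNReal.ofReal (1 / α) := by
  have : volume (box α) = (volume.restrict (box α)) Set.univ := by simp
  rw [this, restrict_box, Measure.map_apply measurable_mkH .univ, Set.preimage_univ,
    Measure.prod_apply .univ]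
  simp [nuY_Ici hα]

instance : IsFiniteMeasure nuH := by
  constructor
  rw [nuH, withDensity_apply _ .univ, Measure.restrict_univ]
  calc ∫⁻ z, phi z ≤ ∫⁻ z, (box (1 / 2)).indicator 1 z := lintegral_mono phi_le
    _ = volume (box (1 / 2)) := lintegral_indicator_one (measurableSet_box _)
    _ < ⊤ := by rw [volume_box (by norm_num)]; exact ENNReal.ofReal_lt_top

instance : IsFiniteMeasure muX := by unfold muX; infer_instance

lemma lintegral_nuH (f : ℍ → ENNReal) (hf : Measurable f) : ∫⁻ z, f z ∂nuH = ∫⁻ z, phi z * f z := by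
  rw [nuH, lintegral_withDensity_eq_lintegral_mul _ measurable_phi hf]; rfl

lemma lintegral_muX (f : XX → ENNReal) (hf : Measurable f) :
    ∫⁻ x, f x ∂muX = ∫⁻ z, phi z * f (mkX z) := by
  rw [muX, lintegral_map hf measurable_mkX, lintegral_nuH _ (measurable_X.1 hf)]

lemma lintegral_muX_unfold (f : XX → ENNReal) (h : ℍ → ENNReal) (hh : Measurable h)
    (hf : ∀ z, f (mkX z) = ∑' γ : SL(2, ℤ), h (γ • z)) :
    ∫⁻ x, f x ∂muX = ∫⁻ z, h z := by
  have hfm : Measurable f := by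
    rw [measurable_X]; simp_rw [hf]
    exact Measurable.tsum fun γ => hh.comp (measurable_const_smul γ)
  rw [lintegral_muX f hfm, ← unfold_lintegral h hh]
  simp_rw [hf]

lemma phi_lt_top (z : ℍ) : phi z < ⊤ :=
  (phi_le z).trans_lt (by classical rw [Set.indicator_apply]; split_ifs <;> simp)

lemma unfold_integral (h : ℍ → ℂ) (hm : Measurable h) (hi : Integrable h) :
    ∫ z, (∑' γ : SL(2, ℤ), h (γ • z)) ∂nuH = ∫ z, h z := by
  have hms : ∀ γ : SL(2, ℤ), Measurable fun z : ℍ => γ • z := fun γ => measurable_const_smul γ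
  have key : ∀ γ : SL(2, ℤ), ∫ z, h (γ • z) ∂nuH = ∫ z, (phi (γ⁻¹ • z)).toReal • h z := by
    intro γ
    rw [nuH, integral_withDensity_eq_integral_toReal_smul measurable_phi (ae_of_all _ phi_lt_top)]
    have := (measurePreserving_smul γ⁻¹ (volume : Measure ℍ)).integral_comp
      (measurableEmbedding_const_smul γ⁻¹) (fun z => (phi z).toReal • h (γ • z))
    rw [← this]
    simp only [smul_inv_smul]
  rw [integral_tsum]
  · simp_rw [key]
    have hre : ∑' γ : SL(2, ℤ), ∫ z, (phi (γ⁻¹ • z)).toReal • h z =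
        ∑' γ : SL(2, ℤ), ∫ z, (phi (γ • z)).toReal • h z :=
      (Equiv.inv SL(2, ℤ)).tsum_eq (fun γ => ∫ z, (phi (γ • z)).toReal • h z)
    rw [hre, ← integral_tsum]
    · refine integral_congr_ae (ae_of_all _ fun z => ?_)
      simp only
      have : HasSum (fun γ : SL(2, ℤ) => (phi (γ • z)).toReal) 1 := by
        have h1 := ENNReal.hasSum_toReal (f := fun γ : SL(2, ℤ) => phi (γ • z)) (by rw [tsum_phi]; simp)
        rwa [← ENNReal.tsum_toReal_eq (fun γ => (phi_lt_top _).ne), tsum_phi] at h1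
      have := (this.smul_const (h z)).tsum_eq
      rw [this, one_smul]
    · intro γ
      exact ((measurable_phi.comp (hms γ)).ennreal_toReal.smul hm).aestronglyMeasurable
    · have : ∀ γ : SL(2, ℤ), ∀ z, ‖(phi (γ • z)).toReal • h z‖ₑ = phi (γ • z) * ‖h z‖ₑ := by
        intro γ z
        rw [enorm_smul, Real.enorm_of_nonneg ENNReal.toReal_nonneg, ENNReal.ofReal_toReal (phi_lt_top _).ne]
      simp_rw [this]
      rw [← lintegral_tsum]
      · simp_rw [ENNReal.tsum_mul_right, tsum_phi, one_mul]
        exact hi.2.ne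
      · exact fun γ => ((measurable_phi.comp (hms γ)).mul hm.enorm).aemeasurable
  · exact fun γ => (hm.comp (hms γ)).aestronglyMeasurable
  · have : ∀ γ : SL(2, ℤ), ∫⁻ z, ‖h (γ • z)‖ₑ ∂nuH = ∫⁻ z, phi z * ‖h (γ • z)‖ₑ := fun γ =>
      lintegral_nuH _ (hm.comp (hms γ)).enorm
    simp_rw [this]
    rw [← lintegral_tsum]
    · simp_rw [ENNReal.tsum_mul_left]
      rw [unfold_lintegral (fun z => ‖h z‖ₑ) hm.enorm]
      exact hi.2.ne
    · exact fun γ => (measurable_phi.mul (hm.comp (hms γ)).enorm).aemeasurable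

lemma integral_muX_unfold (f : XX → ℂ) (h : ℍ → ℂ) (hm : Measurable h) (hi : Integrable h)
    (hfm : Measurable f)
    (hf : ∀ z, f (mkX z) = ∑' γ : SL(2, ℤ), h (γ • z)) :
    ∫ x, f x ∂muX = ∫ z, h z := by
  rw [muX, integral_map measurable_mkX.aemeasurable hfm.aestronglyMeasurable]
  simp_rw [hf]
  exact unfold_integral h hm hi

def repA (p : ℕ) : Option (Fin p) → Matrix (Fin 2) (Fin 2) ℤ
  | none => !![(p : ℤ), 0; 0, 1]
  | some b => !![1, ((b : ℕ) : ℤ); 0, (p : ℤ)]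

lemma det_repA (p : ℕ) (i) : (repA p i).det = p := by
  cases i <;> simp [repA, Matrix.det_fin_two]

lemma rep_exists (p : ℕ) (hp : p.Prime) (A : FixedDetMatrix (Fin 2) ℤ p) :
    ∃ (γ : SL(2, ℤ)) (i : Option (Fin p)), A.1 = γ.1 * repA p i := by
  have hp0 : (p : ℤ) ≠ 0 := by exact_mod_cast hp.ne_zero
  induction A using FixedDetMatrices.induction_on hp0 with
  | h0 A h1 h2 h3 h4 =>
    have hd := A.2
    rw [Matrix.det_fin_two, h1, mul_zero, sub_zero] at hd
    have hd1 : 0 < A.1 1 1 := by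
      have : 0 < A.1 0 0 * A.1 1 1 := by rw [hd]; exact_mod_cast hp.pos
      exact (pos_iff_pos_of_mul_pos this).1 h2
    obtain ⟨a, ha⟩ := Int.eq_ofNat_of_zero_le h2.le
    obtain ⟨d, hd'⟩ := Int.eq_ofNat_of_zero_le hd1.le
    obtain ⟨b, hb⟩ := Int.eq_ofNat_of_zero_le h3
    rw [ha, hd'] at hd
    rw [hb, hd', abs_of_nonneg (by positivity), abs_of_nonneg (by positivity)] at h4
    have hmul : a * d = p := by exact_mod_cast hd
    have hbd : b < d := by exact_mod_cast h4
    rcases (Nat.dvd_prime hp).1 ⟨d, hmul.symm⟩ with h | h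
    · have hdp : d = p := by rw [h, one_mul] at hmul; exact hmul
      refine ⟨1, some ⟨b, hdp ▸ hbd⟩, ?_⟩
      ext i j
      fin_cases i <;> fin_cases j <;> simp [repA, ha, hb, hd', h1, h, hdp]
    · have hd1 : d = 1 := by
        rw [h] at hmul
        exact Nat.eq_of_mul_eq_mul_left hp.pos (by simpa using hmul)
      refine ⟨1, none, ?_⟩
      have hb0 : b = 0 := by omega
      ext i j
      fin_cases i <;> fin_cases j <;> simp [repA, ha, hb, hd', h1, h, hd1, hb0]
  | hS B ih =>
    obtain ⟨γ, i, h⟩ := ih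
    refine ⟨ModularGroup.S * γ, i, ?_⟩
    rw [FixedDetMatrices.smul_coe, h, Matrix.SpecialLinearGroup.coe_mul, mul_assoc]
  | hT B ih =>
    obtain ⟨γ, i, h⟩ := ih
    refine ⟨ModularGroup.T * γ, i, ?_⟩
    rw [FixedDetMatrices.smul_coe, h, Matrix.SpecialLinearGroup.coe_mul, mul_assoc]

lemma rep_unique_aux (p : ℕ) (hp : p.Prime) (δ : Matrix (Fin 2) (Fin 2) ℤ) (hδ : δ.det = 1)
    (i j : Option (Fin p)) (h : repA p i = δ * repA p j) : i = j := by
  have hp2 : (2 : ℤ) ≤ p := by exact_mod_cast hp.two_le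
  rw [Matrix.det_fin_two] at hδ
  have e00 := congrFun (congrFun h 0) 0
  have e01 := congrFun (congrFun h 0) 1
  have e10 := congrFun (congrFun h 1) 0
  have e11 := congrFun (congrFun h 1) 1
  rcases i with _ | i <;> rcases j with _ | j
  · rfl
  · exfalso
    simp [repA, Matrix.mul_apply, Fin.sum_univ_two] at e00 e01 e10 e11
    rw [← e10, ← e00] at hδ
    have : (p : ℤ) ∣ 1 := ⟨δ 1 1, by linarith⟩
    have := Int.le_of_dvd one_pos this
    omega
  · exfalso
    simp [repA, Matrix.mul_apply, Fin.sum_univ_two] at e00 e01 e10 e11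
    have : (p : ℤ) ∣ 1 := ⟨δ 0 0, by linarith⟩
    have := Int.le_of_dvd one_pos this
    omega
  · simp [repA, Matrix.mul_apply, Fin.sum_univ_two] at e00 e01 e10 e11
    rw [← e00] at e01
    have hi := i.2
    have hj := j.2
    have : δ 0 1 = 0 := by
      by_contra hne
      have h1 : (p : ℤ) ∣ ((i : ℕ) : ℤ) - ((j : ℕ) : ℤ) := ⟨δ 0 1, by linarith⟩
      have h2 := Int.eq_zero_of_abs_lt_dvd h1 (by rw [abs_lt]; constructor <;> omega)
      have h3 : δ 0 1 * p = 0 := by linarith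
      rcases mul_eq_zero.1 h3 with h | h <;> omega
    rw [this] at e01
    congr 1
    apply Fin.ext
    have : ((i : ℕ) : ℤ) = ((j : ℕ) : ℤ) := by linarith
    exact_mod_cast this

lemma rep_unique (p : ℕ) (hp : p.Prime) (γ γ' : SL(2, ℤ)) (i j : Option (Fin p))
    (h : γ.1 * repA p i = γ'.1 * repA p j) : γ = γ' ∧ i = j := by
  have hij : i = j := by
    refine rep_unique_aux p hp ((γ⁻¹ * γ' : SL(2, ℤ)).1) (γ⁻¹ * γ').2 i j ?_
    rw [Matrix.SpecialLinearGroup.coe_mul, mul_assoc, ← h, ← mul_assoc,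
      ← Matrix.SpecialLinearGroup.coe_mul, inv_mul_cancel, Matrix.SpecialLinearGroup.coe_one, one_mul]
  refine ⟨?_, hij⟩
  subst hij
  have h2 := congrArg (fun M => M * (repA p i).adjugate) h
  simp only [mul_assoc, Matrix.mul_adjugate, det_repA] at h2
  apply Subtype.ext
  have hp0 : (p : ℤ) ≠ 0 := by exact_mod_cast hp.ne_zero
  ext a b
  rw [Matrix.mul_smul, Matrix.mul_smul, mul_one, mul_one] at h2
  have := congrFun (congrFun h2 a) b
  rw [Matrix.smul_apply, Matrix.smul_apply, smul_eq_mul, smul_eq_mul] at this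
  exact mul_left_cancel₀ hp0 this

/-- all integer matrices of determinant `p`, via coset representatives -/
def repEquiv (p : ℕ) (hp : p.Prime) :
    (SL(2, ℤ) × Option (Fin p)) ≃ FixedDetMatrix (Fin 2) ℤ (p : ℤ) :=
  Equiv.ofBijective (fun q => ⟨q.1.1 * repA p q.2, by rw [Matrix.det_mul, q.1.2, one_mul, det_repA]⟩) (by
    constructor
    · rintro ⟨γ, i⟩ ⟨γ', j⟩ h
      have := rep_unique p hp γ γ' i j (congrArg Subtype.val h)
      rw [this.1, this.2]
    · intro A
      obtain ⟨γ, i, h⟩ := rep_exists p hp A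
      exact ⟨(γ, i), Subtype.ext h.symm⟩)

lemma repEquiv_val (p : ℕ) (hp : p.Prime) (γ i) : (repEquiv p hp (γ, i)).1 = γ.1 * repA p i := rfl

lemma det_repA_pos (p : ℕ) (hp : p.Prime) (i) : 0 < (repA p i).det := by
  rw [det_repA]; exact_mod_cast hp.pos

lemma repEquiv_smul (p : ℕ) (hp : p.Prime) (γ i) (z : ℍ) :
    iGL (repEquiv p hp (γ, i)).1 • z = γ • iGL (repA p i) • z := by
  rw [repEquiv_val, iGL_mul (by rw [γ.2]; exact one_ne_zero) (det_repA_pos p hp i).ne', mul_smul, iGL_SL]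

lemma rep_perm (p : ℕ) (hp : p.Prime) (γ : SL(2, ℤ)) : ∃ σ : Equiv.Perm (Option (Fin p)),
    ∀ i z, mkX (iGL (repA p i) • γ • z) = mkX (iGL (repA p (σ i)) • z) := by
  have h : ∀ i, ∃ (δ : SL(2, ℤ)) (j : Option (Fin p)), repA p i * γ.1 = δ.1 * repA p j := fun i =>
    rep_exists p hp ⟨repA p i * γ.1, by rw [Matrix.det_mul, γ.2, mul_one, det_repA]⟩
  choose δ τ hτ using h
  have hinj : Function.Injective τ := by
    intro i j hij
    refine (rep_unique p hp (δ j * (δ i)⁻¹) 1 i j ?_).2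
    have e1 : repA p j * γ.1 = (δ j * (δ i)⁻¹ : SL(2, ℤ)).1 * (repA p i * γ.1) := by
      rw [hτ i, hτ j, ← hij, ← mul_assoc, ← Matrix.SpecialLinearGroup.coe_mul, mul_assoc (δ j),
        inv_mul_cancel, mul_one]
    have e2 := congrArg (fun M => M * (γ⁻¹ : SL(2, ℤ)).1) e1
    simp only [mul_assoc] at e2
    rw [← Matrix.SpecialLinearGroup.coe_mul, mul_inv_cancel, Matrix.SpecialLinearGroup.coe_one,
      mul_one, mul_one] at e2
    rw [Matrix.SpecialLinearGroup.coe_one, one_mul, e2]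
  refine ⟨Equiv.ofBijective τ (Finite.injective_iff_bijective.1 hinj), fun i z => ?_⟩
  have hd : ∀ γ : SL(2, ℤ), γ.1.det ≠ 0 := fun γ => by rw [γ.2]; exact one_ne_zero
  rw [← iGL_SL γ, ← mul_smul, ← iGL_mul (det_repA_pos p hp i).ne' (hd γ), hτ i,
    iGL_mul (hd _) (det_repA_pos p hp _).ne', mul_smul, iGL_SL, mkX_smul]
  rfl

instance (p : ℕ) : Countable (FixedDetMatrix (Fin 2) ℤ (p : ℤ)) :=
  Function.Injective.countable (β := Fin 2 → Fin 2 → ℤ) (f := fun γ => fun i j => γ.1 i j)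
    fun γ γ' h => by apply Subtype.ext; ext i j; exact congrFun (congrFun h i) j

lemma corr_unfold (p : ℕ) (hp : p.Prime) (F : XX × XX → ENNReal) (hF : Measurable F) :
    ∑ i, ∫⁻ z, phi z * F (mkX z, mkX (iGL (repA p i) • z)) =
      ∑' A : FixedDetMatrix (Fin 2) ℤ (p : ℤ), ∫⁻ z, phi z * phi (iGL A.1 • z) *
        F (mkX z, mkX (iGL A.1 • z)) := by
  have hms : ∀ g : GL (Fin 2) ℝ, Measurable fun z : ℍ => g • z := fun g => measurable_const_smul g
  have hms' : ∀ g : SL(2, ℤ), Measurable fun z : ℍ => g • z := fun g => measurable_const_smul g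
  have hFm : ∀ g : GL (Fin 2) ℝ, Measurable fun z : ℍ => F (mkX z, mkX (g • z)) := fun g =>
    hF.comp (measurable_mkX.prodMk (measurable_mkX.comp (hms g)))
  rw [← (repEquiv p hp).tsum_eq, ENNReal.tsum_prod', ENNReal.tsum_comm, tsum_fintype]
  refine Finset.sum_congr rfl fun i _ => ?_
  simp_rw [repEquiv_smul, mkX_smul]
  rw [← lintegral_tsum]
  · refine lintegral_congr fun z => ?_
    rw [ENNReal.tsum_mul_right, ENNReal.tsum_mul_left, tsum_phi, mul_one]
  · intro γ
    exact ((measurable_phi.mul (measurable_phi.comp ((hms' γ).comp (hms _)))).mul (hFm _)).aemeasurable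

lemma corr_symm (p : ℕ) (hp : p.Prime) (F : XX × XX → ENNReal) (hF : Measurable F) :
    ∑ i, ∫⁻ z, phi z * F (mkX z, mkX (iGL (repA p i) • z)) =
    ∑ i, ∫⁻ z, phi z * F (mkX (iGL (repA p i) • z), mkX z) := by
  have hp0 : (0 : ℤ) < p := by exact_mod_cast hp.pos
  have h2 := corr_unfold p hp (F ∘ Prod.swap) (hF.comp measurable_swap)
  simp only [Function.comp, Prod.swap] at h2
  rw [h2, corr_unfold p hp F hF]
  let adj : FixedDetMatrix (Fin 2) ℤ (p : ℤ) ≃ FixedDetMatrix (Fin 2) ℤ (p : ℤ) :=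
    { toFun := fun A => ⟨A.1.adjugate, by rw [Matrix.det_adjugate, A.2]; simp⟩
      invFun := fun A => ⟨A.1.adjugate, by rw [Matrix.det_adjugate, A.2]; simp⟩
      left_inv := fun A => Subtype.ext (by simp [Matrix.adjugate_adjugate])
      right_inv := fun A => Subtype.ext (by simp [Matrix.adjugate_adjugate]) }
  rw [← adj.tsum_eq]
  refine tsum_congr fun A => ?_
  have hA : 0 < A.1.det := by rw [A.2]; exact hp0
  have hms : ∀ g : GL (Fin 2) ℝ, Measurable fun z : ℍ => g • z := fun g => measurable_const_smul g
  have hm : Measurable fun z => phi z * phi (iGL A.1.adjugate • z) *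
      F (mkX z, mkX (iGL A.1.adjugate • z)) :=
    (measurable_phi.mul (measurable_phi.comp (hms _))).mul
      (hF.comp (measurable_mkX.prodMk (measurable_mkX.comp (hms _))))
  rw [show (adj A).1 = A.1.adjugate from rfl,
    ← (measurePreserving_smul (iGL A.1) (volume : Measure ℍ)).lintegral_comp hm]
  refine lintegral_congr fun z => ?_
  simp only [iGL_adj_smul hA]
  rw [mul_comm (phi _) (phi z)]

/-- the Hecke operator on functions on the modular surface -/
def TX (p : ℕ) (f : XX → ℂ) (x : XX) : ℂ :=
  ((p : ℂ) + 1)⁻¹ * ∑ i, f (mkX (iGL (repA p i) • (Quotient.out x : ℍ)))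

lemma TX_mk (p : ℕ) (hp : p.Prime) (f : XX → ℂ) (z : ℍ) :
    TX p f (mkX z) = ((p : ℂ) + 1)⁻¹ * ∑ i, f (mkX (iGL (repA p i) • z)) := by
  have h : mkX (Quotient.out (mkX z)) = mkX z := Quotient.out_eq _
  obtain ⟨γ, hγ⟩ := mkX_eq h
  obtain ⟨σ, hσ⟩ := rep_perm p hp γ
  rw [TX, ← hγ]
  simp_rw [hσ]
  rw [Equiv.sum_comp σ (fun i => f (mkX (iGL (repA p i) • z)))]

lemma measurable_repA (p : ℕ) (i) : Measurable fun z : ℍ => mkX (iGL (repA p i) • z) :=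
  measurable_mkX.comp (measurable_const_smul (iGL (repA p i)))

lemma measurable_TX (p : ℕ) (hp : p.Prime) {f : XX → ℂ} (hf : Measurable f) : Measurable (TX p f) := by
  rw [measurable_X]
  simp_rw [TX_mk p hp]
  exact measurable_const.mul (Finset.measurable_sum _ fun i _ => hf.comp (measurable_repA p i))

/-- the correspondence measure -/
def PiM (p : ℕ) : Measure (XX × XX) :=
  ∑ i, nuH.map fun z => (mkX z, mkX (iGL (repA p i) • z))

lemma measurable_pr (p : ℕ) (i) : Measurable fun z : ℍ => (mkX z, mkX (iGL (repA p i) • z)) :=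
  measurable_mkX.prodMk (measurable_repA p i)

lemma lintegral_PiM (p : ℕ) (F : XX × XX → ENNReal) (hF : Measurable F) :
    ∫⁻ q, F q ∂(PiM p) = ∑ i, ∫⁻ z, phi z * F (mkX z, mkX (iGL (repA p i) • z)) := by
  rw [PiM, lintegral_finsetSum_measure]
  refine Finset.sum_congr rfl fun i _ => ?_
  rw [lintegral_map hF (measurable_pr p i), lintegral_nuH (fun z => F (mkX z, mkX (iGL (repA p i) • z))) (hF.comp (measurable_pr p i))]

lemma PiM_swap (p : ℕ) (hp : p.Prime) : MeasurePreserving Prod.swap (PiM p) (PiM p) := by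
  refine ⟨measurable_swap, ?_⟩
  refine Measure.ext_of_lintegral _ fun F hF => ?_
  rw [lintegral_map hF measurable_swap, lintegral_PiM p (fun q => F q.swap) (hF.comp measurable_swap),
    lintegral_PiM p _ hF, corr_symm p hp F hF]
  rfl

lemma PiM_fst (p : ℕ) : MeasurePreserving Prod.fst (PiM p) (((p : ENNReal) + 1) • muX) := by
  refine ⟨measurable_fst, ?_⟩
  refine Measure.ext_of_lintegral _ fun F hF => ?_
  rw [lintegral_map hF measurable_fst, lintegral_PiM p (fun q => F q.1) (hF.comp measurable_fst),
    lintegral_smul_measure, lintegral_muX F hF]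
  simp

lemma PiM_snd (p : ℕ) (hp : p.Prime) :
    MeasurePreserving Prod.snd (PiM p) (((p : ENNReal) + 1) • muX) :=
  (PiM_fst p).comp (PiM_swap p hp)

instance (p : ℕ) : IsFiniteMeasure (PiM p) := by unfold PiM; infer_instance

lemma map_le_PiM (p : ℕ) (i) : nuH.map (fun z => (mkX z, mkX (iGL (repA p i) • z))) ≤ PiM p := by
  classical
  unfold PiM
  exact Finset.single_le_sum (f := fun i => nuH.map (fun z => (mkX z, mkX (iGL (repA p i) • z))))
    (fun i _ => bot_le) (Finset.mem_univ i)

lemma ae_PiM {p : ℕ} {P : XX × XX → Prop} (h : ∀ᵐ q ∂(PiM p), P q) (i) :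
    ∀ᵐ z ∂nuH, P (mkX z, mkX (iGL (repA p i) • z)) :=
  ae_of_ae_map (measurable_pr p i).aemeasurable (Measure.absolutelyContinuous_of_le (map_le_PiM p i) h)

lemma ae_muX_smul {p : ℕ} {P : XX → Prop} (h : ∀ᵐ x ∂muX, P x) :
    ∀ᵐ x ∂(((p : ENNReal) + 1) • muX), P x := Measure.smul_absolutelyContinuous h

lemma TX_ae (p : ℕ) (hp : p.Prime) {f g : XX → ℂ} (hf : Measurable f) (hg : Measurable g)
    (h : f =ᵐ[muX] g) : TX p f =ᵐ[muX] TX p g := by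
  have h1 := (PiM_snd p hp).quasiMeasurePreserving.ae (ae_muX_smul h)
  have h2 : ∀ᵐ z ∂nuH, ∀ i, f (mkX (iGL (repA p i) • z)) = g (mkX (iGL (repA p i) • z)) :=
    ae_all_iff.2 fun i => ae_PiM h1 i
  unfold muX
  refine (ae_map_iff measurable_mkX.aemeasurable
    (measurableSet_eq_fun (measurable_TX p hp hf) (measurable_TX p hp hg))).2 ?_
  filter_upwards [h2] with z hz
  rw [TX_mk p hp, TX_mk p hp]
  simp_rw [hz]

lemma eLpNorm_TX (p : ℕ) (hp : p.Prime) {f : XX → ℂ} (hf : Measurable f) :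
    eLpNorm (TX p f) 2 muX ≤ ENNReal.ofReal (p + 1) * eLpNorm f 2 muX := by
  have e1 : eLpNorm (TX p f) 2 muX = eLpNorm (fun z => TX p f (mkX z)) 2 nuH := by
    rw [muX, eLpNorm_map_measure (measurable_TX p hp hf).aestronglyMeasurable measurable_mkX.aemeasurable]; rfl
  have e2 : (fun z => TX p f (mkX z)) =
      ((p : ℂ) + 1)⁻¹ • ∑ i, fun z => f (mkX (iGL (repA p i) • z)) := by
    ext z; rw [TX_mk p hp]; simp
  have e3 : ∀ i, eLpNorm (fun z => f (mkX (iGL (repA p i) • z))) 2 nuH ≤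
      ENNReal.ofReal (p + 1) * eLpNorm f 2 muX := by
    intro i
    have hs : AEStronglyMeasurable (fun q : XX × XX => f q.2) (PiM p) :=
      (hf.comp measurable_snd).aestronglyMeasurable
    have : eLpNorm (fun z => f (mkX (iGL (repA p i) • z))) 2 nuH =
        eLpNorm (fun q : XX × XX => f q.2) 2 (nuH.map (fun z => (mkX z, mkX (iGL (repA p i) • z)))) := by
      rw [eLpNorm_map_measure (g := fun q : XX × XX => f q.2) (hf.comp measurable_snd).aestronglyMeasurable
        (measurable_pr p i).aemeasurable]; rfl
    rw [this]
    refine (eLpNorm_mono_measure _ (map_le_PiM p i)).trans ?_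
    have := eLpNorm_comp_measurePreserving (p := 2) (g := f) hf.aestronglyMeasurable (PiM_snd p hp)
    change eLpNorm (f ∘ Prod.snd) 2 (PiM p) ≤ _
    rw [this, eLpNorm_smul_measure_of_ne_top (by norm_num)]
    rw [smul_eq_mul]
    gcongr
    have hc : ((p : ENNReal) + 1) = ENNReal.ofReal (p + 1) := by
      rw [ENNReal.ofReal_add (by positivity) (by positivity)]; simp
    rw [hc]
    have h1 : (1 : ENNReal) ≤ ENNReal.ofReal (p + 1) := by rw [← hc]; exact le_add_self
    calc ENNReal.ofReal (p + 1) ^ _ ≤ ENNReal.ofReal (p + 1) ^ (1 : ℝ) :=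
          ENNReal.rpow_le_rpow_of_exponent_le h1 (by norm_num)
      _ = _ := ENNReal.rpow_one _
  rw [e1, e2, eLpNorm_const_smul]
  have hsum := eLpNorm_sum_le (μ := nuH) (p := 2) (s := Finset.univ)
    (f := fun i => fun z => f (mkX (iGL (repA p i) • z)))
    (fun i _ => (hf.comp (measurable_repA p i)).aestronglyMeasurable) (by norm_num)
  refine (mul_le_mul_right (hsum.trans (Finset.sum_le_sum fun i _ => e3 i)) _).trans ?_
  rw [Finset.sum_const, Finset.card_univ, Fintype.card_option, Fintype.card_fin, nsmul_eq_mul,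
    ← mul_assoc]
  have : ‖((p : ℂ) + 1)⁻¹‖ₑ * ((p + 1 : ℕ) : ENNReal) = 1 := by
    have h0 : ((p : ℂ) + 1) ≠ 0 := by exact_mod_cast (Nat.succ_ne_zero p)
    have h2 : ((p + 1 : ℕ) : ENNReal) = ‖((p : ℂ) + 1)‖ₑ := by
      rw [← Nat.cast_succ, ← ofReal_norm, Complex.norm_natCast, ENNReal.ofReal_natCast]
    rw [h2, ← enorm_mul, inv_mul_cancel₀ h0]; simp
  rw [this, one_mul]

lemma memLp_TX (p : ℕ) (hp : p.Prime) {f : XX → ℂ} (hf : Measurable f) (hL : MemLp f 2 muX) :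
    MemLp (TX p f) 2 muX :=
  ⟨(measurable_TX p hp hf).aestronglyMeasurable,
    (eLpNorm_TX p hp hf).trans_lt (ENNReal.mul_lt_top ENNReal.ofReal_lt_top hL.2)⟩

abbrev HX : Type := Lp ℂ 2 muX

lemma meas_Lp (f : HX) : Measurable (f : XX → ℂ) := (Lp.stronglyMeasurable f).measurable

lemma TX_add (p : ℕ) (f g : XX → ℂ) : TX p (f + g) = TX p f + TX p g := by
  ext x; simp [TX, Finset.sum_add_distrib, mul_add]

lemma TX_smul (p : ℕ) (c : ℂ) (f : XX → ℂ) : TX p (c • f) = c • TX p f := by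
  ext x; simp only [TX, Pi.smul_apply, smul_eq_mul, ← Finset.mul_sum]; ring

def TL (p : ℕ) (hp : p.Prime) : HX →L[ℂ] HX :=
  LinearMap.mkContinuous
    { toFun := fun f => (memLp_TX p hp (meas_Lp f) (Lp.memLp f)).toLp
      map_add' := fun f g => by
        rw [← MemLp.toLp_add, MemLp.toLp_eq_toLp_iff, ← TX_add]
        exact TX_ae p hp (meas_Lp _) ((meas_Lp f).add (meas_Lp g)) (Lp.coeFn_add f g)
      map_smul' := fun c f => by
        rw [RingHom.id_apply, ← MemLp.toLp_const_smul, MemLp.toLp_eq_toLp_iff, ← TX_smul]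
        exact TX_ae p hp (meas_Lp _) ((meas_Lp f).const_smul c) (Lp.coeFn_smul c f) }
    (p + 1) (by
      intro f
      simp only [LinearMap.coe_mk, AddHom.coe_mk]
      rw [Lp.norm_toLp, Lp.norm_def]
      have := ENNReal.toReal_mono (ENNReal.mul_ne_top ENNReal.ofReal_ne_top (Lp.memLp f).2.ne)
        (eLpNorm_TX p hp (meas_Lp f))
      rwa [ENNReal.toReal_mul, ENNReal.toReal_ofReal (by positivity)] at this)

lemma TL_toLp (p : ℕ) (hp : p.Prime) {f : XX → ℂ} (hf : Measurable f) (hL : MemLp f 2 muX) :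
    TL p hp hL.toLp = (memLp_TX p hp hf hL).toLp := by
  show MemLp.toLp _ (memLp_TX p hp (meas_Lp _) (Lp.memLp _)) = _
  rw [MemLp.toLp_eq_toLp_iff]
  exact TX_ae p hp (meas_Lp _) hf hL.coeFn_toLp

lemma integral_PiM (p : ℕ) (F : XX × XX → ℂ) (hF : Measurable F) (hi : Integrable F (PiM p)) :
    ∫ q, F q ∂(PiM p) = ∑ i, ∫ z, F (mkX z, mkX (iGL (repA p i) • z)) ∂nuH := by
  rw [PiM, integral_finsetSum_measure]
  · refine Finset.sum_congr rfl fun i _ => ?_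
    rw [integral_map (measurable_pr p i).aemeasurable hF.aestronglyMeasurable]
  · intro i _
    exact hi.mono_measure (map_le_PiM p i)

lemma memLp_fst (p : ℕ) {f : XX → ℂ} (hL : MemLp f 2 muX) :
    MemLp (fun q : XX × XX => f q.1) 2 (PiM p) :=
  (hL.smul_measure (by simp)).comp_measurePreserving (PiM_fst p)

lemma memLp_snd (p : ℕ) (hp : p.Prime) {f : XX → ℂ} (hL : MemLp f 2 muX) :
    MemLp (fun q : XX × XX => f q.2) 2 (PiM p) :=
  (hL.smul_measure (by simp)).comp_measurePreserving (PiM_snd p hp)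

lemma integral_TX_mul (p : ℕ) (hp : p.Prime) {f g : XX → ℂ} (hf : Measurable f) (hg : Measurable g)
    (hLf : MemLp f 2 muX) (hLg : MemLp g 2 muX) :
    ∫ x, g x * TX p f x ∂muX = ((p : ℂ) + 1)⁻¹ * ∫ q, g q.1 * f q.2 ∂(PiM p) := by
  have hi : Integrable (fun q : XX × XX => g q.1 * f q.2) (PiM p) :=
    (memLp_fst p hLg).integrable_mul (memLp_snd p hp hLf)
  rw [integral_PiM p (fun q => g q.1 * f q.2) ((hg.comp measurable_fst).mul (hf.comp measurable_snd)) hi, muX,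
    integral_map (f := fun x => g x * TX p f x) measurable_mkX.aemeasurable (hg.mul (measurable_TX p hp hf)).aestronglyMeasurable,
    ← integral_finsetSum, ← integral_const_mul]
  · congr 1; ext z
    rw [TX_mk p hp, Finset.mul_sum, Finset.mul_sum, Finset.mul_sum]
    refine Finset.sum_congr rfl fun i _ => by ring
  · intro i _
    have := (hi.mono_measure (map_le_PiM p i))
    exact this.comp_measurable (measurable_pr p i)

lemma TX_symm (p : ℕ) (hp : p.Prime) {f g : XX → ℂ} (hf : Measurable f) (hg : Measurable g)
    (hLf : MemLp f 2 muX) (hLg : MemLp g 2 muX) :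
    ∫ x, g x * TX p f x ∂muX = ∫ x, f x * TX p g x ∂muX := by
  rw [integral_TX_mul p hp hf hg hLf hLg, integral_TX_mul p hp hg hf hLg hLf]
  congr 1
  have := (PiM_swap p hp).integral_comp (MeasurableEquiv.prodComm (α := XX) (β := XX)).measurableEmbedding
    (fun q : XX × XX => g q.1 * f q.2)
  rw [← this]
  congr 1; ext q; simp [mul_comm]

lemma TX_conj (p : ℕ) (f : XX → ℂ) (x) : (starRingEnd ℂ) (TX p f x) = TX p (fun x => (starRingEnd ℂ) (f x)) x := by
  simp [TX, map_sum]

lemma TL_symm (p : ℕ) (hp : p.Prime) (f g : HX) : inner ℂ (TL p hp f) g = inner ℂ f (TL p hp g) := by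
  have hff := Lp.toLp_coeFn f (Lp.memLp f)
  rw [L2.inner_def, L2.inner_def]
  have h1 : ∀ f : HX, (TL p hp f : XX → ℂ) =ᵐ[muX] TX p f := fun f => MemLp.coeFn_toLp (memLp_TX p hp (meas_Lp _) (Lp.memLp _))
  have e1 : ∫ x, inner ℂ ((TL p hp f : XX → ℂ) x) (g x) ∂muX =
      ∫ x, g x * TX p (fun x => (starRingEnd ℂ) (f x)) x ∂muX := by
    refine integral_congr_ae ?_
    filter_upwards [h1 f] with x hx
    rw [hx, ← TX_conj]; simp [RCLike.inner_apply]
  have e2 : ∫ x, inner ℂ (f x) ((TL p hp g : XX → ℂ) x) ∂muX =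
      ∫ x, (starRingEnd ℂ) (f x) * TX p g x ∂muX := by
    refine integral_congr_ae ?_
    filter_upwards [h1 g] with x hx
    rw [hx]; simp [RCLike.inner_apply, mul_comm]
  rw [e1, e2]
  exact TX_symm p hp (Complex.continuous_conj.measurable.comp (meas_Lp f)) (meas_Lp g) (Lp.memLp f).star (Lp.memLp g)

lemma TL_pow_toLp (p : ℕ) (hp : p.Prime) {f : XX → ℂ} (hf : Measurable f) (hL : MemLp f 2 muX) (n : ℕ) :
    Measurable ((TX p)^[n] f) ∧ ∃ h : MemLp ((TX p)^[n] f) 2 muX, (TL p hp ^ n) hL.toLp = h.toLp := by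
  induction n with
  | zero => exact ⟨hf, hL, rfl⟩
  | succ n ih =>
    obtain ⟨hm, h, e⟩ := ih
    rw [Function.iterate_succ_apply']
    refine ⟨measurable_TX p hp hm, memLp_TX p hp hm h, ?_⟩
    rw [pow_succ', mul_apply_eq_comp, e, TL_toLp p hp hm h]

def ee (t : ℝ) : ℂ := Complex.exp (2 * Real.pi * Complex.I * t)

lemma ee_add (s t : ℝ) : ee (s + t) = ee s * ee t := by
  rw [ee, ee, ee, ← Complex.exp_add]; push_cast; ring_nf

lemma ee_zero : ee 0 = 1 := by simp [ee]

lemma ee_int (n : ℤ) : ee n = 1 := by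
  rw [ee, Complex.exp_eq_one_iff]; exact ⟨n, by push_cast; ring⟩

lemma norm_ee (t : ℝ) : ‖ee t‖ = 1 := by
  rw [ee, show (2 * Real.pi * Complex.I * t : ℂ) = ((2 * Real.pi * t : ℝ) : ℂ) * Complex.I by push_cast; ring,
    Complex.norm_exp_ofReal_mul_I]

lemma continuous_ee : Continuous ee := by unfold ee; fun_prop

lemma measurable_ee : Measurable ee := continuous_ee.measurable

lemma ee_add_int (t : ℝ) (n : ℤ) : ee (t + n) = ee t := by rw [ee_add, ee_int, mul_one]

lemma ee_eq_one {t : ℝ} (h : ee t = 1) : ∃ n : ℤ, t = n := by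
  rw [ee, Complex.exp_eq_one_iff] at h
  obtain ⟨n, hn⟩ := h
  refine ⟨n, ?_⟩
  have h0 : (2 * Real.pi * Complex.I : ℂ) ≠ 0 := Complex.two_pi_I_ne_zero
  have : (t : ℂ) = n := by
    apply mul_left_cancel₀ h0; rw [hn]; ring
  exact_mod_cast this

lemma conj_ee (t : ℝ) : (starRingEnd ℂ) (ee t) = ee (-t) := by
  rw [ee, ee, ← Complex.exp_conj]; simp [map_ofNat]

def sfun (m : ℤ) (α : ℝ) (z : ℍ) : ℂ := (box α).indicator (fun z => ee (m * z.re)) z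

lemma measurable_sfun (m α) : Measurable (sfun m α) :=
  (measurable_ee.comp (measurable_const.mul measurable_re)).indicator (measurableSet_box α)

lemma norm_sfun (m α z) : ‖sfun m α z‖ = (box α).indicator 1 z := by
  classical
  rw [sfun, Set.indicator_apply, Set.indicator_apply]; split_ifs <;> simp [norm_ee]

def PP (m : ℤ) (α : ℝ) (x : XX) : ℂ := ∑' γ : SL(2, ℤ), sfun m α (γ • (Quotient.out x : ℍ))

lemma PP_mk (m α z) : PP m α (mkX z) = ∑' γ : SL(2, ℤ), sfun m α (γ • z) := by
  have h : mkX (Quotient.out (mkX z)) = mkX z := Quotient.out_eq _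
  obtain ⟨g, hg⟩ := mkX_eq h
  rw [PP, ← hg]
  rw [← (Equiv.mulRight g).tsum_eq (fun γ => sfun m α (γ • z))]
  simp [mul_smul, -ModularGroup.sl_moeb]

lemma sfun_finite {α : ℝ} (hα : 0 < α) (m z) :
    (Function.support fun γ : SL(2, ℤ) => sfun m α (γ • z)).Finite := by
  refine (finite_box hα z).subset fun γ hγ => ?_
  by_contra h
  exact hγ (Set.indicator_of_notMem (s := box α) h _)

lemma measurable_PP {α : ℝ} (hα : 0 < α) (m) : Measurable (PP m α) := by
  rw [measurable_X]
  simp_rw [PP_mk]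
  have hs : ∀ z, Summable fun γ : SL(2, ℤ) => sfun m α (γ • z) := fun z =>
    summable_of_hasFiniteSupport (sfun_finite hα m z)
  exact Measurable.tsum fun γ => (measurable_sfun m α).comp (measurable_const_smul γ)

lemma norm_PP_le {α : ℝ} (hα : 0 < α) (m x) : ‖PP m α x‖ ≤ cntB α := by
  obtain ⟨z, rfl⟩ := mkX_surj x
  rw [PP_mk, tsum_eq_sum' (s := (sfun_finite hα m z).toFinset) (by simp)]
  refine (norm_sum_le _ _).trans ?_
  have : ∀ γ ∈ (sfun_finite hα m z).toFinset, ‖sfun m α (γ • z)‖ ≤ 1 := by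
    classical
    intro γ _; rw [norm_sfun, Set.indicator_apply]; split_ifs <;> simp
  refine (Finset.sum_le_sum this).trans ?_
  rw [Finset.sum_const, nsmul_eq_mul, mul_one]
  have := card_box_le hα z (sfun_finite hα m z).toFinset (by
    intro γ hγ
    rw [Set.Finite.mem_toFinset] at hγ
    by_contra h
    exact hγ (Set.indicator_of_notMem h _))
  exact_mod_cast this

/-- lift of a function to coordinates -/
def FF (f : XX → ℂ) (x y : ℝ) : ℂ := f (mkX (mkH (x, y)))

lemma mkH_ext {q : ℝ × ℝ} (hq : 0 < q.2) {z : ℍ} (h1 : z.re = q.1) (h2 : z.im = q.2) : mkH q = z := by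
  apply UpperHalfPlane.ext_re_im
  · rw [mkH_re hq, h1]
  · rw [mkH_im hq, h2]

lemma FF_periodic (f : XX → ℂ) {y : ℝ} (hy : 0 < y) : Function.Periodic (fun x => FF f x y) 1 := by
  intro x
  have : mkH (x + 1, y) = ModularGroup.T • mkH (x, y) := by
    apply mkH_ext hy
    · rw [ModularGroup.re_T_smul, mkH_re hy]
    · rw [ModularGroup.im_T_smul, mkH_im hy]
  simp only [FF]
  rw [this, mkX_smul]

lemma FF_none (p : ℕ) (hp : p.Prime) (f : XX → ℂ) {x y : ℝ} (hy : 0 < y) :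
    f (mkX (iGL (repA p none) • mkH (x, y))) = FF f (p * x) (p * y) := by
  have hp0 : (0 : ℝ) < p := by exact_mod_cast hp.pos
  rw [FF, mkH_ext (q := ((p : ℝ) * x, (p : ℝ) * y)) (by positivity) (z := iGL (repA p none) • mkH (x, y))]
  · show (((iGL (repA p none) • mkH (x, y) : ℍ) : ℂ)).re = _
    rw [coe_iGL_smul (det_repA_pos p hp _), mkH_of_pos hy]
    simp [repA]
  · show (((iGL (repA p none) • mkH (x, y) : ℍ) : ℂ)).im = _
    rw [coe_iGL_smul (det_repA_pos p hp _), mkH_of_pos hy]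
    simp [repA]

lemma FF_some (p : ℕ) (hp : p.Prime) (f : XX → ℂ) {x y : ℝ} (hy : 0 < y) (b : Fin p) :
    f (mkX (iGL (repA p (some b)) • mkH (x, y))) = FF f ((x + (b : ℕ)) / p) (y / p) := by
  have hp0 : (0 : ℝ) < p := by exact_mod_cast hp.pos
  have e : (((iGL (repA p (some b)) • mkH (x, y) : ℍ) : ℂ)) = (⟨x + (b : ℕ), y⟩ : ℂ) / ((p : ℝ) : ℂ) := by
    rw [coe_iGL_smul (det_repA_pos p hp _), mkH_of_pos hy]
    congr 1
    · apply Complex.ext <;> simp [repA]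
    · simp [repA]
  rw [FF, mkH_ext (q := ((x + (b : ℕ)) / p, y / p)) (by positivity) (z := iGL (repA p (some b)) • mkH (x, y))]
  · show (((iGL (repA p (some b)) • mkH (x, y) : ℍ) : ℂ)).re = _
    rw [e, Complex.div_ofReal_re]
  · show (((iGL (repA p (some b)) • mkH (x, y) : ℍ) : ℂ)).im = _
    rw [e, Complex.div_ofReal_im]

lemma measurable_FF {f : XX → ℂ} (hf : Measurable f) (y : ℝ) : Measurable fun x => FF f x y :=
  (measurable_X.1 hf).comp (measurable_mkH.comp (measurable_id.prodMk measurable_const))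

/-- Fourier coefficient -/
def fc (f : XX → ℂ) (k : ℤ) (y : ℝ) : ℂ := ∫ x in (0 : ℝ)..1, FF f x y * ee (-(k * x))

lemma ii_of_bdd {g : ℝ → ℂ} (hg : Measurable g) {B : ℝ} (hB : ∀ x, ‖g x‖ ≤ B) (a b : ℝ) :
    IntervalIntegrable g volume a b :=
  (intervalIntegrable_const (c := B)).mono_fun' hg.aestronglyMeasurable (ae_of_all _ hB)

lemma fourier_some {g : ℝ → ℂ} (hg : Measurable g) {B : ℝ} (hB : ∀ x, ‖g x‖ ≤ B) (p : ℕ) (hp : 0 < p)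
    (k : ℤ) : ∑ b : Fin p, ∫ x in (0 : ℝ)..1, g ((x + (b : ℕ)) / p) * ee (-(k * x)) =
      p * ∫ u in (0 : ℝ)..1, g u * ee (-((k * p : ℤ) * u)) := by
  have hp0 : (0 : ℝ) < p := by exact_mod_cast hp
  set G : ℝ → ℂ := fun x => g (x / p) * ee (-(k * x)) with hG
  have hGm : Measurable G := (hg.comp (by fun_prop)).mul (measurable_ee.comp (by fun_prop))
  have hGB : ∀ x, ‖G x‖ ≤ B := fun x => by simp only [hG, norm_mul, norm_ee, mul_one]; exact hB _
  have h1 : ∀ b : Fin p, ∫ x in (0 : ℝ)..1, g ((x + (b : ℕ)) / p) * ee (-(k * x)) =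
      ∫ x in ((b : ℕ) : ℝ)..((b : ℕ) + 1 : ℕ), G x := by
    intro b
    have := intervalIntegral.integral_comp_add_right (a := 0) (b := 1) G ((b : ℕ) : ℝ)
    rw [zero_add, add_comm (1 : ℝ)] at this
    push_cast
    rw [← this]
    refine intervalIntegral.integral_congr fun x _ => ?_
    simp only [hG]
    congr 1
    rw [show -((k : ℝ) * (x + (b : ℕ))) = -(k * x) + ((-(k * (b : ℕ)) : ℤ) : ℝ) by push_cast; ring, ee_add_int]
  simp_rw [h1]
  rw [Fin.sum_univ_eq_sum_range (fun b => ∫ x in (b : ℝ)..(b + 1 : ℕ), G x) p,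
    intervalIntegral.sum_integral_adjacent_intervals (fun k _ => ii_of_bdd hGm hGB _ _)]
  have := intervalIntegral.integral_comp_mul_left (a := 0) (b := 1) G hp0.ne'
  rw [mul_zero, mul_one] at this
  have e2 : ∫ u in (0 : ℝ)..1, g u * ee (-((k * p : ℤ) * u)) = ∫ x in (0 : ℝ)..1, G (p * x) := by
    refine intervalIntegral.integral_congr fun x _ => ?_
    simp only [hG]
    rw [mul_div_cancel_left₀ _ hp0.ne']
    congr 2; push_cast; ring
  rw [e2, this, Nat.cast_zero, Complex.real_smul, ← mul_assoc]
  push_cast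
  rw [mul_inv_cancel₀ (by exact_mod_cast hp.ne'), one_mul]

lemma fourier_none {g : ℝ → ℂ} (hg : Measurable g) {B : ℝ} (hB : ∀ x, ‖g x‖ ≤ B) (hp1 : Function.Periodic g 1) (p : ℕ) (hp : 0 < p)
    (k : ℤ) : (∫ x in (0 : ℝ)..1, g (p * x) * ee (-(k * x)) = 0) ∨
      ∃ k' : ℤ, k = p * k' ∧ ∫ x in (0 : ℝ)..1, g (p * x) * ee (-(k * x)) =
        ∫ x in (0 : ℝ)..1, g x * ee (-(k' * x)) := by
  have hp0 : (0 : ℝ) < p := by exact_mod_cast hp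
  by_cases hk : (p : ℤ) ∣ k
  · right
    obtain ⟨k', rfl⟩ := hk
    refine ⟨k', rfl, ?_⟩
    set H : ℝ → ℂ := fun x => g x * ee (-(k' * x)) with hH
    have hHp : Function.Periodic H 1 := by
      intro x
      simp only [hH]
      rw [hp1, show -((k' : ℝ) * (x + 1)) = -(k' * x) + ((-k' : ℤ) : ℝ) by push_cast; ring, ee_add_int]
    have e2 : ∫ x in (0 : ℝ)..1, g (p * x) * ee (-(((p * k' : ℤ) : ℝ) * x)) = ∫ x in (0 : ℝ)..1, H (p * x) := by
      refine intervalIntegral.integral_congr fun x _ => ?_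
      simp only [hH]
      congr 2; push_cast; ring
    rw [e2, intervalIntegral.integral_comp_mul_left H hp0.ne', mul_zero, mul_one]
    have := hHp.intervalIntegral_add_zsmul_eq p 0
    simp only [zero_add, natCast_zsmul, nsmul_eq_mul, mul_one] at this
    rw [this (ii_of_bdd (hg.mul (measurable_ee.comp (by fun_prop))) (B := B) (fun x => by
      simp only [hH]; rw [norm_mul, norm_ee, mul_one]; exact hB _)), Complex.real_smul]
    push_cast
    rw [← mul_assoc, inv_mul_cancel₀ (by exact_mod_cast hp.ne'), one_mul]
  · left
    set G : ℝ → ℂ := fun x => g (p * x) * ee (-(k * x)) with hG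
    have hGp : Function.Periodic G 1 := by
      intro x
      simp only [hG]
      have : g (p * (x + 1)) = g (p * x) := by
        have := hp1.nsmul p (p * x)
        rw [nsmul_eq_mul, mul_one] at this
        rw [mul_add, mul_one, this]
      rw [this, show -((k : ℝ) * (x + 1)) = -(k * x) + ((-k : ℤ) : ℝ) by push_cast; ring, ee_add_int]
    have h1 : ∫ x in (0 : ℝ)..1, G (x + 1 / p) = ∫ x in (0 : ℝ)..1, G x := by
      rw [intervalIntegral.integral_comp_add_right, zero_add, add_comm (1 : ℝ)]
      have := hGp.intervalIntegral_add_eq (1 / p) 0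
      rw [zero_add] at this
      exact this
    have h2 : ∀ x, G (x + 1 / p) = ee (-(k / p)) * G x := by
      intro x
      simp only [hG]
      rw [show (p : ℝ) * (x + 1 / p) = p * x + 1 by field_simp, hp1,
        show -((k : ℝ) * (x + 1 / p)) = -(k / p) + -(k * x) by field_simp; ring, ee_add]
      ring
    simp_rw [h2] at h1
    rw [intervalIntegral.integral_const_mul] at h1
    by_contra hne
    have : ee (-(k / p)) = 1 := by
      apply mul_right_cancel₀ hne; rw [h1, one_mul]
    obtain ⟨n, hn⟩ := ee_eq_one this
    apply hk
    refine ⟨-n, ?_⟩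
    have : (k : ℝ) = p * (-n) := by
      rw [← hn]; field_simp
    exact_mod_cast this

lemma fc_TX (p : ℕ) (hp : p.Prime) {f : XX → ℂ} (hf : Measurable f) {B : ℝ} (hB : ∀ x, ‖f x‖ ≤ B)
    (k : ℤ) {y : ℝ} (hy : 0 < y) :
    fc (TX p f) k y = ((p : ℂ) + 1)⁻¹ * ((∫ x in (0 : ℝ)..1, FF f (p * x) (p * y) * ee (-(k * x))) +
      p * fc f (k * p) (y / p)) := by
  have hm := measurable_FF hf
  have hBF : ∀ x y, ‖FF f x y‖ ≤ B := fun x y => hB _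
  rw [fc, fc, ← fourier_some (hm (y / p)) (fun x => hBF x _) p hp.pos k]
  have e : ∀ x, FF (TX p f) x y * ee (-(k * x)) = ((p : ℂ) + 1)⁻¹ * (FF f (p * x) (p * y) * ee (-(k * x)) +
      ∑ b : Fin p, FF f ((x + (b : ℕ)) / p) (y / p) * ee (-(k * x))) := by
    intro x
    rw [FF, TX_mk p hp, Fintype.sum_option, FF_none p hp f hy]
    simp_rw [FF_some p hp f hy]
    rw [← Finset.sum_mul]; ring
  have hi : ∀ g : ℝ → ℝ, Measurable g → ∀ y, IntervalIntegrable (fun x => FF f (g x) y * ee (-(k * x))) volume 0 1 := by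
    intro g hg y
    refine ii_of_bdd (((hm y).comp hg).mul (measurable_ee.comp (by fun_prop))) (B := B) (fun x => ?_) _ _
    rw [Pi.mul_apply, Function.comp_apply, Function.comp_apply, norm_mul, norm_ee, mul_one]; exact hBF _ _
  simp_rw [e]
  rw [intervalIntegral.integral_const_mul, intervalIntegral.integral_add (hi _ (by fun_prop) _),
    intervalIntegral.integral_finsetSum]
  · intro b _; exact hi _ (by fun_prop) _
  · have := IntervalIntegrable.sum (Finset.univ : Finset (Fin p))
      (f := fun b x => FF f ((x + (b : ℕ)) / p) (y / p) * ee (-(k * x))) (fun b _ => hi _ (by fun_prop) _)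
    simpa only [Finset.sum_fn] using this

def rho (p : ℕ) (κ : ℝ) : ℝ := ((p : ℝ) ^ κ + (p : ℝ) ^ (1 - κ)) / (p + 1)

lemma rho_pos {p : ℕ} (hp : p.Prime) (κ) : 0 < rho p κ := by
  have hp0 : (0 : ℝ) < p := by exact_mod_cast hp.pos
  unfold rho; positivity

lemma rho_lt {p : ℕ} (hp : p.Prime) {κ : ℝ} (h0 : 0 < κ) (h1 : κ < 1) : rho p κ < 1 := by
  have hp1 : (1 : ℝ) < p := by exact_mod_cast hp.one_lt
  have a := Real.one_lt_rpow hp1 h0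
  have b := Real.one_lt_rpow hp1 (sub_pos.2 h1)
  have c : (p : ℝ) ^ κ * (p : ℝ) ^ (1 - κ) = p := by
    rw [← Real.rpow_add (by linarith)]; simp
  rw [rho, div_lt_one (by linarith)]
  nlinarith

lemma fc_TX_le (p : ℕ) (hp : p.Prime) {f : XX → ℂ} (hf : Measurable f) {B : ℝ} (hB : ∀ x, ‖f x‖ ≤ B)
    {K : Set ℤ} (hK1 : ∀ k ∈ K, k * p ∈ K) (hK2 : ∀ k, (p : ℤ) * k ∈ K → k ∈ K) {C κ : ℝ} (hC : 0 ≤ C)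
    (h : ∀ k ∈ K, ∀ y, 0 < y → ‖fc f k y‖ ≤ C * y ^ κ) :
    ∀ k ∈ K, ∀ y, 0 < y → ‖fc (TX p f) k y‖ ≤ (rho p κ * C) * y ^ κ := by
  intro k hk y hy
  have hp0 : (0 : ℝ) < p := by exact_mod_cast hp.pos
  rw [fc_TX p hp hf hB k hy]
  have a1 : ‖∫ x in (0 : ℝ)..1, FF f (p * x) (p * y) * ee (-(k * x))‖ ≤ C * (p * y) ^ κ := by
    rcases fourier_none (measurable_FF hf _) (fun x => hB _) (FF_periodic f (mul_pos hp0 hy)) p hp.pos k with h0 | ⟨k', rfl, h0⟩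
    · rw [h0, norm_zero]; positivity
    · rw [h0]; exact h k' (hK2 _ hk) _ (by positivity)
  have a2 : ‖(p : ℂ) * fc f (k * p) (y / p)‖ ≤ p * (C * (y / p) ^ κ) := by
    rw [norm_mul, Complex.norm_natCast]
    gcongr
    exact h _ (hK1 k hk) _ (by positivity)
  have e3 : ‖((p : ℂ) + 1)⁻¹‖ = ((p : ℝ) + 1)⁻¹ := by
    rw [norm_inv, ← Nat.cast_succ, Complex.norm_natCast]; push_cast; rfl
  rw [norm_mul, e3]
  refine (mul_le_mul_of_nonneg_left ((norm_add_le _ _).trans (add_le_add a1 a2)) (by positivity)).trans ?_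
  rw [Real.mul_rpow hp0.le hy.le, Real.div_rpow hy.le hp0.le, rho, Real.rpow_sub hp0, Real.rpow_one]
  apply le_of_eq
  field_simp

lemma TX_bdd (p : ℕ) {f : XX → ℂ} {B : ℝ} (hB : ∀ x, ‖f x‖ ≤ B) (x) : ‖TX p f x‖ ≤ B := by
  have e3 : ‖((p : ℂ) + 1)⁻¹‖ = ((p : ℝ) + 1)⁻¹ := by
    rw [norm_inv, ← Nat.cast_succ, Complex.norm_natCast]; push_cast; rfl
  rw [TX, norm_mul, e3]
  refine (mul_le_mul_of_nonneg_left ((norm_sum_le _ _).trans (Finset.sum_le_sum fun i _ => hB _)) (by positivity)).trans ?_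
  rw [Finset.sum_const, Finset.card_univ, Fintype.card_option, Fintype.card_fin, nsmul_eq_mul]
  apply le_of_eq
  push_cast
  field_simp

lemma fc_iter_le (p : ℕ) (hp : p.Prime) {f : XX → ℂ} (hf : Measurable f) {B : ℝ} (hB : ∀ x, ‖f x‖ ≤ B)
    {K : Set ℤ} (hK1 : ∀ k ∈ K, k * p ∈ K) (hK2 : ∀ k, (p : ℤ) * k ∈ K → k ∈ K) {C κ : ℝ} (hC : 0 ≤ C)
    (h : ∀ k ∈ K, ∀ y, 0 < y → ‖fc f k y‖ ≤ C * y ^ κ) (n : ℕ) :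
    Measurable ((TX p)^[n] f) ∧ (∀ x, ‖(TX p)^[n] f x‖ ≤ B) ∧
    ∀ k ∈ K, ∀ y, 0 < y → ‖fc ((TX p)^[n] f) k y‖ ≤ (rho p κ ^ n * C) * y ^ κ := by
  induction n with
  | zero => simpa using ⟨hf, hB, h⟩
  | succ n ih =>
    obtain ⟨a, b, c⟩ := ih
    rw [Function.iterate_succ_apply']
    refine ⟨measurable_TX p hp a, TX_bdd p b, ?_⟩
    have := fc_TX_le p hp a b hK1 hK2 (mul_nonneg (pow_nonneg (rho_pos hp κ).le n) hC) c
    rwa [pow_succ', mul_assoc]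

lemma integral_conj_PP {α : ℝ} (hα : 0 < α) (m : ℤ) {f : XX → ℂ} (hf : Measurable f) {B : ℝ}
    (hB : ∀ x, ‖f x‖ ≤ B) :
    ∫ x, (starRingEnd ℂ) (PP m α x) * f x ∂muX = ∫ z in box α, ee (-(m * z.re)) * f (mkX z) := by
  have hfz : Measurable fun z => f (mkX z) := measurable_X.1 hf
  have hb : volume (box α) < ⊤ := by rw [volume_box hα]; exact ENNReal.ofReal_lt_top
  rw [integral_muX_unfold _ (fun z => (box α).indicator (fun z => ee (-(m * z.re)) * f (mkX z)) z)]
  · rw [integral_indicator (measurableSet_box α)]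
  · exact (((measurable_ee.comp (measurable_const.mul measurable_re).neg)).mul hfz).indicator (measurableSet_box α)
  · rw [integrable_indicator_iff (measurableSet_box α)]
    refine Measure.integrableOn_of_bounded (M := B) hb.ne
      (((measurable_ee.comp (measurable_const.mul measurable_re).neg)).mul hfz).aestronglyMeasurable (ae_of_all _ fun z => ?_)
    rw [norm_mul, norm_ee, one_mul]; exact hB _
  · exact (Complex.continuous_conj.measurable.comp (measurable_PP hα m)).mul hf
  · intro z
    rw [PP_mk, Complex.conj_tsum, ← tsum_mul_right]
    refine tsum_congr fun γ => ?_
    classical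
    rw [sfun, Set.indicator_apply, Set.indicator_apply, mkX_smul]
    split_ifs
    · rw [conj_ee]
    · simp

lemma setIntegral_box {α : ℝ} (hα : 0 < α) {g : ℍ → ℂ} (hg : Measurable g) {B : ℝ} (hB : ∀ x, ‖g x‖ ≤ B) :
    ∫ z in box α, g z = ∫ y in Set.Ici α, (∫ x in (0 : ℝ)..1, g (mkH (x, y))) ∂nuY := by
  have : IsFiniteMeasure (nuY.restrict (Set.Ici α)) := ⟨by
    rw [Measure.restrict_apply_univ, nuY_Ici hα]; exact ENNReal.ofReal_lt_top⟩
  rw [restrict_box, integral_map measurable_mkH.aemeasurable hg.aestronglyMeasurable, integral_prod_symm]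
  · refine integral_congr_ae (ae_of_all _ fun y => ?_)
    simp only
    rw [intervalIntegral.integral_of_le zero_le_one,
      Measure.restrict_congr_set (Ico_ae_eq_Ioc (a := (0 : ℝ)) (b := 1) (μ := volume))]
  · exact Integrable.of_bound (hg.comp measurable_mkH).aestronglyMeasurable B (ae_of_all _ fun q => hB _)

lemma integral_nuY_rpow_le {α κ : ℝ} (hα : 0 < α) (hκ : κ < 1) {g : ℝ → ℂ} {C : ℝ}
    (h : ∀ y, 0 < y → ‖g y‖ ≤ C * y ^ κ) :
    ‖∫ y in Set.Ici α, g y ∂nuY‖ ≤ C * (α ^ (κ - 1) / (1 - κ)) := by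
  have hsub : Set.Ici α ∩ Set.Ioi 0 = Set.Ici α :=
    Set.inter_eq_left.2 (fun y (hy : α ≤ y) => lt_of_lt_of_le hα hy)
  have hw : nuY.restrict (Set.Ici α) = (volume.restrict (Set.Ici α)).withDensity fun y => ENNReal.ofReal (1 / y ^ 2) := by
    rw [nuY, restrict_withDensity measurableSet_Ici, Measure.restrict_restrict measurableSet_Ici, hsub]
  rw [hw, integral_withDensity_eq_integral_toReal_smul (by fun_prop) (ae_of_all _ fun _ => ENNReal.ofReal_lt_top),
    ← Measure.restrict_congr_set (Ioi_ae_eq_Ici (a := α) (μ := volume))]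
  have h2 : ∫ y in Set.Ioi α, C * y ^ (κ - 2) = C * (α ^ (κ - 1) / (1 - κ)) := by
    rw [integral_const_mul, integral_Ioi_rpow_of_lt (by linarith) hα]
    rw [show κ - 2 + 1 = κ - 1 by ring, neg_div, ← div_neg, neg_sub]
  rw [← h2]
  refine norm_integral_le_of_norm_le ((integrableOn_Ioi_rpow_of_lt (by linarith) hα).const_mul C) ?_
  filter_upwards [ae_restrict_mem measurableSet_Ioi] with y hy
  have hy0 : 0 < y := hα.trans hy
  rw [norm_smul, ENNReal.toReal_ofReal (by positivity), Real.norm_of_nonneg (by positivity)]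
  calc 1 / y ^ 2 * ‖g y‖ ≤ 1 / y ^ 2 * (C * y ^ κ) := by gcongr; exact h y hy0
    _ = C * y ^ (κ - 2) := by
      rw [Real.rpow_sub hy0, Real.rpow_two]; field_simp

/-- pairing estimate -/
lemma pair_le {α κ : ℝ} (hα : 0 < α) (hκ : κ < 1) (m : ℤ) {f : XX → ℂ} (hf : Measurable f) {B : ℝ}
    (hB : ∀ x, ‖f x‖ ≤ B) {C : ℝ} (h : ∀ y, 0 < y → ‖fc f m y‖ ≤ C * y ^ κ) :
    ‖∫ x, (starRingEnd ℂ) (PP m α x) * f x ∂muX‖ ≤ C * (α ^ (κ - 1) / (1 - κ)) := by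
  rw [integral_conj_PP hα m hf hB, setIntegral_box hα (B := B)]
  · refine integral_nuY_rpow_le hα hκ fun y hy => ?_
    refine le_trans (le_of_eq ?_) (h y hy)
    rw [fc]
    congr 1
    refine intervalIntegral.integral_congr fun x _ => ?_
    show ee (-(m * (mkH (x, y)).re)) * f (mkX (mkH (x, y))) = _
    rw [mkH_re hy, FF, mul_comm]
  · exact (measurable_ee.comp (measurable_const.mul measurable_re).neg).mul (measurable_X.1 hf)
  · intro z; rw [norm_mul, norm_ee, one_mul]; exact hB _

def hc (m : ℤ) (α : ℝ) (n : ℕ) (y t : ℝ) : ℂ :=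
  if α * ((n + 1) ^ 2 * (t ^ 2 + y ^ 2)) ≤ y then ee (-(m * (t / ((n + 1) ^ 2 * (t ^ 2 + y ^ 2))))) else 0

open Classical in
def chi (m : ℤ) (n : ℕ) (d : ZMod (n + 1)) : ℂ :=
  if IsUnit d then ZMod.stdAddChar ((m : ZMod (n + 1)) * d⁻¹) else 0

def tau (m : ℤ) (α : ℝ) (n : ℕ) (d : ℤ) (x y : ℝ) : ℂ :=
  chi m n (d : ZMod (n + 1)) * hc m α n y (x + d / (n + 1))

def tv (m : ℤ) (α x y : ℝ) : ℤ → ℤ → ℂ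
  | Int.ofNat 0, d => if (d = 1 ∨ d = -1) ∧ α ≤ y then ee (m * x) else 0
  | Int.ofNat (n + 1), d => tau m α n d x y
  | Int.negSucc n, d => tau m α n (-d) x y

def uu (m : ℤ) (α : ℝ) (γ : SL(2, ℤ)) (z : ℍ) : ℂ := if α ≤ (γ • z).im then ee (m * (γ • z).re) else 0

lemma SL_det (γ : SL(2, ℤ)) : γ 0 0 * γ 1 1 - γ 0 1 * γ 1 0 = 1 := by
  have d1 := γ.2
  rw [Matrix.det_fin_two] at d1
  exact d1

lemma SL_coe (γ : SL(2, ℤ)) (z : ℍ) :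
    ((γ • z : ℍ) : ℂ) = ((γ 0 0 : ℂ) * z + γ 0 1) / ((γ 1 0 : ℂ) * z + γ 1 1) := by
  rw [← iGL_SL, coe_iGL_smul (by rw [γ.2]; exact one_pos)]

lemma SL_re (γ : SL(2, ℤ)) (z : ℍ) (hc : γ 1 0 ≠ 0) :
    (γ • z).re = (γ 0 0 : ℝ) / γ 1 0 - (z.re + (γ 1 1 : ℝ) / γ 1 0) /
      ((γ 1 0 : ℝ) ^ 2 * ((z.re + (γ 1 1 : ℝ) / γ 1 0) ^ 2 + z.im ^ 2)) := by
  set a := γ 0 0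
  set b := γ 0 1
  set c := γ 1 0
  set d := γ 1 1
  have hdet : (a : ℂ) * d - b * c = 1 := by exact_mod_cast SL_det γ
  have hc0 : (c : ℂ) ≠ 0 := by exact_mod_cast hc
  set t : ℝ := z.re + (d : ℝ) / c with ht
  set w : ℂ := ⟨t, z.im⟩ with hw
  have hw0 : w ≠ 0 := by
    intro h
    have := congrArg Complex.im h
    simp [hw] at this
    exact z.im_pos.ne' this
  have hz : (z : ℂ) = w - d / c := by
    apply Complex.ext
    · have : ((d : ℂ) / c).re = (d : ℝ) / c := by
        rw [show ((d : ℂ) / c) = (((d : ℝ) / c : ℝ) : ℂ) by push_cast; rfl, Complex.ofReal_re]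
      rw [Complex.sub_re, this, hw, ht]; simp
    · have : ((d : ℂ) / c).im = 0 := by
        rw [show ((d : ℂ) / c) = (((d : ℝ) / c : ℝ) : ℂ) by push_cast; rfl, Complex.ofReal_im]
      rw [Complex.sub_im, this, hw]; simp
  have h1 : ((γ • z : ℍ) : ℂ) = (((a : ℝ) / c : ℝ) : ℂ) - (((c : ℝ) ^ 2)⁻¹ : ℝ) * w⁻¹ := by
    rw [SL_coe]
    change ((a : ℂ) * z + b) / ((c : ℂ) * z + d) = _
    have e1 : (c : ℂ) * z + d = c * w := by rw [hz]; field_simp; ring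
    have e2 : (a : ℂ) * z + b = a * w - 1 / c := by
      rw [hz]; field_simp; linear_combination (-1 : ℂ) * hdet
    rw [e1, e2]
    push_cast
    field_simp
  show ((γ • z : ℍ) : ℂ).re = _
  rw [h1, Complex.sub_re, Complex.ofReal_re, Complex.re_ofReal_mul, Complex.inv_re, Complex.normSq_mk]
  rw [← pow_two, ← pow_two]
  congr 1
  show ((c : ℝ) ^ 2)⁻¹ * (t / _) = _
  rw [inv_mul_eq_div, div_div, mul_comm ((c : ℝ) ^ 2)]

lemma chi_of (m : ℤ) (n : ℕ) (a b d : ℤ) (h : a * d - b * (n + 1) = 1) :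
    chi m n (d : ZMod (n + 1)) = ee (m * (a / (n + 1))) := by
  have h1 : (a : ZMod (n + 1)) * d = 1 := by
    have := congrArg (Int.cast : ℤ → ZMod (n + 1)) h
    have h0 : ((n : ZMod (n + 1)) + 1) = 0 := by
      have := ZMod.natCast_self (n + 1); push_cast at this; exact this
    push_cast at this
    rwa [h0, mul_zero, sub_zero] at this
  have hu : IsUnit (d : ZMod (n + 1)) := IsUnit.of_mul_eq_one_right _ h1
  have hinv : (d : ZMod (n + 1))⁻¹ = a := by
    have h2 := ZMod.mul_inv_of_unit _ hu
    calc (d : ZMod (n + 1))⁻¹ = (a * d) * (d : ZMod (n + 1))⁻¹ := by rw [h1, one_mul]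
      _ = a := by rw [mul_assoc, h2, mul_one]
  rw [chi, if_pos hu, hinv, ← Int.cast_mul, ZMod.stdAddChar_coe, ee]
  congr 1
  push_cast
  ring

lemma uu_pos (m : ℤ) {α : ℝ} (γ : SL(2, ℤ)) (z : ℍ) (n : ℕ) (h : γ 1 0 = n + 1) :
    uu m α γ z = tau m α n (γ 1 1) z.re z.im := by
  have hdet := SL_det γ
  rw [h] at hdet
  have hn : (0 : ℝ) < n + 1 := by positivity
  have hc : ((γ 1 0 : ℤ) : ℝ) = n + 1 := by rw [h]; push_cast; rfl
  rw [tau, chi_of m n (γ 0 0) (γ 0 1) (γ 1 1) hdet, uu, SL_re γ z (by rw [h]; positivity), hc]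
  unfold _root_.hc
  have him : α ≤ (γ • z).im ↔ α * ((n + 1 : ℝ) ^ 2 * ((z.re + (γ 1 1 : ℝ) / (n + 1)) ^ 2 + z.im ^ 2)) ≤ z.im := by
    rw [SL_im, hc]
    have e : ((n + 1 : ℝ) * z.re + γ 1 1) ^ 2 + ((n + 1) * z.im) ^ 2 =
        (n + 1 : ℝ) ^ 2 * ((z.re + (γ 1 1 : ℝ) / (n + 1)) ^ 2 + z.im ^ 2) := by field_simp
    rw [e, le_div_iff₀]
    have := z.im_pos
    positivity
  simp only [him]
  split_ifs
  · rw [← ee_add]; congr 1; ring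
  · simp

lemma uu_eq (m : ℤ) {α : ℝ} (γ : SL(2, ℤ)) (z : ℍ) :
    uu m α γ z = tv m α z.re z.im (γ 1 0) (γ 1 1) := by
  rcases hc : γ 1 0 with n | n
  · rcases n with _ | n
    · have hdet := SL_det γ
      rw [hc] at hdet
      simp at hdet
      have hd : γ 1 1 = 1 ∨ γ 1 1 = -1 := Int.isUnit_iff.1 (IsUnit.of_mul_eq_one_right _ hdet)
      have had : γ 0 0 = γ 1 1 := by
        rcases hd with h | h <;> rw [h] at hdet ⊢ <;> omega
      have hc' : γ 1 0 = 0 := hc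
      have him : (γ • z).im = z.im := by
        rw [SL_im, hc']; rcases hd with h | h <;> rw [h] <;> simp
      have hre : (γ • z).re = z.re + ((γ 0 1 * γ 1 1 : ℤ) : ℝ) := by
        show ((γ • z : ℍ) : ℂ).re = _
        rw [SL_coe, hc', had]
        rcases hd with h | h <;> rw [h] <;> simp [div_neg]
        ring
      rw [uu, tv, him, hre]
      simp only [hd, true_and]
      split_ifs
      · rw [show (m : ℝ) * (z.re + ((γ 0 1 * γ 1 1 : ℤ) : ℝ)) = m * z.re + ((m * (γ 0 1 * γ 1 1) : ℤ) : ℝ) by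
          push_cast; ring, ee_add_int]
      · rfl
    · rw [tv, uu_pos m γ z n (by rw [hc]; rfl)]
  · have h := uu_pos m (α := α) (-γ) z n (by
      rw [Matrix.SpecialLinearGroup.coe_neg, Matrix.neg_apply]
      rw [show γ.1 1 0 = γ 1 0 from rfl, hc, Int.neg_negSucc]; push_cast; rfl)
    rw [tv]
    have e1 : (-γ) 1 1 = - γ 1 1 := rfl
    rw [e1] at h
    rw [← h, uu, uu, ModularGroup.SL_neg_smul]

lemma sfun_eq (m : ℤ) {α : ℝ} (w : ℍ) (h : w ∈ box α) : sfun m α w = ee (m * w.re) := by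
  rw [sfun, Set.indicator_of_mem h]

lemma SL_of_coprime {c d : ℤ} (h : IsCoprime c d) : ∃ γ : SL(2, ℤ), γ 1 0 = c ∧ γ 1 1 = d := by
  obtain ⟨u, v, h⟩ := h
  exact ⟨⟨!![v, -u; c, d], by rw [Matrix.det_fin_two_of]; linarith⟩, rfl, rfl⟩

lemma tau_coprime {m : ℤ} {α : ℝ} {n : ℕ} {d : ℤ} {x y : ℝ} (h : tau m α n d x y ≠ 0) :
    IsCoprime ((n : ℤ) + 1) d := by
  have : IsUnit (d : ZMod (n + 1)) := by
    by_contra hu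
    apply h
    rw [tau, chi, if_neg hu, zero_mul]
  have h2 := (ZMod.coe_int_isUnit_iff_isCoprime d (n + 1)).1 this
  exact_mod_cast h2

lemma tv_coprime {m : ℤ} {α x y : ℝ} {c d : ℤ} (h : tv m α x y c d ≠ 0) : IsCoprime c d := by
  rcases c with n | n
  · rcases n with _ | n
    · rw [tv] at h
      have : d = 1 ∨ d = -1 := by
        by_contra hd; apply h; rw [if_neg]; tauto
      show IsCoprime 0 d
      rw [isCoprime_zero_left]; exact Int.isUnit_iff.2 this
    · rw [tv] at h
      exact_mod_cast tau_coprime h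
  · rw [tv] at h
    have := (tau_coprime h).neg_left
    rw [IsCoprime.neg_right_iff] at this
    rw [Int.negSucc_eq]
    exact this

lemma PP_rows {α : ℝ} (hα : 0 < α) (m : ℤ) (z : ℍ) :
    (Function.support fun v : ℤ × ℤ => tv m α z.re z.im v.1 v.2).Finite ∧
    ∑' γ : SL(2, ℤ), sfun m α (γ • z) = ∑' v : ℤ × ℤ, tv m α z.re z.im v.1 v.2 := by
  set g : SL(2, ℤ) → ℂ := fun γ => sfun m α (γ • z) with hg
  have hmem : ∀ γ : Function.support g, γ.1 • z ∈ box α := by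
    intro γ; by_contra h
    exact γ.2 (Set.indicator_of_notMem (s := box α) h _)
  let i : Function.support g → ℤ × ℤ := fun γ => (γ.1 1 0, γ.1 1 1)
  have hi : Function.Injective i := by
    intro γ γ' h
    exact Subtype.ext (row_inj (hmem γ) (hmem γ') (congrArg Prod.fst h) (congrArg Prod.snd h))
  have hf : (Function.support fun v : ℤ × ℤ => tv m α z.re z.im v.1 v.2) ⊆ Set.range i := by
    rintro ⟨c, d⟩ hv
    obtain ⟨γ, rfl, rfl⟩ := SL_of_coprime (tv_coprime hv)
    have hv' : tv m α z.re z.im (γ 1 0) (γ 1 1) ≠ 0 := hv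
    rw [← uu_eq] at hv'
    have : α ≤ (γ • z).im := by
      by_contra h; apply hv'; rw [uu, if_neg h]
    obtain ⟨γ', h1, h2, h3, -⟩ := row_surj γ this
    refine ⟨⟨γ', ?_⟩, ?_⟩
    · show sfun m α (γ' • z) ≠ 0
      rw [sfun_eq m _ h1]
      intro h0
      have := norm_ee (m * (γ' • z).re)
      rw [h0, norm_zero] at this
      norm_num at this
    · simp only [i, h2, h3]
  have : Finite (Function.support g) := (sfun_finite hα m z).to_subtype
  refine ⟨(Set.finite_range i).subset hf, (tsum_eq_tsum_of_ne_zero_bij i hi hf ?_).symm⟩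
  intro γ
  show tv m α z.re z.im (γ.1 1 0) (γ.1 1 1) = sfun m α (γ.1 • z)
  rw [← uu_eq, sfun_eq m _ (hmem γ), uu, if_pos (hmem γ).2.2]

lemma PP_formula {α : ℝ} (hα : 0 < α) (m : ℤ) {x y : ℝ} (hy : 0 < y) {N : ℕ}
    (hN : ∀ n, N ≤ n → y < α * ((n + 1 : ℝ) ^ 2 * y ^ 2)) :
    FF (PP m α) x y = 2 * (if α ≤ y then ee (m * x) else 0) +
      2 * ∑ n ∈ Finset.range N, ∑' d : ℤ, tau m α n d x y := by
  obtain ⟨hfin, hs⟩ := PP_rows hα m (mkH (x, y))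
  rw [mkH_re hy, mkH_im hy] at hfin hs
  simp only at hfin hs
  rw [FF, PP_mk, hs]
  have hsum : Summable fun v : ℤ × ℤ => tv m α x y v.1 v.2 := summable_of_hasFiniteSupport hfin
  rw [hsum.tsum_prod' (fun c => hsum.prod_factor c)]
  have hsum1 : Summable fun c => ∑' d, tv m α x y c d := hsum.prod
  have hzero : ∀ n, N ≤ n → ∀ d : ℤ, tau m α n d x y = 0 := by
    intro n hn d
    rw [tau, hc, if_neg, mul_zero]
    push Not
    refine (hN n hn).trans_le ?_
    gcongr
    nlinarith [sq_nonneg (x + (d : ℝ) / (n + 1))]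
  have hT : ∀ n ∉ Finset.range N, ∑' d : ℤ, tau m α n d x y = 0 := by
    intro n hn
    rw [Finset.mem_range, not_lt] at hn
    simp [hzero n hn]
  set G : ℤ → ℂ := fun c => ∑' d, tv m α x y c d with hG
  have h1 : Summable fun n : ℕ => G n := hsum1.comp_injective (Nat.cast_injective (R := ℤ))
  have e0 : G 0 = 2 * (if α ≤ y then ee (m * x) else 0) := by
    simp only [hG]
    rw [tsum_eq_sum (s := {1, -1})]
    · rw [Finset.sum_pair (by norm_num)]
      show tv m α x y (Int.ofNat 0) 1 + tv m α x y (Int.ofNat 0) (-1) = _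
      rw [tv, tv]; simp; split_ifs <;> ring
    · intro d hd
      show tv m α x y (Int.ofNat 0) d = 0
      rw [tv, if_neg]
      simp at hd; tauto
  have hpos : ∀ n : ℕ, G ((n + 1 : ℕ) : ℤ) = ∑' d, tau m α n d x y := by
    intro n
    refine tsum_congr fun d => ?_
    show tv m α x y (Int.ofNat (n + 1)) d = _
    rw [tv]
  have hneg : ∀ n : ℕ, G (-((n : ℤ) + 1)) = ∑' d, tau m α n d x y := by
    intro n
    simp only [hG]
    rw [← Int.negSucc_eq, ← (Equiv.neg ℤ).tsum_eq (fun d => tau m α n d x y)]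
    refine tsum_congr fun d => ?_
    rw [tv]; rfl
  have h2 : Summable fun n : ℕ => G (-((n : ℤ) + 1)) := by
    simp_rw [hneg]
    exact summable_of_ne_finset_zero hT
  have e5 : ∑' c, G c = ∑' n : ℕ, G n + ∑' n : ℕ, G (-((n : ℤ) + 1)) := tsum_of_nat_of_neg_add_one h1 h2
  rw [e5, h1.tsum_eq_zero_add, tsum_congr hneg, tsum_congr hpos, tsum_eq_sum hT, Nat.cast_zero, e0]
  ring

lemma periodize {G : ℝ → ℂ} (hm : Measurable G) (hG : Integrable G) :
    IntervalIntegrable (fun x => ∑' l : ℤ, G (x + l)) volume 0 1 ∧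
    ∫ x in (0:ℝ)..1, ∑' l : ℤ, G (x + l) = ∫ t, G t := by
  have h01 : (0:ℝ) ≤ 1 := zero_le_one
  have hi : ∀ l : ℤ, Integrable (fun x : ℝ => G (x + l)) (volume.restrict (Set.Ioc 0 1)) := fun l =>
    (hG.comp_add_right (l : ℝ)).integrableOn
  have hs : Summable fun l : ℤ => ∫ x, ‖G (x + l)‖ ∂(volume.restrict (Set.Ioc (0:ℝ) 1)) := by
    have := hG.norm.hasSum_intervalIntegral_comp_add_int.summable
    simpa only [intervalIntegral.integral_of_le h01] using this
  constructor
  · rw [intervalIntegrable_iff_integrableOn_Ioc_of_le h01]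
    refine ⟨(Measurable.tsum fun l => hm.comp (measurable_add_const _)).aestronglyMeasurable, ?_⟩
    rw [hasFiniteIntegral_iff_enorm]
    calc ∫⁻ x in Set.Ioc (0:ℝ) 1, ‖∑' l : ℤ, G (x + l)‖ₑ
        ≤ ∫⁻ x in Set.Ioc (0:ℝ) 1, ∑' l : ℤ, ‖G (x + l)‖ₑ :=
          lintegral_mono fun x => enorm_tsum_le_tsum_enorm
      _ = ∑' l : ℤ, ∫⁻ x in Set.Ioc (0:ℝ) 1, ‖G (x + l)‖ₑ :=
          lintegral_tsum fun l => ((hm.comp (measurable_add_const _)).enorm).aemeasurable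
      _ = ∑' l : ℤ, ENNReal.ofReal (∫ x in Set.Ioc (0:ℝ) 1, ‖G (x + l)‖) := by
          congr 1; ext l; rw [ofReal_integral_norm_eq_lintegral_enorm (hi l)]
      _ < ⊤ := hs.tsum_ofReal_lt_top
  · rw [intervalIntegral.integral_of_le h01, ← (hasSum_integral_of_summable_integral_norm hi hs).tsum_eq]
    have := hG.hasSum_intervalIntegral_comp_add_int.tsum_eq
    simpa only [intervalIntegral.integral_of_le h01] using this

lemma measurable_hc (m : ℤ) (α : ℝ) (n : ℕ) (y : ℝ) : Measurable (hc m α n y) := by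
  unfold hc
  refine Measurable.ite ?_ (measurable_ee.comp (by fun_prop)) measurable_const
  exact measurableSet_le (by fun_prop) measurable_const

lemma hc_eq_zero {m : ℤ} {α : ℝ} (hα : 0 < α) {n : ℕ} {y t : ℝ}
    (h : Real.sqrt (y / α) / (n + 1) < |t|) : hc m α n y t = 0 := by
  rw [hc, if_neg]
  intro h1
  have hn : (0:ℝ) < n + 1 := by positivity
  rw [div_lt_iff₀ hn] at h
  have h2 : y / α < (|t| * (n+1)) ^ 2 := by
    rcases le_or_gt 0 (y / α) with h3 | h3
    · exact (Real.sqrt_lt' (lt_of_le_of_lt (Real.sqrt_nonneg _) h)).1 h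
    · exact lt_of_lt_of_le h3 (sq_nonneg _)
  rw [div_lt_iff₀ hα, mul_pow, sq_abs] at h2
  nlinarith [mul_nonneg hα.le (mul_nonneg (sq_nonneg ((n:ℝ)+1)) (sq_nonneg y))]

lemma norm_hc_le (m : ℤ) (α : ℝ) (n : ℕ) (y t : ℝ) : ‖hc m α n y t‖ ≤ 1 := by
  rw [hc]; split_ifs
  · rw [norm_ee]
  · simp

/-- The archimedean integral. -/
def gk (m : ℤ) (α : ℝ) (n : ℕ) (y : ℝ) (k : ℤ) (t : ℝ) : ℂ := hc m α n y t * ee (-(k * t))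

lemma measurable_gk (m : ℤ) (α : ℝ) (n : ℕ) (y : ℝ) (k : ℤ) : Measurable (gk m α n y k) :=
  (measurable_hc m α n y).mul (measurable_ee.comp (by fun_prop))

lemma norm_gk (m : ℤ) (α : ℝ) (n : ℕ) (y : ℝ) (k : ℤ) (t : ℝ) : ‖gk m α n y k t‖ = ‖hc m α n y t‖ := by
  rw [gk, norm_mul, norm_ee, mul_one]

lemma gk_le {m : ℤ} {α : ℝ} (hα : 0 < α) (n : ℕ) (y : ℝ) (k : ℤ) (t : ℝ) :
    ‖gk m α n y k t‖ ≤ (Set.Icc (-(Real.sqrt (y / α) / (n + 1))) (Real.sqrt (y / α) / (n + 1))).indicator (fun _ => (1:ℝ)) t := by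
  rw [norm_gk]
  by_cases h : |t| ≤ Real.sqrt (y / α) / (n + 1)
  · rw [Set.indicator_of_mem (by rw [Set.mem_Icc]; exact abs_le.1 h)]
    exact norm_hc_le ..
  · rw [hc_eq_zero hα (not_le.1 h), norm_zero]
    exact Set.indicator_nonneg (fun _ _ => zero_le_one) _

lemma integrable_gk {m : ℤ} {α : ℝ} (hα : 0 < α) (n : ℕ) (y : ℝ) (k : ℤ) : Integrable (gk m α n y k) := by
  refine Integrable.mono' (g := (Set.Icc (-(Real.sqrt (y / α) / (n + 1))) (Real.sqrt (y / α) / (n + 1))).indicator (fun _ => (1:ℝ))) ?_ (measurable_gk ..).aestronglyMeasurable (ae_of_all _ (gk_le hα n y k))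
  rw [integrable_indicator_iff measurableSet_Icc]
  exact integrableOn_const (by rw [Real.volume_Icc]; exact ENNReal.ofReal_ne_top)

lemma norm_integral_gk {m : ℤ} {α : ℝ} (hα : 0 < α) (n : ℕ) (y : ℝ) (k : ℤ) :
    ‖∫ t, gk m α n y k t‖ ≤ 2 * Real.sqrt (y / α) / (n + 1) := by
  refine (norm_integral_le_of_norm_le ?_ (ae_of_all _ (gk_le hα n y k))).trans ?_
  · rw [integrable_indicator_iff measurableSet_Icc]
    exact integrableOn_const (by rw [Real.volume_Icc]; exact ENNReal.ofReal_ne_top)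
  · have : (0:ℝ) ≤ Real.sqrt (y / α) / (n + 1) := by positivity
    rw [integral_indicator measurableSet_Icc, setIntegral_const, Measure.real, Real.volume_Icc,
      ENNReal.toReal_ofReal (by linarith), smul_eq_mul, mul_one]
    apply le_of_eq; ring

lemma kloos_eq (m k : ℤ) (n : ℕ) :
    ∑ j : Fin (n+1), chi m n ((j : ℕ) : ZMod (n+1)) * ZMod.stdAddChar ((k : ZMod (n+1)) * ((j:ℕ) : ZMod (n+1))) =
      kloos (n+1) (k : ZMod (n+1)) (m : ZMod (n+1)) := by
  classical
  have e1 : ∑ j : Fin (n+1), chi m n ((j : ℕ) : ZMod (n+1)) * ZMod.stdAddChar ((k : ZMod (n+1)) * ((j:ℕ) : ZMod (n+1)))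
      = ∑ j : ZMod (n+1), chi m n j * ZMod.stdAddChar ((k : ZMod (n+1)) * j) := by
    refine Fintype.sum_equiv (ZMod.finEquiv (n+1)).toEquiv _ _ fun j => ?_
    have : (((j : Fin (n+1)) : ℕ) : ZMod (n+1)) = (ZMod.finEquiv (n+1)) j := by
      exact Fin.cast_val_eq_self j
    rw [this]; rfl
  rw [e1, kloos]
  have e2 : ∀ j : ZMod (n+1), chi m n j * ZMod.stdAddChar ((k : ZMod (n+1)) * j) =
      if IsUnit j then ZMod.stdAddChar ((k : ZMod (n+1)) * j + (m : ZMod (n+1)) * j⁻¹) else 0 := by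
    intro j
    rw [chi]
    split_ifs with h
    · rw [AddChar.map_add_eq_mul, mul_comm]
    · rw [zero_mul]
  rw [Finset.sum_congr rfl fun j _ => e2 j, ← Finset.sum_filter]
  symm
  refine Finset.sum_bij (fun (u : (ZMod (n+1))ˣ) _ => (u : ZMod (n+1))) ?_ ?_ ?_ ?_
  · intro u _; simp
  · intro u _ v _ h; exact Units.ext h
  · intro b hb
    rw [Finset.mem_filter] at hb
    exact ⟨hb.2.unit, Finset.mem_univ _, rfl⟩
  · intro u _
    rw [ZMod.inv_coe_unit]

lemma tau_shift (m : ℤ) (α : ℝ) (n : ℕ) (k : ℤ) (x y : ℝ) (l : ℤ) (j : ℕ) :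
    tau m α n (j + ((n+1 : ℕ) : ℤ) * l) x y * ee (-(k * x)) =
      (chi m n (j : ZMod (n+1)) * ZMod.stdAddChar ((k : ZMod (n+1)) * (j : ZMod (n+1)))) *
        gk m α n y k ((x + l) + j / (n+1)) := by
  have hn : ((n:ℝ)+1) ≠ 0 := by positivity
  have e1 : (((j + ((n+1 : ℕ) : ℤ) * l : ℤ)) : ZMod (n+1)) = (j : ZMod (n+1)) := by
    have : ((n:ZMod (n+1)) + 1) = 0 := by exact_mod_cast ZMod.natCast_self (n+1)
    push_cast
    rw [this]; ring
  have e2 : x + (((j + ((n+1 : ℕ) : ℤ) * l : ℤ)) : ℝ) / (n+1) = (x + l) + j / (n+1) := by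
    push_cast; field_simp; ring
  have e3 : ZMod.stdAddChar ((k : ZMod (n+1)) * (j : ZMod (n+1))) = ee (k * (j / (n+1))) := by
    have : (k : ZMod (n+1)) * (j : ZMod (n+1)) = ((k * j : ℤ) : ZMod (n+1)) := by push_cast; rfl
    rw [this, ZMod.stdAddChar_coe, ee]
    congr 1; push_cast; ring
  rw [tau, e1, e2, e3, gk]
  have e4 : ee (-(k * x)) = ee (k * (j / (n+1))) * ee (-(k * ((x + l) + j / (n+1)))) := by
    rw [← ee_add, show k * ((j:ℝ) / (n+1)) + -(k * ((x + l) + j / (n+1))) = -(k * x) + ((-(k * l) : ℤ) : ℝ) by push_cast; ring,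
      ee_add_int]
  rw [e4]; ring

lemma tau_finite {m : ℤ} {α : ℝ} (hα : 0 < α) (n : ℕ) (x y : ℝ) :
    (Function.support fun d : ℤ => tau m α n d x y).Finite := by
  set M := Real.sqrt (y / α) / (n + 1)
  refine (Set.finite_Icc (-⌈(M + |x|) * (n+1)⌉) ⌈(M + |x|) * (n+1)⌉).subset ?_
  intro d hd
  have h1 : |x + d / (n+1)| ≤ M := by
    by_contra h
    exact hd (by change tau m α n d x y = 0; rw [tau, hc_eq_zero hα (not_le.1 h), mul_zero])
  have hn : (0:ℝ) < n+1 := by positivity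
  have h2 : |(d:ℝ)| ≤ (M + |x|) * (n+1) := by
    have : |(d:ℝ) / (n+1)| ≤ M + |x| := by
      calc |(d:ℝ) / (n+1)| = |(x + d/(n+1)) - x| := by congr 1; ring
        _ ≤ |x + d/(n+1)| + |x| := abs_sub _ _
        _ ≤ _ := by linarith
    rwa [abs_div, abs_of_pos hn, div_le_iff₀ hn] at this
  have h3 := abs_le.1 (h2.trans (Int.le_ceil _))
  exact ⟨by exact_mod_cast h3.1, by exact_mod_cast h3.2⟩

lemma ii_sum {ι : Type*} (s : Finset ι) {f : ι → ℝ → ℂ} {a b : ℝ}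
    (h : ∀ i ∈ s, IntervalIntegrable (f i) volume a b) :
    IntervalIntegrable (fun x => ∑ i ∈ s, f i x) volume a b := by
  have := IntervalIntegrable.sum s h
  have e : (∑ i ∈ s, f i) = fun x => ∑ i ∈ s, f i x := by funext x; rw [Finset.sum_apply]
  rwa [e] at this

lemma tsum_divmod {f : ℤ → ℂ} (hf : Summable f) (c : ℕ) [NeZero c] :
    ∑' d, f d = ∑ j : Fin c, ∑' l : ℤ, f ((j : ℕ) + (c : ℤ) * l) := by
  set σ : Fin c × ℤ ≃ ℤ := (Equiv.prodComm _ _).trans (Int.divModEquiv c).symm with hσ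
  have hs2 : Summable fun q => f (σ q) := σ.summable_iff.2 hf
  rw [← σ.tsum_eq, hs2.tsum_prod, tsum_fintype]
  refine Finset.sum_congr rfl fun j _ => tsum_congr fun l => ?_
  rw [show σ (j, l) = (j : ℕ) + (c : ℤ) * l by
    rw [hσ]; simp only [Equiv.trans_apply, Equiv.prodComm_apply, Prod.swap_prod_mk, Int.divModEquiv_symm_apply]; ring]

lemma tau_fourier {m : ℤ} {α : ℝ} (hα : 0 < α) (n : ℕ) (k : ℤ) (y : ℝ) :
    IntervalIntegrable (fun x => (∑' d : ℤ, tau m α n d x y) * ee (-(k * x))) volume 0 1 ∧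
    ∫ x in (0:ℝ)..1, (∑' d : ℤ, tau m α n d x y) * ee (-(k * x)) =
      kloos (n+1) (k : ZMod (n+1)) (m : ZMod (n+1)) * ∫ t, gk m α n y k t := by
  set ψ : Fin (n+1) → ℂ := fun j => chi m n ((j : ℕ) : ZMod (n+1)) * ZMod.stdAddChar ((k : ZMod (n+1)) * ((j:ℕ) : ZMod (n+1))) with hψ
  set G : Fin (n+1) → ℝ → ℂ := fun j t => gk m α n y k (t + ((j:ℕ):ℝ) / (n+1)) with hGd
  have hGm : ∀ j, Measurable (G j) := fun j => (measurable_gk ..).comp (measurable_add_const _)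
  have hGi : ∀ j, Integrable (G j) := fun j => (integrable_gk hα n y k).comp_add_right _
  have hp := fun j => periodize (hGm j) (hGi j)
  have key : (fun x : ℝ => (∑' d : ℤ, tau m α n d x y) * ee (-(k * x))) =
      fun x => ∑ j, ψ j * ∑' l : ℤ, G j (x + l) := by
    funext x
    have hsm : Summable fun d : ℤ => tau m α n d x y * ee (-(k * x)) :=
      (summable_of_hasFiniteSupport (tau_finite hα n x y)).mul_right _
    rw [← tsum_mul_right, tsum_divmod hsm (n+1)]
    refine Finset.sum_congr rfl fun j _ => ?_
    rw [← tsum_mul_left]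
    exact tsum_congr fun l => tau_shift m α n k x y l j
  have hi : ∀ j ∈ Finset.univ, IntervalIntegrable (fun x => ψ j * ∑' l : ℤ, G j (x + l)) volume 0 1 :=
    fun j _ => (hp j).1.const_mul _
  rw [key]
  constructor
  · exact ii_sum _ hi
  · rw [intervalIntegral.integral_finsetSum hi, ← kloos_eq, Finset.sum_mul]
    refine Finset.sum_congr rfl fun j _ => ?_
    rw [intervalIntegral.integral_const_mul, (hp j).2]
    congr 1
    exact integral_add_right_eq_self (gk m α n y k) _

lemma fc_PP {α : ℝ} (hα : 0 < α) (m k : ℤ) {y : ℝ} (hy : 0 < y) {N : ℕ}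
    (hN : ∀ n, N ≤ n → y < α * ((n + 1 : ℝ) ^ 2 * y ^ 2)) :
    fc (PP m α) k y = 2 * (if α ≤ y then ∫ x in (0:ℝ)..1, ee (m * x) * ee (-(k*x)) else 0) +
      2 * ∑ n ∈ Finset.range N, kloos (n+1) (k : ZMod (n+1)) (m : ZMod (n+1)) * ∫ t, gk m α n y k t := by
  have hA : IntervalIntegrable (fun x => (2:ℂ) * ((if α ≤ y then ee (m * x) else 0) * ee (-(k*x)))) volume 0 1 := by
    refine IntervalIntegrable.const_mul ?_ _
    refine ii_of_bdd (B := 1) ?_ ?_ 0 1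
    · split_ifs
      · exact (measurable_ee.comp (by fun_prop)).mul (measurable_ee.comp (by fun_prop))
      · simp
    · intro x; split_ifs
      · rw [norm_mul, norm_ee, norm_ee, mul_one]
      · simp
  have hB : ∀ n ∈ Finset.range N, IntervalIntegrable (fun x => (∑' d : ℤ, tau m α n d x y) * ee (-(k * x))) volume 0 1 :=
    fun n _ => (tau_fourier hα n k y).1
  have hB' : IntervalIntegrable (fun x => (2:ℂ) * ∑ n ∈ Finset.range N, (∑' d : ℤ, tau m α n d x y) * ee (-(k * x))) volume 0 1 := by
    exact (ii_sum _ hB).const_mul _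
  have e : ∀ x : ℝ, FF (PP m α) x y * ee (-(k * x)) = (2:ℂ) * ((if α ≤ y then ee (m * x) else 0) * ee (-(k*x))) +
      (2:ℂ) * ∑ n ∈ Finset.range N, (∑' d : ℤ, tau m α n d x y) * ee (-(k * x)) := by
    intro x
    rw [PP_formula hα m hy hN, ← Finset.sum_mul]; ring
  rw [fc]
  simp_rw [e]
  rw [intervalIntegral.integral_add hA hB', intervalIntegral.integral_const_mul, intervalIntegral.integral_const_mul,
    intervalIntegral.integral_finsetSum hB]
  congr 1
  · congr 1
    split_ifs
    · rfl
    · simp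
  · congr 1
    exact Finset.sum_congr rfl fun n _ => (tau_fourier hα n k y).2

lemma sum_rpow_le (N : ℕ) : ∑ n ∈ Finset.range N, ((n:ℝ)+1) ^ (-(1/8) : ℝ) ≤ 2 * (N:ℝ) ^ (7/8 : ℝ) := by
  induction N with
  | zero => simp
  | succ N ih =>
    rw [Finset.sum_range_succ]
    have h1 : (0:ℝ) < N + 1 := by positivity
    have h2 := Real.geom_mean_le_arith_mean2_weighted (w₁ := 7/8) (w₂ := 1/8) (p₁ := (N:ℝ)) (p₂ := N+1)
      (by norm_num) (by norm_num) (by positivity) (by positivity) (by norm_num)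
    have h3 : (0:ℝ) < ((N:ℝ)+1) ^ (1/8:ℝ) := by positivity
    have e1 : ((N:ℝ)+1) ^ (-(1/8):ℝ) * ((N:ℝ)+1) ^ (1/8:ℝ) = 1 := by
      rw [← Real.rpow_add h1]; norm_num
    have e2 : ((N:ℝ)+1) ^ (7/8:ℝ) * ((N:ℝ)+1) ^ (1/8:ℝ) = N+1 := by
      rw [← Real.rpow_add h1]; norm_num
    push_cast
    nlinarith

lemma kloos_bound2 (m : ℤ) (hm : m ≠ 0) : ∃ C, 1 ≤ C ∧ ∀ (n : ℕ) (k : ℤ),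
    ‖kloos (n+1) (k : ZMod (n+1)) (m : ZMod (n+1))‖ ≤ C * ((n:ℝ)+1) ^ (7/8 : ℝ) := by
  obtain ⟨C, hC1, hC⟩ := divisor_bound (1/6) (by norm_num)
  have hm1 : (1:ℝ) ≤ |(m:ℝ)| := by exact_mod_cast Int.one_le_abs hm
  have hC3 : 1 ≤ C^3 := one_le_pow₀ hC1
  have hD1 : 1 ≤ 2 * |(m:ℝ)| * C^3 := by nlinarith
  refine ⟨2 * |(m:ℝ)| * C^3, hD1, fun n k => ?_⟩
  set D := 2 * |(m:ℝ)| * C^3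
  have h1 := kloos_bound (n+1) (k : ZMod (n+1)) m hm
  have h2 := hC (n+1) (Nat.succ_ne_zero n)
  push_cast at h1 h2
  have hn : (0:ℝ) < n+1 := by positivity
  apply le_of_pow_le_pow_left₀ (n := 4) (by norm_num) (by positivity)
  have e1 : (((n:ℝ)+1) ^ (7/8:ℝ))^4 = ((n:ℝ)+1)^3 * (((n:ℝ)+1) ^ (1/6:ℝ))^3 := by
    rw [← Real.rpow_natCast, ← Real.rpow_mul hn.le, ← Real.rpow_natCast (((n:ℝ)+1) ^ (1/6:ℝ)), ← Real.rpow_mul hn.le,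
      ← Real.rpow_natCast ((n:ℝ)+1) 3, ← Real.rpow_add hn]
    norm_num
  calc _ ≤ _ := h1
    _ ≤ 2 * |(m:ℝ)| * ((n:ℝ)+1)^3 * (C * ((n:ℝ)+1) ^ (1/6:ℝ))^3 := by gcongr
    _ = D * (((n:ℝ)+1)^3 * (((n:ℝ)+1) ^ (1/6:ℝ))^3) := by ring
    _ ≤ D^4 * (((n:ℝ)+1)^3 * (((n:ℝ)+1) ^ (1/6:ℝ))^3) := by
        gcongr; exact le_self_pow₀ hD1 (by norm_num)
    _ = _ := by rw [mul_pow D, e1]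

lemma N_prop {α y : ℝ} (hα : 0 < α) (hy : 0 < y) : ∀ n, ⌊(α*y)^(-(1/2):ℝ)⌋₊ ≤ n → y < α * ((n + 1 : ℝ) ^ 2 * y ^ 2) := by
  intro n hn
  have h1 : (α*y)^(-(1/2):ℝ) < n + 1 := by
    refine (Nat.lt_floor_add_one _).trans_le ?_
    exact_mod_cast Nat.succ_le_succ hn
  have hay : 0 < α * y := by positivity
  have h2 : ((α*y)^(-(1/2):ℝ))^2 = (α*y)⁻¹ := by
    rw [← Real.rpow_natCast, ← Real.rpow_mul hay.le, ← Real.rpow_neg_one]; norm_num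
  have h3 : (α*y)⁻¹ < ((n:ℝ)+1)^2 := by
    rw [← h2]; exact pow_lt_pow_left₀ h1 (by positivity) (by norm_num)
  rw [inv_lt_iff_one_lt_mul₀ hay] at h3
  nlinarith

lemma fc_PP_le {α : ℝ} (hα : 0 < α) (m : ℤ) (hm : m ≠ 0) : ∃ C, ∀ (k : ℤ) (y : ℝ), 0 < y →
    ‖fc (PP m α) k y‖ ≤ C * y ^ (1/16 : ℝ) := by
  obtain ⟨C, hC1, hC⟩ := kloos_bound2 m hm
  refine ⟨2 * α ^ (-(1/16) : ℝ) + 8 * C * α ^ (-(15/16) : ℝ), fun k y hy => ?_⟩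
  set N := ⌊(α*y)^(-(1/2):ℝ)⌋₊ with hN
  rw [fc_PP hα m k hy (N_prop hα hy), ← hN]
  have hay : 0 < α * y := by positivity
  have A : ‖(if α ≤ y then ∫ x in (0:ℝ)..1, ee (m * x) * ee (-(k*x)) else 0)‖ ≤ α ^ (-(1/16) : ℝ) * y ^ (1/16:ℝ) := by
    split_ifs with h
    · calc _ ≤ 1 * |(1:ℝ) - 0| := intervalIntegral.norm_integral_le_of_norm_le_const fun x _ => by
            rw [norm_mul, norm_ee, norm_ee, mul_one]
        _ = 1 := by norm_num
        _ = α ^ (-(1/16) : ℝ) * α ^ (1/16:ℝ) := by rw [← Real.rpow_add hα]; norm_num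
        _ ≤ _ := by gcongr
    · rw [norm_zero]; positivity
  have B : ‖∑ n ∈ Finset.range N, kloos (n+1) (k : ZMod (n+1)) (m : ZMod (n+1)) * ∫ t, gk m α n y k t‖ ≤
      4 * C * α ^ (-(15/16) : ℝ) * y ^ (1/16 : ℝ) := by
    have hNX : (N:ℝ) ≤ (α*y)^(-(1/2):ℝ) := Nat.floor_le (by positivity)
    have e2 : Real.sqrt (y/α) = y^(1/2:ℝ) * α^(-(1/2):ℝ) := by
      rw [Real.sqrt_eq_rpow, Real.div_rpow hy.le hα.le, Real.rpow_neg hα.le]; rfl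
    calc _ ≤ ∑ n ∈ Finset.range N, (C * ((n:ℝ)+1) ^ (7/8 : ℝ)) * (2 * Real.sqrt (y / α) / (n + 1)) := by
          refine norm_sum_le_of_le _ fun n _ => ?_
          rw [norm_mul]
          exact mul_le_mul (hC n k) (norm_integral_gk hα n y k) (norm_nonneg _) (by positivity)
      _ = 2 * C * Real.sqrt (y/α) * ∑ n ∈ Finset.range N, ((n:ℝ)+1) ^ (-(1/8) : ℝ) := by
          rw [Finset.mul_sum]
          refine Finset.sum_congr rfl fun n _ => ?_
          have hn : (0:ℝ) < n+1 := by positivity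
          have : ((n:ℝ)+1) ^ (-(1/8) : ℝ) = ((n:ℝ)+1) ^ (7/8 : ℝ) / (n+1) := by
            rw [show (-(1/8):ℝ) = 7/8 - 1 by norm_num, Real.rpow_sub_one hn.ne']
          rw [this]; ring
      _ ≤ 2 * C * Real.sqrt (y/α) * (2 * (N:ℝ) ^ (7/8 : ℝ)) := by
          gcongr; exact sum_rpow_le N
      _ ≤ 2 * C * Real.sqrt (y/α) * (2 * ((α*y)^(-(1/2):ℝ)) ^ (7/8 : ℝ)) := by gcongr
      _ = _ := by
          rw [← Real.rpow_mul hay.le, Real.mul_rpow hα.le hy.le, e2]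
          have e3 : y^(1/16:ℝ) = y^(1/2:ℝ) * y^(-(1/2)*(7/8):ℝ) := by rw [← Real.rpow_add hy]; norm_num
          have e4 : α^(-(15/16):ℝ) = α^(-(1/2):ℝ) * α^(-(1/2)*(7/8):ℝ) := by rw [← Real.rpow_add hα]; norm_num
          rw [e3, e4]; ring
  refine (norm_add_le _ _).trans ?_
  rw [norm_mul, norm_mul, Complex.norm_ofNat]
  linarith

lemma totient_moebius {c : ℕ} (hc : 0 < c) :
    (c.totient : ℝ) = ∑ x ∈ c.divisorsAntidiagonal, (ArithmeticFunction.moebius x.1 : ℝ) * (x.2 : ℝ) := by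
  have := (ArithmeticFunction.sum_eq_iff_sum_mul_moebius_eq (R := ℝ) (f := fun n => (n.totient : ℝ))
    (g := fun n => (n:ℝ))).1 (fun n _ => by exact_mod_cast Nat.sum_totient n) c hc
  exact this.symm

lemma sum_pairs (N : ℕ) (f : ℕ → ℕ → ℝ) (hf : ∀ d e, N < d * e → f d e = 0) :
    ∑ c ∈ Finset.Ioc 0 N, ∑ x ∈ c.divisorsAntidiagonal, f x.1 x.2 =
      ∑ d ∈ Finset.Ioc 0 N, ∑ e ∈ Finset.Ioc 0 N, f d e := by
  rw [← Finset.sum_product']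
  have h1 : ∑ x ∈ Finset.Ioc 0 N ×ˢ Finset.Ioc 0 N, f x.1 x.2 =
      ∑ x ∈ (Finset.Ioc 0 N ×ˢ Finset.Ioc 0 N) with x.1 * x.2 ≤ N, f x.1 x.2 := by
    symm
    apply Finset.sum_filter_of_ne
    intro x _ h
    by_contra h2
    exact h (hf _ _ (not_le.1 h2))
  rw [h1, ← Finset.sum_fiberwise_of_maps_to (t := Finset.Ioc 0 N) (g := fun x : ℕ × ℕ => x.1 * x.2)]
  · refine Finset.sum_congr rfl fun c hc => Finset.sum_congr ?_ fun _ _ => rfl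
    ext ⟨d, e⟩
    rw [Finset.mem_Ioc] at hc
    simp only [Finset.mem_filter, Finset.mem_product, Finset.mem_Ioc, Nat.mem_divisorsAntidiagonal]
    constructor
    · rintro ⟨rfl, h⟩
      have hd : 0 < d := Nat.pos_of_mul_pos_right hc.1
      have he : 0 < e := Nat.pos_of_mul_pos_left hc.1
      exact ⟨⟨⟨⟨hd, (Nat.le_mul_of_pos_right d he).trans hc.2⟩, he, (Nat.le_mul_of_pos_left e hd).trans hc.2⟩, hc.2⟩, rfl⟩
    · rintro ⟨_, rfl⟩
      exact ⟨rfl, hc.1.ne'⟩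
  · intro x hx
    simp only [Finset.mem_filter, Finset.mem_product, Finset.mem_Ioc] at hx ⊢
    exact ⟨Nat.mul_pos hx.1.1.1 hx.1.2.1, hx.2⟩

def W0 : ℝ := ∫ s in (0:ℝ)..1, Real.sqrt (1 - s^2)

def RR (E : ℕ) (T : ℝ) : ℝ := ∑ e ∈ Finset.Ioc 0 E, Real.sqrt (T^2 - (e:ℝ)^2)

lemma RR_int {E : ℕ} {T : ℝ} (hT : 0 < T) (hE : T ≤ E) :
    ∫ t in (0:ℝ)..E, Real.sqrt (T^2 - t^2) = W0 * T^2 := by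
  have hc : Continuous fun t : ℝ => Real.sqrt (T^2 - t^2) := by fun_prop
  rw [← intervalIntegral.integral_add_adjacent_intervals (b := T) (hc.intervalIntegrable _ _) (hc.intervalIntegrable _ _)]
  have h2 : ∫ t in T..E, Real.sqrt (T^2 - t^2) = 0 := by
    rw [intervalIntegral.integral_congr (g := fun _ => (0:ℝ))]
    · simp
    · intro t ht
      rw [Set.uIcc_of_le hE] at ht
      exact Real.sqrt_eq_zero_of_nonpos (by nlinarith [ht.1])
  have h3 : ∫ t in (0:ℝ)..T, Real.sqrt (T^2 - t^2) = W0 * T^2 := by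
    have := intervalIntegral.mul_integral_comp_mul_left (f := fun t : ℝ => Real.sqrt (T^2 - t^2)) T (a := 0) (b := 1)
    rw [mul_zero, mul_one] at this
    rw [← this, W0]
    have e : ∀ s : ℝ, Real.sqrt (T^2 - (T*s)^2) = T * Real.sqrt (1 - s^2) := by
      intro s
      rw [show T^2 - (T*s)^2 = T^2 * (1 - s^2) by ring, Real.sqrt_mul (sq_nonneg T), Real.sqrt_sq hT.le]
    simp_rw [e]
    rw [intervalIntegral.integral_const_mul]; ring
  rw [h2, h3, add_zero]

lemma RR_range (E : ℕ) (T : ℝ) : RR E T = ∑ i ∈ Finset.range E, Real.sqrt (T^2 - (((i+1:ℕ):ℝ))^2) := by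
  rw [RR]
  induction E with
  | zero => simp
  | succ E ih => rw [Finset.sum_Ioc_succ_top (Nat.zero_le E), ih, Finset.sum_range_succ]

lemma RR_est {E : ℕ} {T : ℝ} (hT : 0 < T) (hE : T ≤ E) : |RR E T - W0 * T^2| ≤ T := by
  have hanti : ∀ E' : ℕ, AntitoneOn (fun t : ℝ => Real.sqrt (T^2 - t^2)) (Set.Icc 0 (0 + (E':ℝ))) := by
    intro E' a ha b hb hab
    apply Real.sqrt_le_sqrt
    have := ha.1
    nlinarith
  have h1 := (hanti E).sum_le_integral
  have h2 := (hanti E).integral_le_sum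
  simp only [zero_add] at h1 h2
  rw [RR_int hT hE] at h1 h2
  rw [← RR_range] at h1
  have h3 : ∑ i ∈ Finset.range E, Real.sqrt (T^2 - (i:ℝ)^2) ≤ RR E T + T := by
    have : ∑ i ∈ Finset.range (E+1), Real.sqrt (T^2 - (i:ℝ)^2) = RR E T + T := by
      rw [Finset.sum_range_succ', RR_range]
      congr 1
      simp [Real.sqrt_sq hT.le]
    rw [← this, Finset.sum_range_succ]
    linarith [Real.sqrt_nonneg (T^2 - (E:ℝ)^2)]
  rw [abs_le]
  constructor <;> linarith

lemma RR_est2 {E : ℕ} {T : ℝ} (hT : 0 < T) (hE : T ≤ E) : |RR E T - W0 * T^2| ≤ (1 + |W0|) * T^(15/8:ℝ) := by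
  rcases le_or_gt 1 T with h | h
  · refine (RR_est hT hE).trans ?_
    have : T ≤ T^(15/8:ℝ) := by
      conv_lhs => rw [← Real.rpow_one T]
      exact Real.rpow_le_rpow_of_exponent_le h (by norm_num)
    nlinarith [abs_nonneg W0, Real.rpow_nonneg hT.le (15/8)]
  · have h0 : RR E T = 0 := by
      refine Finset.sum_eq_zero fun e he => Real.sqrt_eq_zero_of_nonpos ?_
      have : (1:ℝ) ≤ e := by exact_mod_cast (Finset.mem_Ioc.1 he).1
      nlinarith
    have : T^2 ≤ T^(15/8:ℝ) := by
      rw [← Real.rpow_natCast]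
      exact Real.rpow_le_rpow_of_exponent_ge hT h.le (by norm_num)
    rw [h0, zero_sub, abs_neg, abs_mul, abs_of_nonneg (sq_nonneg T)]
    nlinarith [abs_nonneg W0, Real.rpow_nonneg hT.le (15/8)]

lemma SS_eq (N : ℕ) {X : ℝ} (hX : 0 < X) (hN : X ≤ N) :
    ∑ c ∈ Finset.Ioc 0 N, (c.totient : ℝ) / c * Real.sqrt (X^2 - (c:ℝ)^2) =
      ∑ d ∈ Finset.Ioc 0 N, (ArithmeticFunction.moebius d : ℝ) * RR N (X / d) := by
  have h := sum_pairs N (fun d e => (ArithmeticFunction.moebius d : ℝ) * ((e:ℝ) / ((d * e : ℕ) : ℝ) * Real.sqrt (X^2 - ((d*e:ℕ):ℝ)^2))) (by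
    intro d e hde
    have : (N:ℝ) ≤ ((d*e:ℕ):ℝ) := by exact_mod_cast hde.le
    rw [Real.sqrt_eq_zero_of_nonpos (by nlinarith)]; ring)
  calc _ = ∑ c ∈ Finset.Ioc 0 N, ∑ x ∈ c.divisorsAntidiagonal, (fun d e : ℕ => (ArithmeticFunction.moebius d : ℝ) * ((e:ℝ) / ((d * e : ℕ) : ℝ) * Real.sqrt (X^2 - ((d*e:ℕ):ℝ)^2))) x.1 x.2 := by
        refine Finset.sum_congr rfl fun c hc => ?_
        rw [totient_moebius (Finset.mem_Ioc.1 hc).1, Finset.sum_div, Finset.sum_mul]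
        refine Finset.sum_congr rfl fun x hx => ?_
        simp only
        rw [(Nat.mem_divisorsAntidiagonal.1 hx).1]; ring
    _ = _ := by
        rw [h]
        refine Finset.sum_congr rfl fun d hd => ?_
        rw [RR, Finset.mul_sum]
        refine Finset.sum_congr rfl fun e he => ?_
        have hd0 : (0:ℝ) < d := by exact_mod_cast (Finset.mem_Ioc.1 hd).1
        have he0 : (0:ℝ) < e := by exact_mod_cast (Finset.mem_Ioc.1 he).1
        have : X^2 - ((d*e:ℕ):ℝ)^2 = (d:ℝ)^2 * ((X/d)^2 - (e:ℝ)^2) := by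
          push_cast; field_simp
        rw [this, Real.sqrt_mul (sq_nonneg _), Real.sqrt_sq hd0.le]
        push_cast; field_simp

lemma SS_est : ∃ W C : ℝ, 0 ≤ C ∧ ∀ (N : ℕ) (X : ℝ), 0 < X → X ≤ N →
    |∑ c ∈ Finset.Ioc 0 N, (c.totient : ℝ) / c * Real.sqrt (X^2 - (c:ℝ)^2) - W * X^2| ≤ C * X^(15/8:ℝ) := by
  set μ : ℕ → ℝ := fun d => (ArithmeticFunction.moebius d : ℝ)
  have hμ : ∀ d, |μ d| ≤ 1 := fun d => by
    change |(ArithmeticFunction.moebius d : ℝ)| ≤ 1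
    exact_mod_cast ArithmeticFunction.abs_moebius_le_one
  have hs1 : Summable fun d : ℕ => 1 / (d:ℝ)^(15/8:ℝ) := Real.summable_one_div_nat_rpow.2 (by norm_num)
  have hs2 : Summable fun d : ℕ => μ d * (1 / (d:ℝ)^2) := by
    refine Summable.of_norm_bounded (g := fun d : ℕ => 1 / (d:ℝ)^2) (Real.summable_one_div_nat_pow.2 (by norm_num)) fun d => ?_
    rw [Real.norm_eq_abs, abs_mul]
    have : (0:ℝ) ≤ 1 / (d:ℝ)^2 := by positivity
    rw [abs_of_nonneg this]
    exact mul_le_of_le_one_left this (hμ d)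
  refine ⟨W0 * ∑' d : ℕ, μ d * (1 / (d:ℝ)^2), (1 + |W0|) * ∑' d : ℕ, 1 / (d:ℝ)^(15/8:ℝ), ?_, fun N X hX hN => ?_⟩
  · have : 0 ≤ ∑' d : ℕ, 1 / (d:ℝ)^(15/8:ℝ) := tsum_nonneg fun d => by positivity
    positivity
  rw [SS_eq N hX hN]
  set g : ℕ → ℝ := fun d => if d ∈ Finset.Ioc 0 N then μ d * RR N (X/d) else 0
  have hg : HasSum g (∑ d ∈ Finset.Ioc 0 N, μ d * RR N (X/d)) := by
    have : HasSum g (∑ d ∈ Finset.Ioc 0 N, g d) := hasSum_sum_of_ne_finset_zero (fun d hd => if_neg hd)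
    rwa [Finset.sum_congr rfl fun d hd => if_pos hd] at this
  have hh : HasSum (fun d : ℕ => W0 * X^2 * (μ d * (1 / (d:ℝ)^2))) (W0 * X^2 * ∑' d : ℕ, μ d * (1 / (d:ℝ)^2)) :=
    hs2.hasSum.mul_left _
  have hd := hg.sub hh
  have hb : ∀ d, ‖g d - W0 * X^2 * (μ d * (1 / (d:ℝ)^2))‖ ≤ ((1 + |W0|) * X^(15/8:ℝ)) * (1 / (d:ℝ)^(15/8:ℝ)) := by
    intro d
    rcases Nat.eq_zero_or_pos d with rfl | hd0
    · simp [g, μ]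
    have hd' : (0:ℝ) < d := by exact_mod_cast hd0
    have e1 : ((1 + |W0|) * X^(15/8:ℝ)) * (1 / (d:ℝ)^(15/8:ℝ)) = (1 + |W0|) * (X/d)^(15/8:ℝ) := by
      rw [Real.div_rpow hX.le hd'.le]; ring
    have hXd : 0 < X / d := by positivity
    rw [e1, Real.norm_eq_abs]
    simp only [g]
    split_ifs with h
    · have : μ d * RR N (X/d) - W0 * X^2 * (μ d * (1 / (d:ℝ)^2)) = μ d * (RR N (X/d) - W0 * (X/d)^2) := by
        field_simp
      rw [this, abs_mul]
      refine (mul_le_of_le_one_left (abs_nonneg _) (hμ d)).trans (RR_est2 hXd ?_)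
      refine (div_le_self hX.le ?_).trans hN
      exact_mod_cast hd0
    · have hdN : N < d := by
        by_contra h2
        exact h (Finset.mem_Ioc.2 ⟨hd0, not_lt.1 h2⟩)
      have h1 : X / d ≤ 1 := by
        rw [div_le_one hd']
        exact hN.trans (by exact_mod_cast hdN.le)
      have : 0 - W0 * X^2 * (μ d * (1 / (d:ℝ)^2)) = -(μ d * (W0 * (X/d)^2)) := by
        field_simp; ring
      rw [this, abs_neg, abs_mul, abs_mul]
      refine (mul_le_of_le_one_left (by positivity) (hμ d)).trans ?_
      rw [abs_of_nonneg (sq_nonneg (X/d))]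
      have : (X/d)^2 ≤ (X/d)^(15/8:ℝ) := by
        rw [← Real.rpow_natCast]
        exact Real.rpow_le_rpow_of_exponent_ge hXd h1 (by norm_num)
      nlinarith [abs_nonneg W0, Real.rpow_nonneg hXd.le (15/8)]
  have hfin := tsum_of_norm_bounded (hs1.hasSum.mul_left ((1 + |W0|) * X^(15/8:ℝ))) hb
  rw [hd.tsum_eq, Real.norm_eq_abs] at hfin
  calc _ = _ := by congr 1; ring
    _ ≤ _ := hfin
    _ = _ := by ring

lemma kloos_zero (n : ℕ) : kloos (n+1) (((0:ℤ)) : ZMod (n+1)) (((0:ℤ)) : ZMod (n+1)) = (((n+1).totient : ℝ) : ℂ) := by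
  rw [kloos]
  simp only [Int.cast_zero, zero_mul, add_zero, AddChar.map_zero_eq_one, Finset.sum_const, Finset.card_univ,
    ZMod.card_units_eq_totient, nsmul_eq_mul, mul_one]
  push_cast; rfl

lemma integral_gk_zero {α y : ℝ} (hα : 0 < α) (hy : 0 < y) (n : ℕ) :
    ∫ t, gk 0 α n y 0 t = ((2 * (y / (n+1) * Real.sqrt ((α*y)⁻¹ - ((n:ℝ)+1)^2)) : ℝ) : ℂ) := by
  have hn : (0:ℝ) < n+1 := by positivity
  set q : ℝ := y / (α * (n+1)^2) - y^2 with hq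
  have hs : Real.sqrt q = y / (n+1) * Real.sqrt ((α*y)⁻¹ - ((n:ℝ)+1)^2) := by
    rw [hq, show y / (α * (n+1)^2) - y^2 = (y/(n+1))^2 * ((α*y)⁻¹ - ((n:ℝ)+1)^2) by field_simp,
      Real.sqrt_mul (sq_nonneg _), Real.sqrt_sq (by positivity)]
  have e : (gk 0 α n y 0) = ({t : ℝ | t^2 ≤ q}).indicator (fun _ => (1:ℂ)) := by
    funext t
    have hiff : α * ((n + 1) ^ 2 * (t ^ 2 + y ^ 2)) ≤ y ↔ t ∈ {t : ℝ | t^2 ≤ q} := by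
      change _ ↔ t^2 ≤ q
      rw [hq, le_sub_iff_add_le, le_div_iff₀ (by positivity)]
      constructor <;> intro h <;> linarith
    rw [gk, hc]
    simp only [Int.cast_zero, zero_mul, neg_zero, ee_zero, mul_one]
    by_cases h : t ∈ {t : ℝ | t^2 ≤ q}
    · rw [Set.indicator_of_mem h, if_pos (hiff.2 h)]
    · rw [Set.indicator_of_notMem h, if_neg (fun h' => h (hiff.1 h'))]
  rw [← hs, e]
  rcases le_or_gt 0 q with h | h
  · have : {t : ℝ | t^2 ≤ q} = Set.Icc (-Real.sqrt q) (Real.sqrt q) := by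
      ext t; change t^2 ≤ q ↔ _
      rw [Set.mem_Icc, ← abs_le, ← sq_abs]
      exact (Real.le_sqrt (abs_nonneg t) h).symm
    rw [this, integral_indicator measurableSet_Icc, setIntegral_const, Measure.real, Real.volume_Icc,
      ENNReal.toReal_ofReal (by linarith [Real.sqrt_nonneg q])]
    simp only [Complex.real_smul, mul_one]
    congr 1; ring
  · have : {t : ℝ | t^2 ≤ q} = ∅ := by
      ext t; simp only [Set.mem_ofPred_eq, Set.mem_empty_iff_false, iff_false, not_le]
      nlinarith [sq_nonneg t]
    rw [this, Real.sqrt_eq_zero_of_nonpos h.le]; simp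

lemma fc_PP_zero : ∃ W : ℝ, ∀ α : ℝ, 0 < α → ∃ C : ℝ, ∀ y : ℝ, 0 < y →
    ‖(α:ℂ) * fc (PP 0 α) 0 y - (W:ℂ)‖ ≤ C * y ^ (1/16 : ℝ) := by
  obtain ⟨W, C, hC0, hC⟩ := SS_est
  refine ⟨4 * W, fun α hα => ⟨2 * α ^ (15/16:ℝ) + 4 * C * α ^ (1/16:ℝ), fun y hy => ?_⟩⟩
  have hay : 0 < α * y := by positivity
  set X := (α*y)^(-(1/2):ℝ) with hXd
  have hX : 0 < X := by positivity
  set N := ⌊X⌋₊ + 1 with hN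
  have hXN : X ≤ N := by rw [hN]; push_cast; exact (Nat.lt_floor_add_one X).le
  have hX2 : X^2 = (α*y)⁻¹ := by
    rw [hXd, ← Real.rpow_natCast, ← Real.rpow_mul hay.le, ← Real.rpow_neg_one]; norm_num
  have h1 := hC N X hX hXN
  set S := ∑ c ∈ Finset.Ioc 0 N, (c.totient : ℝ) / c * Real.sqrt (X^2 - (c:ℝ)^2) with hS
  have hS2 : S = ∑ n ∈ Finset.range N, ((n+1).totient : ℝ) / ((n+1:ℕ):ℝ) * Real.sqrt (X^2 - ((n+1:ℕ):ℝ)^2) := by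
    rw [hS]
    clear_value N
    clear hXN hS h1 hN S
    induction N with
    | zero => simp
    | succ E ih => rw [Finset.sum_Ioc_succ_top (Nat.zero_le E), ih, Finset.sum_range_succ]
  have h2 : fc (PP 0 α) 0 y = 2 * (if α ≤ y then 1 else 0) + ((4 * y * S : ℝ) : ℂ) := by
    rw [fc_PP hα 0 0 hy (N := N) (fun n hn => N_prop hα hy n ((Nat.le_succ _).trans hn))]
    congr 1
    · congr 1
      simp [ee_zero]
    · rw [hS2, Finset.mul_sum, Finset.mul_sum]
      rw [Complex.ofReal_sum]
      refine Finset.sum_congr rfl fun n _ => ?_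
      rw [kloos_zero, integral_gk_zero hα hy, hX2]
      push_cast; ring
  have e1 : (α:ℂ) * fc (PP 0 α) 0 y - ((4 * W : ℝ):ℂ) =
      2 * ((α * (if α ≤ y then 1 else 0) : ℝ) : ℂ) + ((4 * (α * y) * (S - W * X^2) : ℝ) : ℂ) := by
    rw [h2]
    have : 4 * (α * y) * (S - W * X^2) = 4 * α * y * S - 4 * W := by rw [hX2]; field_simp
    rw [this]
    split_ifs <;> (push_cast; ring)
  rw [e1]
  refine (norm_add_le _ _).trans ?_
  rw [norm_mul, Complex.norm_ofNat, Complex.norm_real, Complex.norm_real, Real.norm_eq_abs, Real.norm_eq_abs]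
  have A : |α * (if α ≤ y then 1 else 0)| ≤ α ^ (15/16:ℝ) * y ^ (1/16:ℝ) := by
    split_ifs with h
    · rw [mul_one, abs_of_pos hα]
      calc α = α ^ (15/16:ℝ) * α ^ (1/16:ℝ) := by rw [← Real.rpow_add hα]; norm_num
        _ ≤ _ := by gcongr
    · rw [mul_zero, abs_zero]; positivity
  have B : |4 * (α * y) * (S - W * X^2)| ≤ 4 * C * α ^ (1/16:ℝ) * y ^ (1/16:ℝ) := by
    rw [abs_mul, abs_of_pos (by positivity)]
    calc _ ≤ 4 * (α * y) * (C * X^(15/8:ℝ)) := by gcongr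
      _ = 4 * C * ((α*y) * (α*y)^(-(15/16):ℝ)) := by
        rw [hXd, ← Real.rpow_mul hay.le]; norm_num; ring
      _ = 4 * C * (α*y)^(1/16:ℝ) := by
        rw [mul_comm (α*y), ← Real.rpow_add_one hay.ne']; norm_num
      _ = _ := by rw [Real.mul_rpow hα.le hy.le]; ring
  linarith

section Hilb
variable {H : Type*} [NormedAddCommGroup H] [InnerProductSpace ℂ H]

lemma logconv (T : H →L[ℂ] H) (hT : ∀ f g, inner ℂ (T f) g = inner ℂ f (T g)) (v : H) :
    ‖T v‖^2 ≤ ‖v‖ * ‖T (T v)‖ := by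
  have h1 : ((‖T v‖^2 : ℝ) : ℂ) = inner ℂ v (T (T v)) := by
    rw [← hT, inner_self_eq_norm_sq_to_K]; norm_cast
  have h2 : ‖((‖T v‖^2 : ℝ) : ℂ)‖ = ‖T v‖^2 := by
    rw [Complex.norm_real, Real.norm_eq_abs, abs_of_nonneg (sq_nonneg _)]
  rw [← h2, h1]
  exact norm_inner_le_norm _ _

lemma contract_of_decay (T : H →L[ℂ] H) (hT : ∀ f g, inner ℂ (T f) g = inner ℂ f (T g)) {ρ : ℝ} (hρ : 0 < ρ)
    (v : H) {C : ℝ} (h : ∀ n : ℕ, ‖(T^n) v‖ ≤ C * ρ^n) : ‖T v‖ ≤ ρ * ‖v‖ := by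
  by_contra hlt
  rw [not_le] at hlt
  have hv : 0 < ‖v‖ := by
    rw [norm_pos_iff]; rintro rfl; simp at hlt
  set r := ‖T v‖ / ‖v‖ with hr
  have hrρ : ρ < r := by rw [hr, lt_div_iff₀ hv]; exact hlt
  have hr0 : 0 < r := hρ.trans hrρ
  have step : ∀ n : ℕ, 0 < ‖(T^n) v‖ ∧ r * ‖(T^n) v‖ ≤ ‖(T^(n+1)) v‖ := by
    intro n
    induction n with
    | zero =>
      refine ⟨by simpa using hv, ?_⟩
      simp only [pow_zero, zero_add, pow_one]
      rw [hr]; apply le_of_eq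
      change ‖T v‖ / ‖v‖ * ‖v‖ = ‖T v‖
      field_simp
    | succ n ih =>
      have h1 : 0 < ‖(T^(n+1)) v‖ := lt_of_lt_of_le (mul_pos hr0 ih.1) ih.2
      refine ⟨h1, ?_⟩
      have h2 := logconv T hT ((T^n) v)
      have e1 : T ((T^n) v) = (T^(n+1)) v := by rw [pow_succ']; rfl
      have e2 : T ((T^(n+1)) v) = (T^(n+1+1)) v := by rw [pow_succ' T (n+1)]; rfl
      rw [e1, e2] at h2
      by_contra h3
      rw [not_le] at h3
      have := mul_lt_mul_of_pos_left h3 ih.1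
      nlinarith [ih.2, ih.1]
  have hgrow : ∀ n : ℕ, r^n * ‖v‖ ≤ ‖(T^n) v‖ := by
    intro n
    induction n with
    | zero => simp
    | succ n ih =>
      refine le_trans ?_ (step n).2
      rw [pow_succ', mul_assoc]
      exact mul_le_mul_of_nonneg_left ih hr0.le
  have hb : ∀ n : ℕ, (r/ρ)^n ≤ C / ‖v‖ := by
    intro n
    rw [div_pow, div_le_iff₀ (by positivity), div_mul_eq_mul_div, le_div_iff₀ hv]
    exact (hgrow n).trans (h n)
  have ht := tendsto_pow_atTop_atTop_of_one_lt ((one_lt_div hρ).2 hrρ)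
  obtain ⟨n, hn⟩ := (ht.eventually_gt_atTop (C / ‖v‖)).exists
  exact absurd (hb n) (not_le.2 hn)

/-- vectors with decay -/
def decayV (T : H →L[ℂ] H) (ρ : ℝ) (hρ : 0 < ρ) : Submodule ℂ H where
  carrier := {v | ∃ C : ℝ, ∀ n : ℕ, ‖(T^n) v‖ ≤ C * ρ^n}
  zero_mem' := ⟨0, fun n => by simp⟩
  add_mem' := by
    rintro a b ⟨C, hC⟩ ⟨D, hD⟩
    refine ⟨C + D, fun n => ?_⟩
    rw [map_add, add_mul]
    exact (norm_add_le _ _).trans (add_le_add (hC n) (hD n))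
  smul_mem' := by
    rintro c a ⟨C, hC⟩
    refine ⟨‖c‖ * C, fun n => ?_⟩
    rw [map_smul, norm_smul, mul_assoc]
    exact mul_le_mul_of_nonneg_left (hC n) (norm_nonneg _)

lemma mem_decayV (T : H →L[ℂ] H) (ρ : ℝ) (hρ : 0 < ρ) (v : H) :
    v ∈ decayV T ρ hρ ↔ ∃ C : ℝ, ∀ n : ℕ, ‖(T^n) v‖ ≤ C * ρ^n := Iff.rfl

lemma decay_closure [CompleteSpace H] (T : H →L[ℂ] H) (hT : ∀ f g, inner ℂ (T f) g = inner ℂ f (T g)) {ρ : ℝ} (hρ : 0 < ρ)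
    {v : H} (hv : v ∈ (decayV T ρ hρ).topologicalClosure) (n : ℕ) : ‖(T^n) v‖ ≤ ρ^n * ‖v‖ := by
  have hinv : ∀ w ∈ (decayV T ρ hρ).topologicalClosure, T w ∈ (decayV T ρ hρ).topologicalClosure := by
    intro w hw
    have : Set.MapsTo T (decayV T ρ hρ : Set H) (decayV T ρ hρ : Set H) := by
      rintro w ⟨C, hC⟩
      refine ⟨C * ρ, fun n => ?_⟩
      have := hC (n+1)
      rw [pow_succ T] at this
      calc _ ≤ _ := this
        _ = _ := by ring
    exact this.closure T.continuous hw
  have hcon : ∀ w ∈ (decayV T ρ hρ).topologicalClosure, ‖T w‖ ≤ ρ * ‖w‖ := by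
    intro w hw
    have hcl : IsClosed {w : H | ‖T w‖ ≤ ρ * ‖w‖} := isClosed_le (by fun_prop) (by fun_prop)
    refine (closure_minimal ?_ hcl) hw
    rintro w ⟨C, hC⟩
    exact contract_of_decay T hT hρ w hC
  have : ∀ n : ℕ, (T^n) v ∈ (decayV T ρ hρ).topologicalClosure ∧ ‖(T^n) v‖ ≤ ρ^n * ‖v‖ := by
    intro n
    induction n with
    | zero => simpa using hv
    | succ n ih =>
      have e : (T^(n+1)) v = T ((T^n) v) := by rw [pow_succ']; rfl
      rw [e]
      refine ⟨hinv _ ih.1, (hcon _ ih.1).trans ?_⟩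
      rw [pow_succ', mul_assoc]
      exact mul_le_mul_of_nonneg_left ih.2 hρ.le
  exact (this n).2

lemma mem_decayV_of_inner (T : H →L[ℂ] H) (hT : ∀ f g, inner ℂ (T f) g = inner ℂ f (T g)) {ρ : ℝ} (hρ : 0 < ρ)
    (v : H) {C : ℝ} (h : ∀ n : ℕ, ‖inner ℂ v ((T^n) v)‖ ≤ C * ρ^n) : v ∈ decayV T ρ hρ := by
  have hsym : ∀ (n : ℕ) (f g : H), inner ℂ ((T^n) f) g = inner ℂ f ((T^n) g) := by
    intro n
    induction n with
    | zero => intro f g; rfl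
    | succ n ih =>
      intro f g
      have e : ∀ w, (T^(n+1)) w = T ((T^n) w) := fun w => by rw [pow_succ']; rfl
      have e' : ∀ w, (T^(n+1)) w = (T^n) (T w) := fun w => by rw [pow_succ]; rfl
      rw [e, hT, ih, ← e']
  have hC : 0 ≤ C := by have := (norm_nonneg _).trans (h 0); simpa using this
  refine ⟨Real.sqrt C, fun n => ?_⟩
  have h1 : ((‖(T^n) v‖^2 : ℝ) : ℂ) = inner ℂ v ((T^(n+n)) v) := by
    rw [pow_add]
    change _ = inner ℂ v ((T^n) ((T^n) v))
    rw [← hsym, inner_self_eq_norm_sq_to_K]; norm_cast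
  have h2 : ‖((‖(T^n) v‖^2 : ℝ) : ℂ)‖ = ‖(T^n) v‖^2 := by
    rw [Complex.norm_real, Real.norm_eq_abs, abs_of_nonneg (sq_nonneg _)]
  have h3 : ‖(T^n) v‖^2 ≤ (Real.sqrt C * ρ^n)^2 := by
    rw [← h2, h1, mul_pow, Real.sq_sqrt hC, ← pow_mul, mul_two]
    exact h (n+n)
  exact le_of_sq_le_sq h3 (by positivity) 
end Hilb

lemma fourier_unique {F : ℝ → ℂ} (hF : IntegrableOn F (Set.Ico 0 1))
    (h : ∀ m : ℤ, ∫ x in Set.Ico (0:ℝ) 1, ee (-(m * x)) * F x = 0) :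
    ∀ᵐ x ∂(volume.restrict (Set.Ico (0:ℝ) 1)), F x = 0 := by
  haveI : Fact ((0:ℝ) < 1) := ⟨zero_lt_one⟩
  let cmeas : ∀ φ : C(AddCircle (1:ℝ), ℂ), Continuous fun x : ℝ => φ (x : AddCircle (1:ℝ)) := fun φ =>
    φ.continuous.comp (AddCircle.continuous_mk' 1)
  have hIntg : ∀ φ : C(AddCircle (1:ℝ), ℂ), IntegrableOn (fun x : ℝ => φ (x : AddCircle (1:ℝ)) * F x) (Set.Ico 0 1) := by
    intro φ
    exact Integrable.bdd_mul (c := ‖φ‖) hF (cmeas φ).aestronglyMeasurable (ae_of_all _ fun x => φ.norm_coe_le_norm _)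
  let Λ : C(AddCircle (1:ℝ), ℂ) →L[ℂ] ℂ := LinearMap.mkContinuous
    { toFun := fun φ => ∫ x in Set.Ico (0:ℝ) 1, φ (x : AddCircle (1:ℝ)) * F x
      map_add' := fun φ ψ => by
        rw [← integral_add (hIntg φ) (hIntg ψ)]
        refine integral_congr_ae (ae_of_all _ fun x => ?_)
        simp [add_mul]
      map_smul' := fun c φ => by
        simp only [RingHom.id_apply, smul_eq_mul]
        rw [← integral_const_mul]
        refine integral_congr_ae (ae_of_all _ fun x => ?_)
        simp [mul_assoc] }
    (∫ x in Set.Ico (0:ℝ) 1, ‖F x‖) (fun φ => by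
      change ‖∫ x in Set.Ico (0:ℝ) 1, φ (x : AddCircle (1:ℝ)) * F x‖ ≤ _
      rw [mul_comm, ← integral_const_mul]
      refine norm_integral_le_of_norm_le (hF.norm.const_mul _) (ae_of_all _ fun x => ?_)
      rw [norm_mul]
      exact mul_le_mul_of_nonneg_right (φ.norm_coe_le_norm _) (norm_nonneg _))
  have hΛ : ∀ φ, Λ φ = ∫ x in Set.Ico (0:ℝ) 1, φ (x : AddCircle (1:ℝ)) * F x := fun φ => rfl
  have hz : Λ = 0 := by
    refine ContinuousLinearMap.ext_on (s := Set.range (@fourier (1:ℝ))) ?_ ?_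
    · rw [Submodule.dense_iff_topologicalClosure_eq_top]; exact span_fourier_closure_eq_top
    · rintro _ ⟨n, rfl⟩
      rw [hΛ]
      change _ = 0
      rw [← h (-n)]
      refine integral_congr_ae (ae_of_all _ fun x => ?_)
      simp only
      rw [fourier_coe_apply, ee]
      congr 2; push_cast; ring
  have hloc : LocallyIntegrableOn F (Set.Ioo 0 1) volume :=
    (hF.mono_set Set.Ioo_subset_Ico_self).locallyIntegrableOn
  have key := isOpen_Ioo.ae_eq_zero_of_integral_contDiff_smul_eq_zero hloc (fun g hg hgc hgs => by
    have hg0 : g 0 = 0 := image_eq_zero_of_notMem_tsupport fun h' => by simpa using (hgs h').1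
    have hg1 : g 1 = 0 := image_eq_zero_of_notMem_tsupport fun h' => by simpa using (hgs h').2
    let φ : C(AddCircle (1:ℝ), ℂ) := ⟨AddCircle.liftIco 1 0 (fun x => (g x : ℂ)),
      AddCircle.liftIco_zero_continuous (by simp only [hg0, hg1]) (Complex.continuous_ofReal.comp hg.continuous).continuousOn⟩
    have := congrArg (fun L : C(AddCircle (1:ℝ), ℂ) →L[ℂ] ℂ => L φ) hz
    simp only [hΛ, ContinuousLinearMap.zero_apply] at this
    rw [← this, ← setIntegral_eq_integral_of_forall_compl_eq_zero (s := Set.Ico (0:ℝ) 1)]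
    · refine setIntegral_congr_fun measurableSet_Ico fun x hx => ?_
      change g x • F x = AddCircle.liftIco 1 0 (fun x => (g x : ℂ)) (x : AddCircle (1:ℝ)) * F x
      rw [AddCircle.liftIco_zero_coe_apply hx]; rfl
    · intro x hx
      have : g x = 0 := image_eq_zero_of_notMem_tsupport fun h' => hx (Set.Ioo_subset_Ico_self (hgs h'))
      rw [this, zero_smul])
  rw [← Measure.restrict_congr_set Ioo_ae_eq_Ico]
  exact (ae_restrict_iff' measurableSet_Ioo).2 key

lemma two_dim {ν : Measure ℝ} [IsFiniteMeasure ν] {F : ℝ × ℝ → ℂ}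
    (hF : Integrable F ((volume.restrict (Set.Ico (0:ℝ) 1)).prod ν)) 
    (h0 : ∫ q, F q ∂((volume.restrict (Set.Ico (0:ℝ) 1)).prod ν) = 0)
    (h : ∀ (m : ℤ) (α : ℝ), ∫ q in Set.univ ×ˢ Set.Ici α, ee (-(m * q.1)) * F q ∂((volume.restrict (Set.Ico (0:ℝ) 1)).prod ν) = 0) :
    F =ᵐ[(volume.restrict (Set.Ico (0:ℝ) 1)).prod ν] 0 := by
  set P1 := volume.restrict (Set.Ico (0:ℝ) 1) with hP1
  have hmain : ∀ (α : ℝ) (A : Set ℝ), MeasurableSet A → ∫ q in A ×ˢ Set.Ici α, F q ∂(P1.prod ν) = 0 := by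
    intro α A hA
    have hFα : Integrable F (P1.prod (ν.restrict (Set.Ici α))) := by
      have : P1.prod (ν.restrict (Set.Ici α)) = (P1.prod ν).restrict (Set.univ ×ˢ Set.Ici α) := by
        rw [← Measure.prod_restrict, Measure.restrict_univ]
      rw [this]; exact hF.restrict
    have hu := fourier_unique (F := fun x => ∫ y in Set.Ici α, F (x, y) ∂ν) hFα.integral_prod_left (fun m => by
      rw [← h m α]
      have : (P1.prod ν).restrict (Set.univ ×ˢ Set.Ici α) = P1.prod (ν.restrict (Set.Ici α)) := by
        rw [← Measure.prod_restrict, Measure.restrict_univ]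
      rw [this, integral_prod]
      · refine integral_congr_ae (ae_of_all _ fun x => ?_)
        simp only
        rw [integral_const_mul]
      · refine Integrable.bdd_mul (c := 1) hFα ?_ (ae_of_all _ fun q => (norm_ee _).le)
        exact (measurable_ee.comp (by fun_prop)).aestronglyMeasurable)
    rw [← Measure.prod_restrict, integral_prod]
    · rw [integral_congr_ae (g := fun _ => 0)]
      · simp
      · exact ae_restrict_of_ae hu
    · rw [Measure.prod_restrict]; exact hF.restrict
  refine hF.ae_eq_zero_of_forall_setIntegral_eq_zero fun s hs _ => ?_
  have hgen : (inferInstance : MeasurableSpace (ℝ × ℝ)) = MeasurableSpace.generateFrom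
      (Set.image2 (· ×ˢ ·) {s : Set ℝ | MeasurableSet s} (Set.range Set.Ici)) := by
    symm
    refine generateFrom_eq_prod (MeasurableSpace.generateFrom_measurableSet) ?_ isCountablySpanning_measurableSet ?_
    · rw [← borel_eq_generateFrom_Ici]; exact (BorelSpace.measurable_eq).symm
    · refine ⟨fun n : ℕ => Set.Ici (-(n:ℝ)), fun n => ⟨_, rfl⟩, ?_⟩
      ext x; simp only [Set.mem_iUnion, Set.mem_Ici, Set.mem_univ, iff_true]
      obtain ⟨n, hn⟩ := exists_nat_ge (-x)
      exact ⟨n, by linarith⟩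
  have hpi : IsPiSystem (Set.image2 (· ×ˢ ·) {s : Set ℝ | MeasurableSet s} (Set.range (Set.Ici : ℝ → Set ℝ))) := by
    refine IsPiSystem.prod MeasurableSpace.isPiSystem_measurableSet ?_
    have := isPiSystem_image_Ici (Set.univ : Set ℝ)
    rwa [Set.image_univ] at this
  induction s, hs using MeasurableSpace.induction_on_inter hgen hpi with
  | empty => simp
  | basic t ht =>
    obtain ⟨A, hA, _, ⟨α, rfl⟩, rfl⟩ := ht
    exact hmain α A hA
  | compl t ht ih =>
    have := integral_add_compl ht hF
    rw [h0] at this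
    rw [ih (measure_lt_top _ _), zero_add] at this
    exact this
  | iUnion f hd hm ih =>
    have := (hasSum_integral_iUnion hm hd hF.integrableOn).tsum_eq
    rw [← this]
    simp_rw [fun i => ih i (measure_lt_top _ _)]
    simp

lemma memLp_bdd {f : XX → ℂ} (hf : Measurable f) {B : ℝ} (hB : ∀ x, ‖f x‖ ≤ B) : MemLp f 2 muX :=
  MemLp.of_bound hf.aestronglyMeasurable B (ae_of_all _ hB)

lemma inner_toLp {f : XX → ℂ} (hf : MemLp f 2 muX) (g : HX) {g' : XX → ℂ} (hg : g =ᵐ[muX] g') :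
    inner ℂ (hf.toLp : HX) g = ∫ x, (starRingEnd ℂ) (f x) * g' x ∂muX := by
  rw [L2.inner_def]
  refine integral_congr_ae ?_
  filter_upwards [hf.coeFn_toLp, hg] with x h1 h2
  rw [h1, h2]; simp [RCLike.inner_apply, mul_comm]

lemma mem_decay_of (p : ℕ) (hp : p.Prime) {ρ : ℝ} (hρ : 0 < ρ) {f : XX → ℂ} (hf : Measurable f) 
    (hL : MemLp f 2 muX) {C : ℝ}
    (h : ∀ n : ℕ, ‖∫ x, (starRingEnd ℂ) (f x) * ((TX p)^[n] f) x ∂muX‖ ≤ C * ρ ^ n) :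
    hL.toLp ∈ decayV (TL p hp) ρ hρ := by
  refine mem_decayV_of_inner (TL p hp) (TL_symm p hp) hρ _ (C := C) fun n => ?_
  obtain ⟨_, h2, e⟩ := TL_pow_toLp p hp hf hL n
  rw [e, inner_toLp hL _ h2.coeFn_toLp]
  exact h n

lemma PP_decay (p : ℕ) (hp : p.Prime) {α : ℝ} (hα : 0 < α) {m : ℤ} (hm : m ≠ 0) :
    (memLp_bdd (measurable_PP hα m) (norm_PP_le hα m)).toLp ∈ decayV (TL p hp) (rho p (1/16)) (rho_pos hp _) := by
  obtain ⟨C, hC⟩ := fc_PP_le hα m hm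
  have hC' : ∀ k ∈ (Set.univ : Set ℤ), ∀ y : ℝ, 0 < y → ‖fc (PP m α) k y‖ ≤ |C| * y ^ (1/16:ℝ) := by
    intro k _ y hy
    exact (hC k y hy).trans (mul_le_mul_of_nonneg_right (le_abs_self _) (by positivity))
  refine mem_decay_of p hp _ (measurable_PP hα m) _ (C := |C| * (α ^ ((1/16:ℝ) - 1) / (1 - 1/16))) fun n => ?_
  obtain ⟨h1, h2, h3⟩ := fc_iter_le p hp (measurable_PP hα m) (norm_PP_le hα m) (fun _ _ => Set.mem_univ _)
    (fun _ _ => Set.mem_univ _) (abs_nonneg C) hC' n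
  refine (pair_le hα (by norm_num) m h1 h2 (h3 m (Set.mem_univ _))).trans (le_of_eq (by ring))

def P0 (α β : ℝ) (x : XX) : ℂ := α * PP 0 α x - β * PP 0 β x

lemma measurable_P0 {α β : ℝ} (hα : 0 < α) (hβ : 0 < β) : Measurable (P0 α β) :=
  ((measurable_PP hα 0).const_mul _).sub ((measurable_PP hβ 0).const_mul _)

lemma norm_P0 {α β : ℝ} (hα : 0 < α) (hβ : 0 < β) (x) : ‖P0 α β x‖ ≤ α * cntB α + β * cntB β := by
  refine (norm_sub_le _ _).trans ?_
  rw [norm_mul, norm_mul, Complex.norm_real, Complex.norm_real, Real.norm_of_nonneg hα.le, Real.norm_of_nonneg hβ.le]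
  exact add_le_add (mul_le_mul_of_nonneg_left (norm_PP_le hα 0 x) hα.le) (mul_le_mul_of_nonneg_left (norm_PP_le hβ 0 x) hβ.le)

lemma fc_P0 {α β : ℝ} (hα : 0 < α) (hβ : 0 < β) (y : ℝ) :
    fc (P0 α β) 0 y = α * fc (PP 0 α) 0 y - β * fc (PP 0 β) 0 y := by
  have hi : ∀ {a : ℝ}, 0 < a → IntervalIntegrable (fun x => (a:ℂ) * (FF (PP 0 a) x y * ee (-((0:ℤ) * x)))) volume 0 1 := by
    intro a ha
    refine (ii_of_bdd (B := cntB a) ((measurable_FF (measurable_PP ha 0) y).mul (measurable_ee.comp (by fun_prop))) (fun x => ?_) 0 1).const_mul _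
    rw [Pi.mul_apply, norm_mul, Function.comp, norm_ee, mul_one]; exact norm_PP_le ha 0 _
  unfold fc
  rw [← intervalIntegral.integral_const_mul, ← intervalIntegral.integral_const_mul, ← intervalIntegral.integral_sub (hi hα) (hi hβ)]
  congr 1
  ext x
  simp only [FF, P0]; ring

lemma P0_decay (p : ℕ) (hp : p.Prime) {α β : ℝ} (hα : 0 < α) (hβ : 0 < β) :
    (memLp_bdd (measurable_P0 hα hβ) (norm_P0 hα hβ)).toLp ∈ decayV (TL p hp) (rho p (1/16)) (rho_pos hp _) := by
  obtain ⟨W, hW⟩ := fc_PP_zero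
  obtain ⟨C1, hC1⟩ := hW α hα
  obtain ⟨C2, hC2⟩ := hW β hβ
  set C := |C1| + |C2| with hCdef
  have hC' : ∀ k ∈ ({0} : Set ℤ), ∀ y : ℝ, 0 < y → ‖fc (P0 α β) k y‖ ≤ C * y ^ (1/16:ℝ) := by
    rintro k rfl y hy
    rw [fc_P0 hα hβ]
    have e : (α:ℂ) * fc (PP 0 α) 0 y - β * fc (PP 0 β) 0 y = (α * fc (PP 0 α) 0 y - W) - (β * fc (PP 0 β) 0 y - W) := by ring
    rw [e, hCdef, add_mul]
    refine (norm_sub_le _ _).trans (add_le_add ?_ ?_)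
    · exact (hC1 y hy).trans (mul_le_mul_of_nonneg_right (le_abs_self _) (by positivity))
    · exact (hC2 y hy).trans (mul_le_mul_of_nonneg_right (le_abs_self _) (by positivity))
  refine mem_decay_of p hp _ (measurable_P0 hα hβ) _ (C := α * (C * (α ^ ((1/16:ℝ) - 1) / (1 - 1/16))) + β * (C * (β ^ ((1/16:ℝ) - 1) / (1 - 1/16)))) fun n => ?_
  obtain ⟨h1, h2, h3⟩ := fc_iter_le p hp (measurable_P0 hα hβ) (norm_P0 hα hβ) (K := {0}) (by simp)
    (by intro k hk; simpa [hp.ne_zero] using hk) (by positivity) hC' n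
  have q1 := pair_le hα (by norm_num) 0 h1 h2 (h3 0 rfl)
  have q2 := pair_le hβ (by norm_num) 0 h1 h2 (h3 0 rfl)
  have hi : ∀ {a : ℝ}, 0 < a → Integrable (fun x => (a:ℂ) * ((starRingEnd ℂ) (PP 0 a x) * ((TX p)^[n] (P0 α β)) x)) muX := by
    intro a ha
    refine Integrable.const_mul (Integrable.of_bound (((Complex.continuous_conj.measurable.comp (measurable_PP ha 0)).mul h1).aestronglyMeasurable) (cntB a * (α * cntB α + β * cntB β)) (ae_of_all _ fun x => ?_)) _
    rw [Pi.mul_apply, norm_mul]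
    refine mul_le_mul ?_ (h2 x) (norm_nonneg _) (by positivity)
    rw [Function.comp, RCLike.norm_conj]; exact norm_PP_le ha 0 x
  have e : ∫ x, (starRingEnd ℂ) (P0 α β x) * ((TX p)^[n] (P0 α β)) x ∂muX =
      α * (∫ x, (starRingEnd ℂ) (PP 0 α x) * ((TX p)^[n] (P0 α β)) x ∂muX) - 
      β * (∫ x, (starRingEnd ℂ) (PP 0 β x) * ((TX p)^[n] (P0 α β)) x ∂muX) := by
    rw [← integral_const_mul, ← integral_const_mul, ← integral_sub (hi hα) (hi hβ)]
    congr 1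
    ext x
    rw [P0, map_sub, map_mul, map_mul, Complex.conj_ofReal, Complex.conj_ofReal]; ring
  rw [e]
  refine (norm_sub_le _ _).trans ?_
  rw [norm_mul, norm_mul, Complex.norm_real, Complex.norm_real, Real.norm_of_nonneg hα.le, Real.norm_of_nonneg hβ.le, add_mul]
  refine add_le_add ?_ ?_
  · exact (mul_le_mul_of_nonneg_left q1 hα.le).trans (le_of_eq (by ring))
  · exact (mul_le_mul_of_nonneg_left q2 hβ.le).trans (le_of_eq (by ring))



lemma integrableOn_box {α : ℝ} (hα : 0 < α) {f : XX → ℂ} (hf : Measurable f) (hi : Integrable f muX) :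
    IntegrableOn (fun z => f (mkX z)) (box α) := by
  have hfz : Measurable fun z => f (mkX z) := measurable_X.1 hf
  refine ⟨hfz.aestronglyMeasurable, ?_⟩
  rw [HasFiniteIntegral, ← lintegral_indicator (measurableSet_box α)]
  rw [← unfold_lintegral _ (hfz.enorm.indicator (measurableSet_box α))]
  have hle : ∀ z, phi z * ∑' γ : SL(2, ℤ), (box α).indicator (fun z => ‖f (mkX z)‖ₑ) (γ • z) ≤
      cntB α * (phi z * ‖f (mkX z)‖ₑ) := by
    intro z
    have : ∑' γ : SL(2, ℤ), (box α).indicator (fun z => ‖f (mkX z)‖ₑ) (γ • z) = cnt α z * ‖f (mkX z)‖ₑ := by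
      rw [cnt, ← ENNReal.tsum_mul_right]
      refine tsum_congr fun γ => ?_
      classical
      rw [Set.indicator_apply, Set.indicator_apply, mkX_smul]
      split_ifs <;> simp
    rw [this, mul_left_comm]
    exact mul_le_mul_left (cnt_le hα z) _
  refine (lintegral_mono hle).trans_lt ?_
  have hmm : Measurable fun z => phi z * ‖f (mkX z)‖ₑ := measurable_phi.mul hfz.enorm
  rw [lintegral_const_mul _ hmm, ← lintegral_muX _ hf.enorm]
  exact ENNReal.mul_lt_top (ENNReal.natCast_lt_top _) hi.2

lemma integral_conj_PP' {α : ℝ} (hα : 0 < α) (m : ℤ) {f : XX → ℂ} (hf : Measurable f) (hi : Integrable f muX) :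
    ∫ x, (starRingEnd ℂ) (PP m α x) * f x ∂muX = ∫ z in box α, ee (-(m * z.re)) * f (mkX z) := by
  have hfz : Measurable fun z => f (mkX z) := measurable_X.1 hf
  rw [integral_muX_unfold _ (fun z => (box α).indicator (fun z => ee (-(m * z.re)) * f (mkX z)) z)]
  · rw [integral_indicator (measurableSet_box α)]
  · exact (((measurable_ee.comp (measurable_const.mul measurable_re).neg)).mul hfz).indicator (measurableSet_box α)
  · rw [integrable_indicator_iff (measurableSet_box α)]
    refine (integrableOn_box hα hf hi).bdd_mul (c := 1) (measurable_ee.comp (measurable_const.mul measurable_re).neg).aestronglyMeasurable (ae_of_all _ fun z => ?_)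
    exact (norm_ee _).le
  · exact (Complex.continuous_conj.measurable.comp (measurable_PP hα m)).mul hf
  · intro z
    rw [PP_mk, Complex.conj_tsum, ← tsum_mul_right]
    refine tsum_congr fun γ => ?_
    classical
    rw [sfun, Set.indicator_apply, Set.indicator_apply, mkX_smul]
    split_ifs
    · rw [conj_ee]
    · simp


lemma integral_ee_zero {m : ℤ} (hm : m ≠ 0) : ∫ x in (0:ℝ)..1, ee (-(m * x)) = 0 := by
  have hc : (-(2 * Real.pi * Complex.I * m) : ℂ) ≠ 0 := by
    have : (m:ℂ) ≠ 0 := by exact_mod_cast hm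
    simp [Real.pi_ne_zero, this]
  have e : ∀ x : ℝ, ee (-(m * x)) = Complex.exp ((-(2 * Real.pi * Complex.I * m)) * x) := by
    intro x; unfold ee; congr 1; push_cast; ring
  simp_rw [e]
  rw [integral_exp_mul_complex hc]
  have h1 := e 1
  rw [mul_one] at h1
  have h2 : ee (-(m:ℝ)) = 1 := by
    have := ee_int (-m); push_cast at this; exact this
  rw [← h1, h2]; simp

lemma measurable_eere (m : ℤ) : Measurable fun z : ℍ => ee (-(m * z.re)) :=
  measurable_ee.comp (measurable_const.mul measurable_re).neg

lemma box_ee_zero {α : ℝ} (hα : 0 < α) {m : ℤ} (hm : m ≠ 0) : ∫ z in box α, ee (-(m * z.re)) = 0 := by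
  rw [setIntegral_box hα (B := 1) (measurable_eere m) (fun x => (norm_ee _).le)]
  refine (setIntegral_congr_fun measurableSet_Ici (g := fun _ => (0:ℂ)) fun y hy => ?_).trans (by simp)
  have hy0 : 0 < y := hα.trans_le hy
  have : ∀ x : ℝ, ee (-(m * (mkH (x, y)).re)) = ee (-(m * x)) := fun x => by rw [mkH_re (q := (x, y)) hy0]
  simp only [this]
  exact integral_ee_zero hm

lemma integral_prod_box {α : ℝ} (hα : 1/2 ≤ α) {f : ℍ → ℂ} (hf : Measurable f) (m : ℤ) :
    ∫ q, ee (-(m * q.1)) * f (mkH q) ∂((volume.restrict (Set.Ico (0:ℝ) 1)).prod (nuY.restrict (Set.Ici α))) =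
      ∫ z in box α, ee (-(m * z.re)) * f z := by
  have hmm : Measurable fun z : ℍ => ee (-(m * z.re)) * f z := (measurable_eere m).mul hf
  rw [restrict_box, integral_map measurable_mkH.aemeasurable hmm.aestronglyMeasurable]
  refine integral_congr_ae ?_
  have : ∀ᵐ q ∂((volume.restrict (Set.Ico (0:ℝ) 1)).prod (nuY.restrict (Set.Ici α))), 0 < q.2 := by
    rw [Measure.prod_restrict]
    exact ae_restrict_of_ae prod_pos
  filter_upwards [this] with q hq
  rw [mkH_re hq]

lemma const_of_orth (p : ℕ) (hp : p.Prime) (g : HX)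
    (hg : ∀ v ∈ decayV (TL p hp) (rho p (1/16)) (rho_pos hp _), inner ℂ v g = 0) :
    ∃ c : ℂ, (g : XX → ℂ) =ᵐ[muX] fun _ => c := by
  have hm := meas_Lp g
  have hi : Integrable g muX := (Lp.memLp g).integrable (by norm_num)
  have hgz : Measurable fun z => (g : XX → ℂ) (mkX z) := measurable_X.1 hm
  set A : ℤ → ℝ → ℂ := fun m α => ∫ z in box α, ee (-(m * z.re)) * g (mkX z) with hA
  have hA0 : ∀ m : ℤ, m ≠ 0 → ∀ α : ℝ, 0 < α → A m α = 0 := by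
    intro m hm0 α hα
    have := hg _ (PP_decay p hp hα hm0)
    rw [inner_toLp _ g (ae_eq_refl _), integral_conj_PP' hα m hm hi] at this
    exact this
  have hA1 : ∀ α β : ℝ, 0 < α → 0 < β → α * A 0 α = β * A 0 β := by
    intro α β hα hβ
    have h := hg _ (P0_decay p hp hα hβ)
    rw [inner_toLp _ g (ae_eq_refl _)] at h
    have hi' : ∀ {a : ℝ}, 0 < a → Integrable (fun x => (a:ℂ) * ((starRingEnd ℂ) (PP 0 a x) * g x)) muX := by
      intro a ha
      refine Integrable.const_mul (hi.bdd_mul (c := cntB a) (Complex.continuous_conj.measurable.comp (measurable_PP ha 0)).aestronglyMeasurable (ae_of_all _ fun x => ?_)) _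
      rw [Function.comp, RCLike.norm_conj]; exact norm_PP_le ha 0 x
    have e : ∫ x, (starRingEnd ℂ) (P0 α β x) * g x ∂muX =
        α * (∫ x, (starRingEnd ℂ) (PP 0 α x) * g x ∂muX) - 
        β * (∫ x, (starRingEnd ℂ) (PP 0 β x) * g x ∂muX) := by
      rw [← integral_const_mul, ← integral_const_mul, ← integral_sub (hi' hα) (hi' hβ)]
      congr 1
      ext x
      rw [P0, map_sub, map_mul, map_mul, Complex.conj_ofReal, Complex.conj_ofReal]; ring
    rw [e, integral_conj_PP' hα 0 hm hi, integral_conj_PP' hβ 0 hm hi] at h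
    exact sub_eq_zero.1 h
  set c : ℂ := ((1/2:ℝ):ℂ) * A 0 (1/2) with hc
  refine ⟨c, ?_⟩
  have hfin : IsFiniteMeasure (nuY.restrict (Set.Ici (1/2:ℝ))) := ⟨by
    rw [Measure.restrict_apply_univ, nuY_Ici (by norm_num)]; exact ENNReal.ofReal_lt_top⟩
  have hfb : ∀ {a : ℝ}, 0 < a → volume (box a) < ⊤ := by
    intro a ha; rw [volume_box ha]; exact ENNReal.ofReal_lt_top
  have hh : ∀ (m : ℤ) (α : ℝ), ∫ q in Set.univ ×ˢ Set.Ici α, ee (-(m * q.1)) * (g (mkX (mkH q)) - c) ∂((volume.restrict (Set.Ico (0:ℝ) 1)).prod (nuY.restrict (Set.Ici (1/2)))) = 0 := by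
    intro m α
    rw [← Measure.prod_restrict, Measure.restrict_univ, Measure.restrict_restrict measurableSet_Ici, Set.Ici_inter_Ici]
    set β := α ⊔ (1/2) with hβ
    have hβ1 : 1/2 ≤ β := le_max_right _ _
    have hβ0 : 0 < β := by linarith
    rw [integral_prod_box (f := fun z => g (mkX z) - c) hβ1 (hgz.sub_const c)]
    have i1 : IntegrableOn (fun z : ℍ => ee (-(m * z.re)) * g (mkX z)) (box β) := by
      refine (integrableOn_box hβ0 hm hi).bdd_mul (c := 1) (measurable_ee.comp (measurable_const.mul measurable_re).neg).aestronglyMeasurable (ae_of_all _ fun z => ?_)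
      exact (norm_ee _).le
    have i2 : IntegrableOn (fun z : ℍ => ee (-(m * z.re)) * c) (box β) := by
      refine Measure.integrableOn_of_bounded (M := ‖c‖) (hfb hβ0).ne
        ((measurable_eere m).mul_const c).aestronglyMeasurable (ae_of_all _ fun z => ?_)
      rw [norm_mul, norm_ee, one_mul]
    simp_rw [mul_sub]
    rw [integral_sub i1 i2, integral_mul_const]
    by_cases hm0 : m = 0
    · subst hm0
      have : (β:ℂ) ≠ 0 := by exact_mod_cast hβ0.ne'
      have h1 := hA1 β (1/2) hβ0 (by norm_num)
      have h2 : ∫ z in box β, ee (-((0:ℤ) * z.re)) = (1 / β : ℂ) := by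
        simp only [Int.cast_zero, zero_mul, neg_zero, ee_zero]
        rw [setIntegral_const, Measure.real, volume_box hβ0, ENNReal.toReal_ofReal (by positivity)]
        simp
      rw [h2]
      change A 0 β - _ = 0
      rw [hc, ← h1]; field_simp; ring
    · rw [box_ee_zero hβ0 hm0, zero_mul, sub_zero]
      exact hA0 m hm0 β hβ0
  have hF : Integrable (fun q => (g : XX → ℂ) (mkX (mkH q)) - c) ((volume.restrict (Set.Ico (0:ℝ) 1)).prod (nuY.restrict (Set.Ici (1/2)))) := by
    refine Integrable.sub ?_ (integrable_const c)
    have := integrableOn_box (α := 1/2) (by norm_num) hm hi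
    rw [IntegrableOn, restrict_box] at this
    exact (integrable_map_measure hgz.aestronglyMeasurable measurable_mkH.aemeasurable).1 this
  have h0 := two_dim hF (by
    have := hh 0 (1/2)
    rw [← Measure.prod_restrict, Measure.restrict_univ, Measure.restrict_restrict measurableSet_Ici, Set.inter_self] at this
    simpa [ee_zero] using this) hh
  -- transfer
  have h1 : ∀ᵐ z ∂(volume.restrict (box (1/2))), (g : XX → ℂ) (mkX z) = c := by
    rw [restrict_box]
    rw [ae_map_iff measurable_mkH.aemeasurable (measurableSet_eq_fun hgz measurable_const)]
    filter_upwards [h0] with q hq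
    exact sub_eq_zero.1 hq
  have h2 : ∀ᵐ z ∂nuH, (g : XX → ℂ) (mkX z) = c := by
    refine Measure.AbsolutelyContinuous.ae_le ?_ h1
    have : nuH ≤ volume.restrict (box (1/2)) := by
      rw [nuH, ← withDensity_indicator_one (measurableSet_box _)]
      exact withDensity_mono (ae_of_all _ phi_le)
    exact Measure.absolutelyContinuous_of_le this
  change ∀ᵐ x ∂muX, (g : XX → ℂ) x = c
  exact (ae_map_iff measurable_mkX.aemeasurable (measurableSet_eq_fun hm measurable_const)).2 h2

theorem mean_zero_decay (p : ℕ) (hp : p.Prime) (f : HX) (hf : ∫ x, f x ∂muX = 0) (n : ℕ) :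
    ‖(TL p hp ^ n) f‖ ≤ rho p (1/16) ^ n * ‖f‖ := by
  refine decay_closure (TL p hp) (TL_symm p hp) (rho_pos hp _) ?_ n
  rw [← Submodule.orthogonal_orthogonal_eq_closure, Submodule.mem_orthogonal]
  intro g hg
  obtain ⟨c, hc⟩ := const_of_orth p hp g (fun v hv => (Submodule.mem_orthogonal _ _).1 hg v hv)
  rw [L2.inner_def]
  have : ∫ x, inner ℂ (g x) (f x) ∂muX = ∫ x, (starRingEnd ℂ c) * f x ∂muX := by
    refine integral_congr_ae ?_
    filter_upwards [hc] with x hx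
    rw [hx]; simp [RCLike.inner_apply, mul_comm]
  rw [this, integral_const_mul, hf, mul_zero]

lemma TX_sub_const (p : ℕ) (g : XX → ℂ) (c : ℂ) :
    TX p (fun x => g x - c) = fun x => TX p g x - c := by
  ext x
  have : (p:ℂ) + 1 ≠ 0 := by exact_mod_cast Nat.succ_ne_zero p
  simp only [TX, Finset.sum_sub_distrib, Finset.sum_const, Finset.card_univ, Fintype.card_option, Fintype.card_fin, nsmul_eq_mul]
  push_cast
  field_simp

lemma TX_iter_sub_const (p : ℕ) (g : XX → ℂ) (c : ℂ) (j : ℕ) :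
    (TX p)^[j] (fun x => g x - c) = fun x => (TX p)^[j] g x - c := by
  induction j with
  | zero => rfl
  | succ j ih => rw [Function.iterate_succ_apply', ih, TX_sub_const, Function.iterate_succ_apply']

lemma sq_norm_toLp {f : XX → ℂ} (hf : MemLp f 2 muX) : ‖(hf.toLp : HX)‖ ^ 2 = ∫ x, ‖f x‖ ^ 2 ∂muX := by
  have h := inner_toLp hf hf.toLp hf.coeFn_toLp
  rw [inner_self_eq_norm_sq_to_K] at h
  have e : ∀ x, (starRingEnd ℂ) (f x) * f x = ((‖f x‖^2 : ℝ) : ℂ) := by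
    intro x; rw [mul_comm, Complex.mul_conj, Complex.normSq_eq_norm_sq]
  simp_rw [e] at h
  rw [integral_complex_ofReal] at h
  have h' : ((‖(hf.toLp : HX)‖ ^ 2 : ℝ) : ℂ) = ((∫ x, ‖f x‖ ^ 2 ∂muX : ℝ) : ℂ) := by
    rw [← h]; push_cast; rfl
  exact Complex.ofReal_injective h'

theorem miss_bound (p : ℕ) (hp : p.Prime) {S : Set XX} (hS : MeasurableSet S) (j : ℕ) :
    muX.real {x | (TX p)^[j] (S.indicator 1) x = 0} * (muX.real S)^2 ≤
      (muX.real Set.univ)^2 * (rho p (1/16)) ^ (2*j) * muX.real S := by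
  set V := muX.real Set.univ with hV
  set s := muX.real S with hs
  have hV0 : 0 ≤ V := measureReal_nonneg
  have hs0 : 0 ≤ s := measureReal_nonneg
  have hsV : s ≤ V := measureReal_mono (Set.subset_univ _)
  rcases hV0.eq_or_lt with h | hVpos
  · have : s = 0 := by linarith
    simp [this]
  set c : ℂ := ((s / V : ℝ) : ℂ) with hc
  set g : XX → ℂ := S.indicator 1 with hg
  have hgm : Measurable g := measurable_one.indicator hS
  have hg1 : ∀ x, ‖g x‖ ≤ 1 := by
    intro x; classical
    rw [hg, Set.indicator_apply]; split_ifs <;> simp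
  set f : XX → ℂ := fun x => g x - c with hf
  have hfm : Measurable f := hgm.sub_const c
  have hfb : ∀ x, ‖f x‖ ≤ 1 + ‖c‖ := fun x => (norm_sub_le _ _).trans (add_le_add (hg1 x) le_rfl)
  have hL := memLp_bdd hfm hfb
  have hgi : Integrable g muX := (memLp_bdd hgm hg1).integrable (by norm_num)
  have hgint : ∫ x, g x ∂muX = (s:ℂ) := by
    rw [hg, integral_indicator hS]
    simp only [Pi.one_apply]
    rw [setIntegral_const, ← hs]; simp
  have hcV : (V:ℂ) ≠ 0 := by exact_mod_cast hVpos.ne'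
  have h0 : ∫ x, f x ∂muX = 0 := by
    rw [hf, integral_sub hgi (integrable_const c), hgint, integral_const, hc, ← hV]
    simp only [Complex.real_smul]; push_cast; field_simp; ring
  have hnorm : ‖(hL.toLp : HX)‖^2 ≤ s := by
    rw [sq_norm_toLp]
    have e : ∀ x, ‖f x‖^2 = S.indicator (fun _ => 1 - 2 * (s/V)) x + (s/V)^2 := by
      intro x; classical
      rw [hf, hg]; simp only [hc, Set.indicator_apply]
      split_ifs
      · rw [Pi.one_apply, ← Complex.ofReal_one, ← Complex.ofReal_sub, Complex.norm_real, Real.norm_eq_abs, sq_abs]; ring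
      · rw [zero_sub, norm_neg, Complex.norm_real, Real.norm_eq_abs, sq_abs]; ring
    simp_rw [e]
    rw [integral_add ((integrable_const _).indicator hS) (integrable_const _), integral_indicator hS, setIntegral_const, integral_const, ← hV, ← hs]
    simp only [smul_eq_mul]
    have : s * (1 - 2 * (s/V)) + V * (s/V)^2 = s - s^2/V := by field_simp; ring
    rw [this]
    have : 0 ≤ s^2/V := by positivity
    linarith
  have hdec := mean_zero_decay p hp hL.toLp (by
    rw [← h0]; exact integral_congr_ae hL.coeFn_toLp) j
  obtain ⟨hm', hL', e'⟩ := TL_pow_toLp p hp hfm hL j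
  rw [e'] at hdec
  have hdec2 : ‖(hL'.toLp : HX)‖^2 ≤ rho p (1/16) ^ (2*j) * s := by
    calc ‖(hL'.toLp : HX)‖^2 ≤ (rho p (1/16) ^ j * ‖(hL.toLp : HX)‖)^2 := by gcongr
      _ = rho p (1/16) ^ (2*j) * ‖(hL.toLp : HX)‖^2 := by ring
      _ ≤ _ := mul_le_mul_of_nonneg_left hnorm (pow_nonneg (rho_pos hp _).le _)
  rw [sq_norm_toLp] at hdec2
  set E := {x | (TX p)^[j] g x = 0} with hE
  have hgjm := (TL_pow_toLp p hp hgm (memLp_bdd hgm hg1) j).1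
  have hEm : MeasurableSet E := measurableSet_eq_fun hgjm measurable_const
  have hlow : muX.real E * (s/V)^2 ≤ ∫ x, ‖(TX p)^[j] f x‖^2 ∂muX := by
    have e1 : ∫ x, E.indicator (fun _ => (s/V)^2) x ∂muX = muX.real E * (s/V)^2 := by
      rw [integral_indicator hEm, setIntegral_const, smul_eq_mul]
    rw [← e1]
    refine integral_mono ((integrable_const _).indicator hEm) hL'.norm.integrable_sq fun x => ?_
    classical
    simp only [Set.indicator_apply]
    split_ifs with hx
    · have : (TX p)^[j] f x = -c := by
        have h1 : (TX p)^[j] g x = 0 := hx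
        rw [hf, TX_iter_sub_const]
        simp only [h1, zero_sub]
      rw [this, norm_neg, hc, Complex.norm_real, Real.norm_eq_abs, sq_abs]
    · positivity
  have := hlow.trans hdec2
  calc muX.real E * s^2 = (muX.real E * (s/V)^2) * V^2 := by field_simp
    _ ≤ (rho p (1/16) ^ (2*j) * s) * V^2 := by gcongr
    _ = _ := by ring

lemma TX_ne_zero (p : ℕ) (hp : p.Prime) {S : Set XX} (j : ℕ) (z : ℍ)
    (h : (TX p)^[j] (S.indicator 1) (mkX z) ≠ 0) :
    ∃ A : Matrix (Fin 2) (Fin 2) ℤ, A.det = (p:ℤ)^j ∧ mkX (iGL A • z) ∈ S := by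
  induction j generalizing z with
  | zero =>
    refine ⟨1, by simp, ?_⟩
    have h1 := iGL_SL 1 z
    rw [Matrix.SpecialLinearGroup.coe_one, one_smul] at h1
    rw [h1]
    by_contra h2
    exact h (Set.indicator_of_notMem h2 _)
  | succ j ih =>
    rw [Function.iterate_succ_apply', TX_mk p hp] at h
    obtain ⟨i, hi⟩ : ∃ i, (TX p)^[j] (S.indicator 1) (mkX (iGL (repA p i) • z)) ≠ 0 := by
      by_contra hcon
      push Not at hcon
      exact h (by simp [hcon])
    obtain ⟨A, hA, hA2⟩ := ih _ hi
    have hp0 : (p:ℤ) ≠ 0 := by exact_mod_cast hp.ne_zero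
    refine ⟨A * repA p i, ?_, ?_⟩
    · rw [Matrix.det_mul, hA, det_repA]; ring
    · rw [iGL_mul, mul_smul]
      · exact hA2
      · rw [hA]; exact pow_ne_zero _ hp0
      · rw [det_repA]; exact hp0

lemma pairs_card (s : Finset (ℤ × ℤ)) {v : ℤ} (hv : v ≠ 0) (h : ∀ q ∈ s, q.1 * q.2 = v) :
    s.card ≤ 2 * v.natAbs.divisors.card := by
  classical
  have hinj : Set.InjOn (fun q : ℤ × ℤ => q.1) s := by
    intro q hq r hr e
    have h1 := h q hq
    have h2 := h r hr
    simp only at e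
    have h0 : q.1 ≠ 0 := by rintro h0; rw [h0, zero_mul] at h1; exact hv h1.symm
    refine Prod.ext e (mul_left_cancel₀ h0 ?_)
    rw [h1, e, h2]
  rw [← Finset.card_image_of_injOn hinj]
  have hsub : s.image (fun q => q.1) ⊆ v.natAbs.divisors.image (fun n : ℕ => (n:ℤ)) ∪ v.natAbs.divisors.image (fun n : ℕ => -(n:ℤ)) := by
    intro b hb
    obtain ⟨q, hq, rfl⟩ := Finset.mem_image.1 hb
    have hd : q.1.natAbs ∈ v.natAbs.divisors := by
      rw [Nat.mem_divisors]
      refine ⟨?_, by simpa using hv⟩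
      rw [← h q hq, Int.natAbs_mul]; exact dvd_mul_right _ _
    rw [Finset.mem_union, Finset.mem_image, Finset.mem_image]
    rcases Int.natAbs_eq q.1 with e | e
    · exact Or.inl ⟨_, hd, e.symm⟩
    · exact Or.inr ⟨_, hd, e.symm⟩
  refine (Finset.card_le_card hsub).trans ((Finset.card_union_le _ _).trans ?_)
  rw [two_mul]
  exact add_le_add Finset.card_image_le Finset.card_image_le

lemma sum_abs_le (f : ℕ → ℝ) (hf : ∀ n, 0 ≤ f n) (M : ℕ) :
    ∑ k ∈ Finset.Icc (-(M:ℤ)) M, f k.natAbs ≤ 2 * ∑ i ∈ Finset.range (M+1), f i := by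
  classical
  have hsub : Finset.Icc (-(M:ℤ)) M ⊆ (Finset.range (M+1)).image (fun n : ℕ => (n:ℤ)) ∪ (Finset.range (M+1)).image (fun n : ℕ => -(n:ℤ)) := by
    intro k hk
    rw [Finset.mem_Icc] at hk
    have hd : k.natAbs ∈ Finset.range (M+1) := by rw [Finset.mem_range]; omega
    rw [Finset.mem_union, Finset.mem_image, Finset.mem_image]
    rcases Int.natAbs_eq k with e | e
    · exact Or.inl ⟨_, hd, e.symm⟩
    · exact Or.inr ⟨_, hd, e.symm⟩
  refine (Finset.sum_le_sum_of_subset_of_nonneg hsub fun _ _ _ => hf _).trans ?_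
  have hu : ∀ s t : Finset ℤ, ∑ k ∈ s ∪ t, f k.natAbs ≤ ∑ k ∈ s, f k.natAbs + ∑ k ∈ t, f k.natAbs := by
    intro s t
    have h1 := Finset.sum_union_inter (s₁ := s) (s₂ := t) (f := fun k : ℤ => f k.natAbs)
    have h2 : 0 ≤ ∑ k ∈ s ∩ t, f k.natAbs := Finset.sum_nonneg fun _ _ => hf _
    linarith
  refine (hu _ _).trans ?_
  rw [two_mul, Finset.sum_image (by intro a _ b _ h; simpa using h), Finset.sum_image (by intro a _ b _ h; simpa using h)]
  simp

lemma sum_inv_sqrt (M : ℕ) : ∑ i ∈ Finset.range M, 1 / √(1 + (i:ℝ)) ≤ 2 * √M := by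
  induction M with
  | zero => simp
  | succ M ih =>
    rw [Finset.sum_range_succ]
    have h1 : √((M:ℝ)+1) ^ 2 = M + 1 := Real.sq_sqrt (by positivity)
    have h2 : √(M:ℝ) ^ 2 = M := Real.sq_sqrt (by positivity)
    have h3 : 0 < √((M:ℝ)+1) := Real.sqrt_pos.2 (by positivity)
    have h4 : 0 ≤ √(M:ℝ) := Real.sqrt_nonneg _
    have : 1 / √(1 + (M:ℝ)) ≤ 2 * √((M:ℝ)+1) - 2 * √M := by
      rw [add_comm 1, div_le_iff₀ h3]
      nlinarith [sq_nonneg (√((M:ℝ)+1) - √M)]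
    push_cast
    linarith

lemma sum_inv_lin (M : ℕ) : ∑ i ∈ Finset.range (M+1), 1 / (1 + (i:ℝ)) ≤ 1 + Real.log (M+1) := by
  have := harmonic_le_one_add_log (M+1)
  rw [harmonic] at this
  push_cast at this
  refine le_trans (le_of_eq ?_) this
  refine Finset.sum_congr rfl fun i _ => ?_
  rw [one_div, add_comm]


/-- entries range -/
def II (B N : ℕ) : Finset ℤ := Finset.Icc (-((B * N : ℕ) : ℤ)) ((B * N : ℕ) : ℤ)

def QQ (B N : ℕ) (q : (ℤ × ℤ) × (ℤ × ℤ)) : Prop :=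
  q.1.1 * q.1.2 - q.2.1 * q.2.2 = (N:ℤ)^2 ∧ (q.1.2 - q.1.1)^2 ≤ (B:ℤ) * (q.2.2^2 + N) ∧
    q.2.1^2 ≤ (B:ℤ) * (q.2.2^2 + N)

lemma weight_bound {B N : ℕ} (hN : 1 ≤ N) {a d b c : ℤ} (h : QQ B N ((a, d), (b, c))) :
    (N:ℝ) / (N + (c:ℝ)^2) ≤ (4 * (3 * B + 3)) * √N * ((1 / √(1 + ((a + d - 2 * N).natAbs : ℝ)) + 1 / √(1 + ((a + d + 2 * N).natAbs : ℝ))) *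
      (1 / (1 + ((d - a).natAbs : ℝ)))) := by
  obtain ⟨h1, h2, h3⟩ := h
  simp only at h1 h2 h3
  have hN' : (1:ℝ) ≤ N := by exact_mod_cast hN
  have h1' : (a:ℝ) * d - b * c = (N:ℝ)^2 := by exact_mod_cast h1
  have h2' : ((d:ℝ) - a)^2 ≤ B * (c^2 + N) := by exact_mod_cast h2
  have h3' : (b:ℝ)^2 ≤ B * (c^2 + N) := by exact_mod_cast h3
  simp only [Nat.cast_natAbs, Int.cast_abs]
  push_cast
  set e : ℝ := d - a with he
  set t : ℝ := a + d with ht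
  have hX : (0:ℝ) < c^2 + N := by positivity
  have hB0 : (0:ℝ) ≤ B := by positivity
  -- key
  have key : ∀ u : ℝ, 0 ≤ u → N * u ≤ |t^2 - 4 * N^2| → 
      (N:ℝ) / (N + (c:ℝ)^2) ≤ (4 * (3 * B + 3)) * √N * ((1 / √(1 + u)) * (1 / (1 + |e|))) := by
    intro u hu hNu
    have e1 : t^2 - 4*N^2 = e^2 + 4 * (b * c) := by rw [ht, he]; linear_combination 4 * h1'
    have e2 : |t^2 - 4 * (N:ℝ)^2| ≤ e^2 + 2 * (b^2 + c^2) := by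
      rw [e1, abs_le]; constructor <;> nlinarith [sq_nonneg ((b:ℝ) + c), sq_nonneg ((b:ℝ)-c)]
    have e3 : N + N * u + e^2 ≤ 2 * (3 * B + 3) * (c^2 + N) := by nlinarith
    set s := √(1 + u) with hs
    set r := √(N:ℝ) with hr
    have hs2 : s^2 = 1 + u := Real.sq_sqrt (by linarith)
    have hr2 : r^2 = N := Real.sq_sqrt (by linarith)
    have hs1 : 1 ≤ s := by rw [hs]; exact Real.one_le_sqrt.2 (by linarith)
    have hr1 : 1 ≤ r := by rw [hr]; exact Real.one_le_sqrt.2 hN'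
    have hrs : 1 ≤ r * s := one_le_mul_of_one_le_of_one_le hr1 hs1
    have e4 : r * s * (1 + |e|) ≤ 2 * (N + N * u + e^2) := by
      have : N + N * u = (r*s)^2 := by rw [mul_pow, hr2, hs2]; ring
      rw [this, ← sq_abs e]
      nlinarith [sq_nonneg (r * s - |e|), abs_nonneg e]
    have e5 : r * s * (1 + |e|) ≤ 4 * (3 * B + 3) * (c^2 + N) := by linarith
    have hpos : 0 < s * (1 + |e|) := by positivity
    rw [div_le_iff₀ (by linarith)]
    have : 4 * (3 * (B:ℝ) + 3) * r * (1 / s * (1 / (1 + |e|))) * (N + c^2) = r * (4 * (3 * B + 3) * (c^2 + N)) / (s * (1 + |e|)) := by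
      field_simp; ring
    rw [this, le_div_iff₀ hpos]
    have e6 := mul_le_mul_of_nonneg_left e5 (by linarith : 0 ≤ r)
    refine le_trans (le_of_eq ?_) e6
    linear_combination (-(s * (1 + |e|))) * hr2
  have hfac : t^2 - 4 * (N:ℝ)^2 = (t - 2*N) * (t + 2*N) := by ring
  have hpos1 : 0 ≤ 1 / √(1 + |t + 2 * N|) := by positivity
  have hpos2 : 0 ≤ 1 / √(1 + |t - 2 * N|) := by positivity
  have hpos3 : 0 ≤ 1 / (1 + |e|) := by positivity
  rcases le_total 0 t with h0 | h0
  · refine (key |t - 2 * N| (abs_nonneg _) ?_).trans ?_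
    · rw [hfac, abs_mul, mul_comm]
      gcongr
      rw [abs_of_nonneg (by linarith)]; linarith
    · gcongr; linarith
  · refine (key |t + 2 * N| (abs_nonneg _) ?_).trans ?_
    · rw [hfac, abs_mul]
      gcongr
      rw [abs_of_nonpos (by linarith)]; linarith
    · gcongr; linarith

lemma sum_ad (B N : ℕ) (hB : 2 ≤ B) (hN : 1 ≤ N) :
    ∑ q ∈ II B N ×ˢ II B N, ((1 / √(1 + ((q.1 + q.2 - 2 * N).natAbs : ℝ)) + 1 / √(1 + ((q.1 + q.2 + 2 * N).natAbs : ℝ))) *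
      (1 / (1 + ((q.2 - q.1).natAbs : ℝ)))) ≤ (2 * (2 * (2 * √(3 * B * N + 1)))) * (2 * (1 + Real.log (3 * B * N + 1))) := by
  classical
  set M := 3 * B * N with hM
  have hsplit : ∀ s : ℤ, (s = 2 * N ∨ s = -(2 * N)) → ∑ q ∈ II B N ×ˢ II B N, (1 / √(1 + ((q.1 + q.2 - s).natAbs : ℝ))) *
      (1 / (1 + ((q.2 - q.1).natAbs : ℝ))) ≤ (2 * (2 * √(M + 1 : ℕ))) * (2 * (1 + Real.log (M + 1))) := by
    intro s hs
    have hsb : |s| ≤ B * N := by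
      have : (2:ℤ) * N ≤ B * N := by exact_mod_cast Nat.mul_le_mul_right N hB
      rcases hs with rfl | rfl
      · rwa [abs_of_nonneg (by positivity)]
      · rwa [abs_neg, abs_of_nonneg (by positivity)]
    set φ : ℤ × ℤ → ℤ × ℤ := fun q => (q.1 + q.2 - s, q.2 - q.1) with hφ
    have hinj : Set.InjOn φ (II B N ×ˢ II B N : Finset _) := by
      intro q _ r _ h
      simp only [hφ, Prod.mk.injEq] at h
      ext <;> omega
    have e : ∑ q ∈ II B N ×ˢ II B N, (1 / √(1 + ((q.1 + q.2 - s).natAbs : ℝ))) * (1 / (1 + ((q.2 - q.1).natAbs : ℝ))) =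
        ∑ r ∈ (II B N ×ˢ II B N).image φ, (1 / √(1 + (r.1.natAbs : ℝ))) * (1 / (1 + (r.2.natAbs : ℝ))) := by
      rw [Finset.sum_image hinj]
    rw [e]
    have hsub : (II B N ×ˢ II B N).image φ ⊆ Finset.Icc (-(M:ℤ)) M ×ˢ Finset.Icc (-(M:ℤ)) M := by
      intro r hr
      obtain ⟨q, hq, rfl⟩ := Finset.mem_image.1 hr
      simp only [II, Finset.mem_product, Finset.mem_Icc, hφ, hM] at hq ⊢
      push_cast at hq ⊢
      rw [abs_le] at hsb
      have h0 : (0:ℤ) ≤ B * N := by positivity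
      rw [mul_assoc]
      refine ⟨⟨?_, ?_⟩, ?_, ?_⟩ <;> linarith [hq.1.1, hq.1.2, hq.2.1, hq.2.2, hsb.1, hsb.2]
    refine (Finset.sum_le_sum_of_subset_of_nonneg hsub fun _ _ _ => by positivity).trans ?_
    rw [Finset.sum_product]
    simp only
    rw [← Finset.sum_mul_sum]
    refine mul_le_mul ?_ ?_ (Finset.sum_nonneg fun _ _ => by positivity) (by positivity)
    · refine (sum_abs_le (fun n => 1 / √(1 + (n:ℝ))) (fun _ => by positivity) M).trans ?_
      exact mul_le_mul_of_nonneg_left (sum_inv_sqrt _) (by norm_num)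
    · refine (sum_abs_le (fun n => 1 / (1 + (n:ℝ))) (fun _ => by positivity) M).trans ?_
      exact mul_le_mul_of_nonneg_left (sum_inv_lin _) (by norm_num)
  have h1 := hsplit (2 * N) (Or.inl rfl)
  have h2 := hsplit (-(2 * N)) (Or.inr rfl)
  simp only [sub_neg_eq_add] at h2
  simp_rw [add_mul]
  rw [Finset.sum_add_distrib]
  refine (add_le_add h1 h2).trans (le_of_eq ?_)
  rw [hM]; push_cast; ring


lemma card_II (B N : ℕ) : (II B N).card = 2 * (B * N) + 1 := by
  rw [II, Int.card_Icc]; omega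

lemma abs_II {B N : ℕ} {a : ℤ} (h : a ∈ II B N) : |a| ≤ (B * N : ℕ) := by
  rw [II, Finset.mem_Icc] at h; exact abs_le.2 h

open Classical in
lemma count_main (B : ℕ) (hB : 2 ≤ B) {δ : ℝ} (hδ : 0 < δ) : ∃ C : ℝ, 0 ≤ C ∧ ∀ N : ℕ, 1 ≤ N →
    ∑ q ∈ ((II B N ×ˢ II B N) ×ˢ (II B N ×ˢ II B N)).filter (QQ B N), (N:ℝ) / (N + (q.2.2:ℝ)^2) ≤ C * (N:ℝ)^(1 + δ) := by
  set η := δ / 3 with hη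
  have hη0 : 0 < η := by positivity
  obtain ⟨C0, hC0, hdiv⟩ := divisor_bound η hη0
  have hB' : (2:ℝ) ≤ B := by exact_mod_cast hB
  set K1 : ℝ := 2 * (C0 * (2 * (B:ℝ)^2)^η) with hK1
  set K2 : ℝ := 1 + (4 * (B:ℝ))^η / η with hK2
  have hK1' : 0 ≤ K1 := by positivity
  have hK2' : 0 ≤ K2 := by positivity
  refine ⟨K1 * (4 * (3 * B + 3)) * (16 * (2 * B) * K2) + K1 * (6 * B), by positivity, fun N hN => ?_⟩
  have hN' : (1:ℝ) ≤ N := by exact_mod_cast hN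
  set X : ℝ := (N:ℝ)^η with hX
  have hX1 : 1 ≤ X := Real.one_le_rpow hN' hη0.le
  have hX3 : (N:ℝ)^(1 + δ) = N * X^3 := by
    rw [Real.rpow_add (by linarith), Real.rpow_one, hX, ← Real.rpow_natCast, ← Real.rpow_mul (by linarith)]
    congr 2; rw [hη]; push_cast; ring
  -- divisor count
  have hcount : ∀ (s : Finset (ℤ × ℤ)) (v : ℤ), v ≠ 0 → |v| ≤ 2 * B^2 * N^2 → (∀ q ∈ s, q.1 * q.2 = v) → (s.card : ℝ) ≤ K1 * X^2 := by
    intro s v hv hvb hs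
    have h1 : (s.card : ℝ) ≤ 2 * v.natAbs.divisors.card := by exact_mod_cast pairs_card s hv hs
    have h2 := hdiv v.natAbs (by simpa using hv)
    have h3 : ((v.natAbs : ℝ)) ≤ (2 * (B:ℝ)^2) * (N:ℝ)^2 := by
      rw [Nat.cast_natAbs]; exact_mod_cast hvb
    have h4 : (v.natAbs : ℝ)^η ≤ (2 * (B:ℝ)^2)^η * X^2 := by
      refine (Real.rpow_le_rpow (by positivity) h3 hη0.le).trans (le_of_eq ?_)
      rw [Real.mul_rpow (by positivity) (by positivity), hX, Real.rpow_pow_comm (by positivity)]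
    rw [hK1]
    nlinarith
  set T := ((II B N ×ˢ II B N) ×ˢ (II B N ×ˢ II B N)).filter (QQ B N) with hT
  rw [← Finset.sum_filter_add_sum_filter_not T (fun q => q.2.1 * q.2.2 = 0), hX3, add_comm, add_mul]
  refine add_le_add ?_ ?_
  · set T1 := T.filter (fun q => ¬ q.2.1 * q.2.2 = 0) with hT1
    set G : ℤ × ℤ → ℝ := fun q => ((1 / √(1 + ((q.1 + q.2 - 2 * N).natAbs : ℝ)) + 1 / √(1 + ((q.1 + q.2 + 2 * N).natAbs : ℝ))) *
      (1 / (1 + ((q.2 - q.1).natAbs : ℝ)))) with hG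
    have hG0 : ∀ q, 0 ≤ G q := fun q => by rw [hG]; positivity
    have hmem : ∀ q ∈ T1, q.1 ∈ II B N ×ˢ II B N := by
      intro q hq
      rw [hT1, hT, Finset.filter_filter, Finset.mem_filter] at hq
      exact (Finset.mem_product.1 hq.1).1
    have step1 : ∑ q ∈ T1, (N:ℝ) / (N + (q.2.2:ℝ)^2) ≤ ∑ q ∈ T1, (4 * (3 * B + 3)) * √N * G q.1 := by
      refine Finset.sum_le_sum fun q hq => ?_
      rw [hT1, hT, Finset.filter_filter, Finset.mem_filter] at hq
      exact weight_bound hN hq.2.1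
    have step2 : ∑ q ∈ T1, (4 * (3 * (B:ℝ) + 3)) * √N * G q.1 ≤ ∑ r ∈ II B N ×ˢ II B N, (K1 * X^2) * ((4 * (3 * B + 3)) * √N * G r) := by
      rw [← Finset.sum_fiberwise_of_maps_to hmem]
      refine Finset.sum_le_sum fun r hr => ?_
      have e : ∑ q ∈ T1 with q.1 = r, (4 * (3 * (B:ℝ) + 3)) * √N * G q.1 = ∑ q ∈ T1 with q.1 = r, (4 * (3 * (B:ℝ) + 3)) * √N * G r := by
        refine Finset.sum_congr rfl fun q hq => ?_
        rw [(Finset.mem_filter.1 hq).2]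
      rw [e, Finset.sum_const, nsmul_eq_mul]
      refine mul_le_mul_of_nonneg_right ?_ (mul_nonneg (by positivity) (hG0 r))
      rw [Finset.mem_product] at hr
      by_cases hv : r.1 * r.2 - (N:ℤ)^2 = 0
      · have : (T1.filter (fun q => q.1 = r)) = ∅ := by
          rw [Finset.filter_eq_empty_iff]
          intro q hq e
          rw [hT1, hT, Finset.filter_filter, Finset.mem_filter] at hq
          have h1 := hq.2.1.1
          rw [e] at h1
          exact hq.2.2 (by linarith)
        rw [this]; simp; positivity
      · have hinj : Set.InjOn (fun q : (ℤ × ℤ) × (ℤ × ℤ) => q.2) (T1.filter (fun q => q.1 = r)) := by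
          intro q hq q' hq' e
          have h1 := (Finset.mem_filter.1 (Finset.mem_coe.1 hq)).2
          have h2 := (Finset.mem_filter.1 (Finset.mem_coe.1 hq')).2
          exact Prod.ext (h1.trans h2.symm) e
        rw [← Finset.card_image_of_injOn hinj]
        refine hcount _ (r.1 * r.2 - (N:ℤ)^2) hv ?_ ?_
        · have ha := abs_II hr.1
          have hb := abs_II hr.2
          push_cast at ha hb
          have hc : |r.1 * r.2| ≤ (B * N) * (B * N) := by
            rw [abs_mul]; exact mul_le_mul ha hb (abs_nonneg _) (by positivity)
          have hd : |r.1 * r.2 - (N:ℤ)^2| ≤ |r.1 * r.2| + |(N:ℤ)^2| := abs_sub _ _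
          rw [abs_of_nonneg (by positivity : (0:ℤ) ≤ (N:ℤ)^2)] at hd
          have : (1:ℤ) ≤ (B:ℤ)^2 := by
            have : (1:ℤ) ≤ B := by omega
            nlinarith
          nlinarith [sq_nonneg (N:ℤ)]
        · intro q hq
          obtain ⟨q', hq', rfl⟩ := Finset.mem_image.1 hq
          obtain ⟨hq1, rfl⟩ := Finset.mem_filter.1 hq'
          rw [hT1, hT, Finset.filter_filter, Finset.mem_filter] at hq1
          have h1 := hq1.2.1.1
          linarith
    refine (step1.trans step2).trans ?_
    rw [← Finset.mul_sum, ← Finset.mul_sum]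
    have step3 := sum_ad B N hB hN
    have hs : √(3 * B * N + 1 : ℝ) ≤ (2 * B) * √N := by
      rw [Real.sqrt_le_left (by positivity), mul_pow, Real.sq_sqrt (by positivity)]
      have : 3 * (B:ℝ) + 1 ≤ (2 * B)^2 := by nlinarith
      nlinarith
    have hl : 1 + Real.log (3 * B * N + 1) ≤ K2 * X := by
      have h1 : Real.log (3 * B * N + 1) ≤ Real.log (4 * B * N) := by
        apply Real.log_le_log (by positivity); nlinarith
      have h2 : Real.log (4 * B * N) ≤ (4 * B * N : ℝ)^η / η := Real.log_le_rpow_div (by positivity) hη0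
      rw [Real.mul_rpow (by positivity) (by positivity)] at h2
      rw [hK2, add_mul, one_mul, div_mul_eq_mul_div]
      linarith
    have hl0 : 0 ≤ 1 + Real.log (3 * B * N + 1) := by
      have : 0 ≤ Real.log (3 * (B:ℝ) * N + 1) := Real.log_nonneg (by nlinarith)
      linarith
    have hNs : √(N:ℝ) * √N = N := Real.mul_self_sqrt (by linarith)
    calc K1 * X^2 * (4 * (3 * (B:ℝ) + 3) * √N * ∑ r ∈ II B N ×ˢ II B N, G r)
        ≤ K1 * X^2 * (4 * (3 * (B:ℝ) + 3) * √N * ((2 * (2 * (2 * ((2 * B) * √N)))) * (2 * (K2 * X)))) := by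
          gcongr
          refine step3.trans ?_
          gcongr
      _ = K1 * (4 * (3 * B + 3)) * (16 * (2 * B) * K2) * ((√N * √N) * X^3) := by ring
      _ = _ := by rw [hNs]
  · set T2 := T.filter (fun q => q.2.1 * q.2.2 = 0) with hT2
    have hw : ∑ q ∈ T2, (N:ℝ) / (N + (q.2.2:ℝ)^2) ≤ T2.card := by
      have : (T2.card : ℝ) = ∑ q ∈ T2, (1:ℝ) := by simp
      rw [this]
      refine Finset.sum_le_sum fun q _ => ?_
      rw [div_le_one (by positivity)]
      nlinarith [sq_nonneg (q.2.2:ℝ)]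
    set U := (II B N ×ˢ II B N).filter (fun r => r.1 * r.2 = (N:ℤ)^2) with hU
    have hUc : (U.card : ℝ) ≤ K1 * X^2 := by
      refine hcount U ((N:ℤ)^2) (by positivity) ?_ (fun q hq => (Finset.mem_filter.1 hq).2)
      rw [abs_of_nonneg (by positivity)]
      have : (1:ℤ) ≤ 2 * (B:ℤ)^2 := by
        have : (1:ℤ) ≤ B := by omega
        nlinarith
      nlinarith [sq_nonneg (N:ℤ)]
    have hsub : T2 ⊆ U ×ˢ (({0} ×ˢ II B N) ∪ (II B N ×ˢ {0})) := by
      intro q hq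
      rw [hT2, hT, Finset.filter_filter, Finset.mem_filter, Finset.mem_product, Finset.mem_product] at hq
      obtain ⟨⟨h1, h2⟩, h3, h4⟩ := hq
      rw [Finset.mem_product] at h2
      rw [Finset.mem_product, hU, Finset.mem_filter, Finset.mem_product]
      refine ⟨⟨h1, ?_⟩, ?_⟩
      · have := h3.1; linarith
      · rw [Finset.mem_union, Finset.mem_product, Finset.mem_product, Finset.mem_singleton, Finset.mem_singleton]
        rcases mul_eq_zero.1 h4 with h | h
        · exact Or.inl ⟨h, h2.2⟩
        · exact Or.inr ⟨h2.1, h⟩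
    have hc : (T2.card : ℝ) ≤ U.card * (6 * B * N) := by
      have h1 := Finset.card_le_card hsub
      rw [Finset.card_product] at h1
      have h2 : (({0} ×ˢ II B N) ∪ (II B N ×ˢ {0}) : Finset (ℤ × ℤ)).card ≤ 6 * B * N := by
        refine (Finset.card_union_le _ _).trans ?_
        rw [Finset.card_product, Finset.card_product, card_II, Finset.card_singleton]
        nlinarith
      exact_mod_cast h1.trans (Nat.mul_le_mul_left _ h2)
    calc _ ≤ (T2.card : ℝ) := hw
      _ ≤ U.card * (6 * B * N) := hc
      _ ≤ (K1 * X^2) * (6 * B * N) := by gcongr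
      _ ≤ (K1 * X^2) * (6 * B * N) * X := le_mul_of_one_le_right (by positivity) hX1
      _ = _ := by ring

lemma sinh_le_two_mul {t : ℝ} (h0 : 0 ≤ t) (h1 : t ≤ 1) : Real.sinh t ≤ 2 * t := by
  have h2 := Real.abs_exp_sub_one_le (x := t) (by rw [abs_of_nonneg h0]; exact h1)
  have h3 := Real.add_one_le_exp (-t)
  rw [abs_of_nonneg h0] at h2
  have h4 := (abs_le.1 h2).2
  rw [Real.sinh_eq]; linarith

lemma geo1 {A : Matrix (Fin 2) (Fin 2) ℤ} {N : ℕ} (hN : 1 ≤ N) (hA : A.det = (N:ℤ)^2) (w : ℍ) {r : ℝ}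
    (hr0 : 0 ≤ r) (hr : r^2 * N ≤ 4) (hd : dist (iGL A • w) w ≤ r) :
    ((A 1 0:ℝ) * (w.re^2 - w.im^2) + ((A 1 1:ℝ) - A 0 0) * w.re - A 0 1)^2
      + (w.im * (2 * A 1 0 * w.re + ((A 1 1:ℝ) - A 0 0)))^2 ≤ 16 * w.im^2 * N := by
  have hN' : (1:ℝ) ≤ N := by exact_mod_cast hN
  have hdet : 0 < A.det := by rw [hA]; positivity
  have hy := w.im_pos
  set D : ℂ := (A 1 0 : ℂ) * w + A 1 1 with hD
  have hw : (w : ℂ) = ⟨w.re, w.im⟩ := rfl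
  have him : (iGL A • w).im = (A.det:ℝ) * w.im / Complex.normSq D := im_iGL_smul hdet w
  have hDpos : 0 < Complex.normSq D := by
    by_contra hneg
    have : Complex.normSq D = 0 := le_antisymm (not_lt.1 hneg) (Complex.normSq_nonneg _)
    have h2 := (iGL A • w).im_pos
    rw [him, this, div_zero] at h2; exact lt_irrefl _ h2
  have hD0 : D ≠ 0 := Complex.normSq_pos.1 hDpos
  have hsub : ((iGL A • w : ℍ) : ℂ) - w =
      -((A 1 0 : ℂ) * w^2 + ((A 1 1 : ℂ) - A 0 0) * w - A 0 1) / D := by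
    rw [coe_iGL_smul hdet w]
    rw [← hD, eq_div_iff hD0, sub_mul, div_mul_cancel₀ _ hD0, hD]; ring
  set s := Real.sinh (dist (iGL A • w) w / 2) with hs
  have hs0 : 0 ≤ s := Real.sinh_nonneg_iff.2 (by positivity)
  have hr2 : r ≤ 2 := by nlinarith
  have hs1 : s ≤ r := by
    calc s ≤ Real.sinh (r / 2) := Real.sinh_le_sinh.2 (by linarith)
      _ ≤ 2 * (r/2) := sinh_le_two_mul (by linarith) (by linarith)
      _ = r := by ring
  have hsd := sinh_half_dist (iGL A • w) w
  have hpos : 0 < (iGL A • w).im * w.im := mul_pos (iGL A • w).im_pos hy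
  rw [eq_div_iff (by positivity)] at hsd
  have hsq : (dist ((iGL A • w : ℍ) : ℂ) w)^2 = s^2 * (4 * ((iGL A • w).im * w.im)) := by
    rw [← hsd, mul_pow, mul_pow, Real.sq_sqrt hpos.le]; ring
  rw [Complex.dist_eq, hsub, ← Complex.normSq_eq_norm_sq, map_div₀, Complex.normSq_neg, him, hA] at hsq
  have key : Complex.normSq ((A 1 0 : ℂ) * w^2 + ((A 1 1 : ℂ) - A 0 0) * w - A 0 1)
      = s^2 * (4 * ((N:ℝ)^2 * w.im * w.im)) := by
    rw [div_eq_iff hDpos.ne'] at hsq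
    rw [hsq]
    push_cast
    field_simp
  have hexp : Complex.normSq ((A 1 0 : ℂ) * w^2 + ((A 1 1 : ℂ) - A 0 0) * w - A 0 1) = 
    ((A 1 0:ℝ) * (w.re^2 - w.im^2) + ((A 1 1:ℝ) - A 0 0) * w.re - A 0 1)^2
      + (w.im * (2 * A 1 0 * w.re + ((A 1 1:ℝ) - A 0 0)))^2 := by
    rw [Complex.normSq_apply]
    simp [pow_two]
    ring
  rw [← hexp, key]
  have : s^2 * N ≤ 4 := by
    have : s^2 ≤ r^2 := by gcongr
    nlinarith
  have h5 : 0 ≤ 4 * (N * w.im^2) := by positivity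
  nlinarith

/-- The compact exhaustion. -/
def KK (R : ℕ) : Set ℍ := {z | |z.re| ≤ R ∧ 1 / (R:ℝ) ≤ z.im ∧ z.im ≤ R}

lemma measurableSet_KK (R : ℕ) : MeasurableSet (KK R) := by
  have h1 : Measurable fun z : ℍ => |z.re| := measurable_re.abs
  exact (measurableSet_le h1 measurable_const).inter
    ((measurableSet_le measurable_const measurable_im).inter (measurableSet_le measurable_im measurable_const))

lemma three_sq (a b c : ℝ) : (a + b + c)^2 ≤ 3 * (a^2 + b^2 + c^2) := by
  nlinarith [sq_nonneg (a - b), sq_nonneg (a - c), sq_nonneg (c - b)]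

set_option maxHeartbeats 800000 in
lemma geo2 {R : ℕ} (hR : 1 ≤ R) {N : ℕ} (hN : 1 ≤ N) {a b c d x y : ℝ} (hdet : a * d - b * c = N^2)
    (hx : |x| ≤ R) (hy1 : 1 / (R:ℝ) ≤ y) (hy2 : y ≤ R)
    (h : (c * (x^2 - y^2) + (d - a) * x - b)^2 + (y * (2 * c * x + (d - a)))^2 ≤ 16 * y^2 * N) :
    |2 * c * x + (d - a)| ≤ 4 * √N ∧ |c * (x^2 - y^2) + (d - a) * x - b| ≤ 4 * R * √N ∧
    |c| ≤ 200 * R^6 * N ∧ |a| ≤ 200 * R^6 * N ∧ |b| ≤ 200 * R^6 * N ∧ |d| ≤ 200 * R^6 * N ∧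
    (d - a)^2 ≤ 200 * R^6 * (c^2 + N) ∧ b^2 ≤ 200 * R^6 * (c^2 + N) := by
  have hR' : (1:ℝ) ≤ R := by exact_mod_cast hR
  have hN' : (1:ℝ) ≤ N := by exact_mod_cast hN
  have hy : 0 < y := lt_of_lt_of_le (by positivity) hy1
  have hRy : 1 ≤ R * y := by rw [div_le_iff₀ (by positivity)] at hy1; linarith
  set e := d - a with he
  set u := 2 * c * x + e with hu
  set q := c * (x^2 - y^2) + e * x - b with hq
  set s := √(N:ℝ) with hs
  have hss : s^2 = N := Real.sq_sqrt (by positivity)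
  have hs1 : 1 ≤ s := Real.one_le_sqrt.2 hN'
  have hu1 : |u| ≤ 4 * s := by
    apply abs_le_of_sq_le_sq _ (by positivity)
    have : y^2 * u^2 ≤ y^2 * (16 * N) := by nlinarith [sq_nonneg q]
    have := le_of_mul_le_mul_left this (by positivity)
    nlinarith
  have hq1 : |q| ≤ 4 * R * s := by
    apply abs_le_of_sq_le_sq _ (by positivity)
    have h1 : q^2 ≤ 16 * y^2 * N := by nlinarith [sq_nonneg (y * u)]
    have h2 : y^2 ≤ R^2 := by gcongr
    have h3 : 16 * y^2 * N ≤ 16 * R^2 * N := by gcongr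
    nlinarith
  have hsN : s ≤ N := by nlinarith
  obtain ⟨S, hS⟩ : ∃ S, S = (R:ℝ) * 1 := ⟨_, rfl⟩
  -- the form value
  set T := c * (x^2 + y^2) + e * x - b with hT
  have hid : q^2 + (y*u)^2 = T^2 + y^2 * (e^2 + 4 * b * c) := by rw [hq, hu, hT]; ring
  have htr : (a + d)^2 = 4 * N^2 + (e^2 + 4 * b * c) := by rw [← hdet, he]; ring
  have hT1 : |T| ≤ 5 * R * N := by
    apply abs_le_of_sq_le_sq _ (by positivity)
    have h0 : 0 ≤ y^2 * (a+d)^2 := by positivity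
    have h0' : y^2 * (a+d)^2 = 4 * N^2 * y^2 + y^2 * (e^2 + 4 * b * c) := by rw [htr]; ring
    have h1 : T^2 ≤ 16 * y^2 * N + 4 * N^2 * y^2 := by linarith
    have h4 : 16 * N + 4 * N^2 ≤ 25 * (N:ℝ)^2 := by nlinarith
    have h5 : (R:ℝ)^2 * (16 * N + 4 * N^2) ≤ R^2 * (25 * (N:ℝ)^2) := by gcongr
    have h2 : y^2 ≤ R^2 := by gcongr
    have h3 : y^2 * (16 * N + 4 * N^2) ≤ R^2 * (16 * N + 4 * N^2) := by gcongr
    linarith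
  have htr1 : |a + d| ≤ 5 * N := by
    apply abs_le_of_sq_le_sq _ (by positivity)
    have h0 := sq_nonneg T
    have h1 : y^2 * (e^2 + 4 * b * c) ≤ y^2 * (16 * N) := by linarith
    have h1 := le_of_mul_le_mul_left h1 (by positivity)
    nlinarith
  have hqN : |q| ≤ 4 * R * N := hq1.trans (by gcongr)
  have huN : |u| ≤ 4 * N := hu1.trans (by gcongr)
  have hc1 : |c| ≤ 5 * R^3 * N := by
    have h1 : 2 * (|c| * y^2) = |T - q| := by
      rw [hT, hq, show c * (x^2 + y^2) + e * x - b - (c * (x^2 - y^2) + e * x - b) = 2 * (c * y^2) by ring,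
        abs_mul, abs_mul, abs_of_pos (by norm_num : (0:ℝ) < 2), abs_of_pos (by positivity : 0 < y^2)]
    have h2 : |T - q| ≤ 9 * R * N := by
      have := abs_sub T q
      linarith
    have h3 : 1 ≤ (R * y)^2 := one_le_pow₀ hRy
    calc |c| ≤ |c| * (R * y)^2 := le_mul_of_one_le_right (abs_nonneg _) h3
      _ = R^2 * (|c| * y^2) := by ring
      _ ≤ R^2 * (9 * R * N / 2) := by gcongr; linarith
      _ ≤ _ := by nlinarith [show 0 ≤ (R:ℝ)^3 * N by positivity]
  have hcx : |2 * c * x| ≤ 2 * |c| * R := by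
    rw [abs_mul, abs_mul, abs_of_pos (by norm_num : (0:ℝ) < 2)]; gcongr
  have he1 : |e| ≤ 4 * s + 2 * |c| * R := by
    have : e = u - 2 * c * x := by rw [hu]; ring
    rw [this]
    exact (abs_sub _ _).trans (by linarith)
  have hxy : |x^2 - y^2| ≤ R^2 := by
    have : x^2 ≤ R^2 := by rw [← sq_abs]; gcongr
    have : y^2 ≤ R^2 := by gcongr
    rw [abs_le]; constructor <;> nlinarith
  have hb1 : |b| ≤ |c| * R^2 + |e| * R + 4 * R * s := by
    have : b = c * (x^2 - y^2) + e * x - q := by rw [hq]; ring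
    rw [this]
    refine (abs_sub _ _).trans (add_le_add ((abs_add_le _ _).trans (add_le_add ?_ ?_)) hq1)
    · rw [abs_mul]; gcongr
    · rw [abs_mul]; gcongr
  have hp : ∀ i : ℕ, i ≤ 6 → (R:ℝ)^i ≤ R^6 := fun i hi => pow_le_pow_right₀ hR' hi
  have p0 := hp 0 (by norm_num)
  have p1 := hp 1 (by norm_num)
  have p2 := hp 2 (by norm_num)
  have p3 := hp 3 (by norm_num)
  have p4 := hp 4 (by norm_num)
  have p5 := hp 5 (by norm_num)
  have he2 : |e| ≤ 14 * R^4 * N := by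
    have h1 : 2 * |c| * R ≤ 2 * (5 * R^3 * N) * R := by gcongr
    have h2 : (1:ℝ) ≤ R^4 := one_le_pow₀ hR'
    have h3 : 1 * (N:ℝ) ≤ R^4 * N := by gcongr
    linarith
  have hb2 : |b| ≤ 23 * R^5 * N := by
    have h1 : |c| * R^2 ≤ (5 * R^3 * N) * R^2 := by gcongr
    have h2 : |e| * R ≤ 14 * R^4 * N * R := by gcongr
    have h3 : 4 * R * s ≤ 4 * R^5 * N := by
      have : (R:ℝ) ≤ R^5 := le_self_pow₀ hR' (by norm_num)
      gcongr
    linarith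
  have hce : e^2 ≤ 32 * N + 8 * R^2 * c^2 := by
    have : e^2 ≤ (4 * s + 2 * |c| * R)^2 := by rw [← sq_abs e]; gcongr
    have h2 := sq_nonneg (4 * s - 2 * |c| * R)
    have h4 : (4 * s + 2 * |c| * R)^2 + (4 * s - 2 * |c| * R)^2 = 32 * s^2 + 8 * R^2 * |c|^2 := by ring
    rw [hss, sq_abs c] at h4
    linarith
  have hN6 : (N:ℝ) ≤ R^6 * N := le_mul_of_one_le_left (by positivity) (one_le_pow₀ hR')
  have h4N : (R:ℝ)^4 * N ≤ R^6 * N := by gcongr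
  have h5N : (R:ℝ)^5 * N ≤ R^6 * N := by gcongr
  have h3N : (R:ℝ)^3 * N ≤ R^6 * N := by gcongr
  have h2N : (R:ℝ)^2 * N ≤ R^6 * N := by gcongr
  have h2c : (R:ℝ)^2 * c^2 ≤ R^6 * c^2 := by gcongr
  have h4c : (R:ℝ)^4 * c^2 ≤ R^6 * c^2 := by gcongr
  have hc6 : 0 ≤ (R:ℝ)^6 * c^2 := by positivity
  have hexp : 200 * (R:ℝ)^6 * (c^2 + N) = 200 * (R^6 * c^2) + 200 * (R^6 * N) := by ring
  rw [hexp]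
  refine ⟨hu1, hq1, by linarith, ?_, by linarith, ?_, by linarith, ?_⟩
  · have : a = ((a + d) - e) / 2 := by rw [he]; ring
    rw [this, abs_div, abs_of_pos (by norm_num : (0:ℝ) < 2)]
    have := abs_sub (a + d) e
    linarith
  · have : d = ((a + d) + e) / 2 := by rw [he]; ring
    rw [this, abs_div, abs_of_pos (by norm_num : (0:ℝ) < 2)]
    have := abs_add_le (a + d) e
    linarith
  · have h1 : b^2 ≤ (|c| * R^2 + |e| * R + 4 * R * s)^2 := by rw [← sq_abs b]; gcongr
    have h2 : (|c| * R^2 + |e| * R + 4 * R * s)^2 ≤ 3 * ((|c| * R^2)^2 + (|e| * R)^2 + (4 * R * s)^2) := by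
      exact three_sq _ _ _
    have h3 : (|c| * R^2)^2 + (|e| * R)^2 + (4 * R * s)^2 = R^4 * c^2 + R^2 * e^2 + 16 * R^2 * N := by
      rw [mul_pow, mul_pow, sq_abs, sq_abs, mul_pow, hss]; ring
    have h4 : (R:ℝ)^2 * e^2 ≤ R^2 * (32 * N + 8 * R^2 * c^2) := by gcongr
    have h5 : (R:ℝ)^2 * (32 * N + 8 * R^2 * c^2) = 32 * (R^2 * N) + 8 * (R^4 * c^2) := by ring
    linarith

lemma vol_slice {R : ℕ} (hR : 1 ≤ R) {S : Set ℍ} (hS : MeasurableSet S) (hK : S ⊆ KK R) {X : Set ℝ}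
    (hX : MeasurableSet X) {D : ℝ} (hD : 0 ≤ D) (h1 : ∀ w ∈ S, w.re ∈ X)
    (h2 : ∀ w ∈ S, ∀ w' ∈ S, w.re = w'.re → w.im - w'.im ≤ D) :
    volume S ≤ ENNReal.ofReal (R^2) * volume X * ENNReal.ofReal D := by
  have hR' : (1:ℝ) ≤ R := by exact_mod_cast hR
  rw [volume_eq_map, Measure.map_apply measurable_mkH hS, Measure.prod_apply (measurable_mkH hS)]
  have key : ∀ x : ℝ, nuY (Prod.mk x ⁻¹' (mkH ⁻¹' S)) ≤
      X.indicator (fun _ => ENNReal.ofReal (R^2) * ENNReal.ofReal D) x := by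
    intro x
    set T := Prod.mk x ⁻¹' (mkH ⁻¹' S) with hT
    have hTm : MeasurableSet T := measurable_prodMk_left (measurable_mkH hS)
    have e1 : nuY T = ∫⁻ y in Set.Ioi (0:ℝ), ENNReal.ofReal (1 / y^2) * T.indicator 1 y := by
      rw [← lintegral_indicator_one hTm, lintegral_nuY _ (measurable_one.indicator hTm)]
    have e2 : nuY T ≤ ENNReal.ofReal (R^2) * volume (T ∩ Set.Ioi 0) := by
      rw [e1]
      calc _ ≤ ∫⁻ y in Set.Ioi (0:ℝ), ENNReal.ofReal (R^2) * T.indicator 1 y := by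
            refine setLIntegral_mono' measurableSet_Ioi fun y hy => ?_
            have hy' : (0:ℝ) < y := hy
            by_cases hyT : y ∈ T
            · gcongr
              have hw : mkH (x, y) ∈ S := hyT
              have := (hK hw).2.1
              rw [mkH_im (by exact hy')] at this
              change 1 / (R:ℝ) ≤ y at this
              rw [div_le_iff₀ (by positivity)] at this ⊢
              nlinarith
            · simp [hyT]
        _ = _ := by
            rw [lintegral_const_mul _ (measurable_one.indicator hTm), lintegral_indicator_one hTm,
              Measure.restrict_apply hTm]
    refine e2.trans ?_
    by_cases hx : x ∈ X
    · rw [Set.indicator_of_mem hx]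
      gcongr
      refine (Real.volume_le_diam _).trans ?_
      refine Metric.ediam_le fun y hy y' hy' => ?_
      rw [edist_dist]
      apply ENNReal.ofReal_le_ofReal
      have p1 : (0:ℝ) < y := hy.2
      have p2 : (0:ℝ) < y' := hy'.2
      have a1 := h2 _ hy.1 _ hy'.1 (by rw [mkH_re (by exact p1), mkH_re (by exact p2)])
      have a2 := h2 _ hy'.1 _ hy.1 (by rw [mkH_re (by exact p2), mkH_re (by exact p1)])
      rw [mkH_im (by exact p1), mkH_im (by exact p2)] at a1
      rw [mkH_im (by exact p2), mkH_im (by exact p1)] at a2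
      rw [Real.dist_eq, abs_le]
      constructor <;> simp only at a1 a2 <;> linarith
    · have : T ∩ Set.Ioi 0 = ∅ := by
        ext y
        simp only [Set.mem_inter_iff, Set.mem_empty_iff_false, iff_false]
        rintro ⟨hy, hy0⟩
        apply hx
        have := h1 _ hy
        rwa [mkH_re (by exact hy0)] at this
      rw [this]; simp
  refine (lintegral_mono key).trans ?_
  rw [lintegral_indicator_const hX]
  apply le_of_eq; ring

lemma vol_box {R : ℕ} (hR : 1 ≤ R) {N : ℕ} (hN : 1 ≤ N) (b c e : ℝ) {S : Set ℍ} (hS : MeasurableSet S)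
    (hK : S ⊆ KK R) (h1 : ∀ w ∈ S, |2 * c * w.re + e| ≤ 4 * √N)
    (h2 : ∀ w ∈ S, |c * (w.re^2 - w.im^2) + e * w.re - b| ≤ 4 * R * √N) :
    volume S ≤ ENNReal.ofReal (32 * R^4 * (N / (N + c^2))) := by
  have hR' : (1:ℝ) ≤ R := by exact_mod_cast hR
  have hN' : (1:ℝ) ≤ N := by exact_mod_cast hN
  set s := √(N:ℝ) with hs
  have hss : s^2 = N := Real.sq_sqrt (by positivity)
  have hs1 : 1 ≤ s := Real.one_le_sqrt.2 hN'
  by_cases hc : c^2 ≤ N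
  · have := vol_slice hR hS hK (X := Set.Icc (-R) R) measurableSet_Icc (D := R) (by positivity)
      (fun w hw => abs_le.1 (hK hw).1) (fun w hw w' hw' _ => by
        have := (hK hw).2.2
        have := w'.im_pos
        linarith)
    refine this.trans ?_
    rw [Real.volume_Icc, ← ENNReal.ofReal_mul (by positivity), ← ENNReal.ofReal_mul (by nlinarith)]
    apply ENNReal.ofReal_le_ofReal
    have h3 : (1:ℝ)/2 ≤ N / (N + c^2) := by
      rw [div_le_div_iff₀ (by norm_num) (by positivity)]; linarith
    have h4 : 0 ≤ (R:ℝ)^4 := by positivity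
    nlinarith
  · have hc := not_le.1 hc
    have hc0 : c ≠ 0 := by rintro rfl; norm_num at hc; linarith
    have hca : 0 < |c| := abs_pos.2 hc0
    have := vol_slice hR hS hK (X := Set.Icc (-e/(2*c) - 2 * s / |c|) (-e/(2*c) + 2 * s / |c|)) measurableSet_Icc
      (D := 4 * R^2 * s / |c|) (by positivity)
      (fun w hw => by
        have h3 := h1 w hw
        have h4 : w.re - (-e/(2*c)) = (2 * c * w.re + e) / (2 * c) := by field_simp; ring
        have h5 : |w.re - (-e/(2*c))| ≤ 2 * s / |c| := by
          rw [h4, abs_div, abs_mul, abs_of_pos (by norm_num : (0:ℝ) < 2), div_le_div_iff₀ (by positivity) hca]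
          nlinarith
        have := abs_le.1 h5
        exact ⟨by linarith, by linarith⟩) (fun w hw w' hw' hre => by
        by_cases hle : w.im ≤ w'.im
        · have : 0 ≤ 4 * R^2 * s / |c| := by positivity
          linarith
        have hle := not_le.1 hle
        have a1 := h2 w hw
        have a2 := h2 w' hw'
        rw [← hre] at a2
        have a3 : |c| * (w.im^2 - w'.im^2) ≤ 8 * R * s := by
          have : |c| * (w.im^2 - w'.im^2) = |c * (w.im^2 - w'.im^2)| := by
            rw [abs_mul, abs_of_nonneg (a := w.im^2 - w'.im^2)]
            nlinarith [w'.im_pos]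
          rw [this]
          have := abs_sub (c * (w.re^2 - w'.im^2) + e * w.re - b) (c * (w.re^2 - w.im^2) + e * w.re - b)
          have e4 : (c * (w.re^2 - w'.im^2) + e * w.re - b) - (c * (w.re^2 - w.im^2) + e * w.re - b) =
            c * (w.im^2 - w'.im^2) := by ring
          rw [e4] at this
          linarith
        have b1 := (hK hw).2.1
        have b2 := (hK hw').2.1
        rw [div_le_iff₀ (by positivity)] at b1 b2
        rw [le_div_iff₀ hca]
        have b3 : 2 ≤ (w.im + w'.im) * R := by linarith
        have b4 : 0 ≤ (w.im - w'.im) * |c| := mul_nonneg (by linarith) hca.le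
        have b5 : R * (|c| * (w.im^2 - w'.im^2)) ≤ R * (8 * R * s) := by gcongr
        have b6 : (w.im - w'.im) * |c| * 2 ≤ (w.im - w'.im) * |c| * ((w.im + w'.im) * R) := by gcongr
        have b7 : (w.im - w'.im) * |c| * ((w.im + w'.im) * R) = R * (|c| * (w.im^2 - w'.im^2)) := by ring
        linarith)
    refine this.trans ?_
    rw [Real.volume_Icc, show -e/(2*c) + 2 * s / |c| - (-e/(2*c) - 2 * s / |c|) = 4 * s / |c| by ring,
      ← ENNReal.ofReal_mul (by positivity), ← ENNReal.ofReal_mul (by positivity)]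
    apply ENNReal.ofReal_le_ofReal
    have h3 : (R:ℝ)^2 * (4 * s / |c|) * (4 * R^2 * s / |c|) = 16 * R^4 * (N / c^2) := by
      rw [← hss, ← sq_abs c]; field_simp; ring
    rw [h3]
    have h4 : (N:ℝ) / c^2 ≤ 2 * (N / (N + c^2)) := by
      rw [mul_div_assoc', div_le_div_iff₀ (by positivity) (by positivity)]
      nlinarith
    have h5 : 0 ≤ 16 * (R:ℝ)^4 := by positivity
    nlinarith

instance countable_matZ : Countable (Matrix (Fin 2) (Fin 2) ℤ) :=
  inferInstanceAs (Countable (Fin 2 → Fin 2 → ℤ))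

/-- Counts of matrices almost fixing `w`. -/
def MM (N : ℕ) (r : ℝ) (w : ℍ) : ENNReal :=
  ∑' A : Matrix (Fin 2) (Fin 2) ℤ, {w : ℍ | A.det = (N:ℤ)^2 ∧ dist (iGL A • w) w ≤ r}.indicator 1 w

lemma measurableSet_MMset (N : ℕ) (r : ℝ) (A : Matrix (Fin 2) (Fin 2) ℤ) :
    MeasurableSet {w : ℍ | A.det = (N:ℤ)^2 ∧ dist (iGL A • w) w ≤ r} := by
  by_cases h : A.det = (N:ℤ)^2
  · simp only [h, true_and]
    exact measurableSet_le ((measurable_const_smul (iGL A)).dist measurable_id) measurable_const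
  · simp [h]

lemma measurable_MM (N : ℕ) (r : ℝ) : Measurable (MM N r) := by
  unfold MM
  exact Measurable.tsum fun A => measurable_one.indicator (measurableSet_MMset N r A)

lemma MM_lintegral {R : ℕ} (hR : 1 ≤ R) {δ : ℝ} (hδ : 0 < δ) : ∃ C : ℝ, 0 ≤ C ∧ ∀ N : ℕ, 1 ≤ N → ∀ r : ℝ,
    0 ≤ r → r^2 * N ≤ 4 → ∫⁻ w in KK R, MM N r w ≤ ENNReal.ofReal (C * (N:ℝ)^(1+δ)) := by
  classical
  obtain ⟨C, hC, hcount⟩ := count_main (200 * R^6) (by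
    have : 1 ≤ R^6 := Nat.one_le_pow _ _ hR
    omega) hδ
  refine ⟨32 * R^4 * C, by positivity, fun N hN r hr0 hr => ?_⟩
  have hR' : (1:ℝ) ≤ R := by exact_mod_cast hR
  set B := 200 * R^6 with hB
  set V : Matrix (Fin 2) (Fin 2) ℤ → Set ℍ := fun A => {w : ℍ | A.det = (N:ℤ)^2 ∧ dist (iGL A • w) w ≤ r} ∩ KK R
  have hVm : ∀ A, MeasurableSet (V A) := fun A => (measurableSet_MMset N r A).inter (measurableSet_KK R)
  have e1 : ∫⁻ w in KK R, MM N r w = ∑' A, volume (V A) := by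
    unfold MM
    rw [lintegral_tsum fun A => (measurable_one.indicator (measurableSet_MMset N r A)).aemeasurable]
    refine tsum_congr fun A => ?_
    rw [lintegral_indicator_one (measurableSet_MMset N r A), Measure.restrict_apply (measurableSet_MMset N r A)]
  let E : (ℤ × ℤ) × (ℤ × ℤ) ≃ Matrix (Fin 2) (Fin 2) ℤ :=
    { toFun := fun q => !![q.1.1, q.2.1; q.2.2, q.1.2]
      invFun := fun A => ((A 0 0, A 1 1), (A 0 1, A 1 0))
      left_inv := fun q => by simp
      right_inv := fun A => by ext i j; fin_cases i <;> fin_cases j <;> rfl }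
  have hprop : ∀ q : (ℤ × ℤ) × (ℤ × ℤ), ∀ w ∈ V (E q), 
      |2 * (q.2.2:ℝ) * w.re + ((q.1.2:ℝ) - q.1.1)| ≤ 4 * √N ∧
      |(q.2.2:ℝ) * (w.re^2 - w.im^2) + ((q.1.2:ℝ) - q.1.1) * w.re - q.2.1| ≤ 4 * R * √N ∧
      q ∈ ((II B N ×ˢ II B N) ×ˢ (II B N ×ˢ II B N)).filter (QQ B N) := by
    rintro ⟨⟨a, d⟩, ⟨b, c⟩⟩ w ⟨⟨hdet, hd⟩, hw⟩
    have g1 := geo1 hN hdet w hr0 hr hd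
    have hdet' : a * d - b * c = (N:ℤ)^2 := by
      rw [← hdet, Matrix.det_fin_two]; rfl
    have hdetR : (a:ℝ) * d - b * c = (N:ℝ)^2 := by exact_mod_cast hdet'
    have g2 := geo2 hR hN hdetR hw.1 hw.2.1 hw.2.2 g1
    obtain ⟨k1, k2, k3, k4, k5, k6, k7, k8⟩ := g2
    refine ⟨k1, k2, ?_⟩
    have hmem : ∀ t : ℤ, |(t:ℝ)| ≤ 200 * R^6 * N → t ∈ II B N := by
      intro t ht
      rw [II, Finset.mem_Icc, ← abs_le]
      rw [hB]
      exact_mod_cast ht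
    rw [Finset.mem_filter, Finset.mem_product, Finset.mem_product, Finset.mem_product]
    refine ⟨⟨⟨hmem _ k4, hmem _ k6⟩, ⟨hmem _ k5, hmem _ k3⟩⟩, ?_⟩
    refine ⟨hdet', ?_, ?_⟩
    · rw [hB]; push_cast; exact_mod_cast k7
    · rw [hB]; push_cast; exact_mod_cast k8
  have e2 : ∑' A, volume (V A) = ∑' q, volume (V (E q)) := (E.tsum_eq fun A => volume (V A)).symm
  rw [e1, e2, tsum_eq_sum (s := ((II B N ×ˢ II B N) ×ˢ (II B N ×ˢ II B N)).filter (QQ B N)) (fun q hq => by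
    have : V (E q) = ∅ := by
      ext w
      simp only [Set.mem_empty_iff_false, iff_false]
      exact fun hw => hq (hprop q w hw).2.2
    rw [this, measure_empty])]
  calc _ ≤ ∑ q ∈ ((II B N ×ˢ II B N) ×ˢ (II B N ×ˢ II B N)).filter (QQ B N), 
        ENNReal.ofReal (32 * R^4 * ((N:ℝ) / (N + (q.2.2:ℝ)^2))) := by
        refine Finset.sum_le_sum fun q _ => ?_
        exact vol_box hR hN (q.2.1:ℝ) q.2.2 ((q.1.2:ℝ) - q.1.1) (hVm _) (fun w hw => hw.2)
          (fun w hw => (hprop q w hw).1) (fun w hw => (hprop q w hw).2.1)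
    _ = ENNReal.ofReal (∑ q ∈ ((II B N ×ˢ II B N) ×ˢ (II B N ×ˢ II B N)).filter (QQ B N), 
        (32 * R^4 * ((N:ℝ) / (N + (q.2.2:ℝ)^2)))) := by
        rw [ENNReal.ofReal_sum_of_nonneg]
        intro q _; positivity
    _ ≤ _ := by
        apply ENNReal.ofReal_le_ofReal
        rw [← Finset.mul_sum, mul_assoc (32 * (R:ℝ)^4)]
        exact mul_le_mul_of_nonneg_left (hcount N hN) (by positivity)

lemma iGL_dist {A : Matrix (Fin 2) (Fin 2) ℤ} (h : 0 < A.det) (z w : ℍ) :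
    dist (iGL A • z) (iGL A • w) = dist z w := by
  have hden : ∀ u : ℍ, ((A 1 0 : ℂ) * u + A 1 1) ≠ 0 := by
    intro u hu
    have := (iGL A • u).im_pos
    rw [im_iGL_smul h u, hu] at this
    simp at this
  have hd : (A.det : ℝ) = A 0 0 * A 1 1 - A 0 1 * A 1 0 := by
    rw [Matrix.det_fin_two]; push_cast; ring
  have hdpos : (0:ℝ) < A.det := by exact_mod_cast h
  have hc : Real.cosh (dist (iGL A • z) (iGL A • w)) = Real.cosh (dist z w) := by
    rw [cosh_dist, cosh_dist, im_iGL_smul h, im_iGL_smul h, Complex.dist_eq, Complex.dist_eq,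
      coe_iGL_smul h, coe_iGL_smul h]
    have h1 : ((A 0 0 : ℂ) * z + A 0 1) / (A 1 0 * z + A 1 1) - (A 0 0 * w + A 0 1) / (A 1 0 * w + A 1 1) =
      ((A.det : ℝ) : ℂ) * (z - w) / ((A 1 0 * z + A 1 1) * (A 1 0 * w + A 1 1)) := by
      rw [div_sub_div _ _ (hden z) (hden w), hd]
      congr 1; push_cast; ring
    rw [h1, ← Complex.normSq_eq_norm_sq, ← Complex.normSq_eq_norm_sq, map_div₀, map_mul, map_mul, Complex.normSq_ofReal]
    have p1 := Complex.normSq_pos.2 (hden z)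
    have p2 := Complex.normSq_pos.2 (hden w)
    have := z.im_pos
    have := w.im_pos
    generalize Complex.normSq ((A 1 0 : ℂ) * z + A 1 1) = P at p1 ⊢
    generalize Complex.normSq ((A 1 0 : ℂ) * w + A 1 1) = Q at p2 ⊢
    field_simp
  have h1 := Real.cosh_le_cosh.1 hc.le
  have h2 := Real.cosh_le_cosh.1 hc.ge
  rw [abs_of_nonneg dist_nonneg, abs_of_nonneg dist_nonneg] at h1 h2
  exact le_antisymm h1 h2

lemma SL2Z_dist (γ : SL(2, ℤ)) (z w : ℍ) : dist (γ • z) (γ • w) = dist z w := by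
  rw [← iGL_SL, ← iGL_SL, iGL_dist (by rw [γ.2]; exact one_pos)]

lemma iGL_scal {A : Matrix (Fin 2) (Fin 2) ℤ} (h : 0 < A.det) {g : ℤ} (hg : 0 < g) (z : ℍ) :
    iGL (g • A) • z = iGL A • z := by
  have h2 : 0 < (g • A).det := by
    rw [Matrix.det_smul]; positivity
  apply UpperHalfPlane.ext
  rw [coe_iGL_smul h2, coe_iGL_smul h]
  have : (g:ℂ) ≠ 0 := by exact_mod_cast hg.ne'
  simp only [Matrix.smul_apply, smul_eq_mul, Int.cast_mul]
  rw [mul_assoc, mul_assoc, ← mul_add, ← mul_add, mul_div_mul_left _ _ this]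

/-- The upper triangular representatives. -/
def AA (N : ℕ) (b : ℕ) : Matrix (Fin 2) (Fin 2) ℤ := !![1, (b:ℤ); 0, (N:ℤ)]

lemma det_AA (N b : ℕ) : (AA N b).det = N := by simp [AA, Matrix.det_fin_two]

/-- The pair count. -/
def PC (N : ℕ) (r : ℝ) (w : ℍ) : ENNReal :=
  ∑ b : Fin N, ∑ b' : Fin N, ∑' γ : SL(2, ℤ),
    {w : ℍ | dist (γ • iGL (AA N b) • w) (iGL (AA N b') • w) ≤ r}.indicator 1 w

/-- The combined matrix. -/
def CC (N : ℕ) (t : (Fin N × Fin N) × SL(2, ℤ)) : Matrix (Fin 2) (Fin 2) ℤ :=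
  (AA N t.1.2).adjugate * (t.2.1 * AA N t.1.1)

lemma CC_eq (N : ℕ) (t : (Fin N × Fin N) × SL(2, ℤ)) : CC N t =
    !![N * t.2.1 0 0 - t.1.2 * t.2.1 1 0,
       t.1.1 * (N * t.2.1 0 0 - t.1.2 * t.2.1 1 0) + N * (N * t.2.1 0 1 - t.1.2 * t.2.1 1 1);
       t.2.1 1 0, t.2.1 1 0 * t.1.1 + t.2.1 1 1 * N] := by
  rw [CC, AA, AA, Matrix.adjugate_fin_two_of]
  ext i j
  fin_cases i <;> fin_cases j <;> simp [Matrix.mul_apply, Fin.sum_univ_two] <;> ring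

lemma CC_det (N : ℕ) (t : (Fin N × Fin N) × SL(2, ℤ)) : (CC N t).det = (N:ℤ)^2 := by
  rw [CC, Matrix.det_mul, Matrix.det_mul, Matrix.det_adjugate, det_AA, det_AA, t.2.2]
  simp; ring

def gg (N : ℕ) (t : (Fin N × Fin N) × SL(2, ℤ)) : ℕ := Int.gcd (t.2.1 1 0) N

lemma gg_pos {N : ℕ} (hN : 1 ≤ N) (t) : 0 < gg N t :=
  Int.gcd_pos_of_ne_zero_right _ (by exact_mod_cast (by omega : N ≠ 0))

lemma gg_dvd (N : ℕ) (t) : gg N t ∣ N := by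
  have := Int.gcd_dvd_right (t.2.1 1 0) (N:ℤ)
  exact_mod_cast this

def CP (N : ℕ) (t : (Fin N × Fin N) × SL(2, ℤ)) : Matrix (Fin 2) (Fin 2) ℤ :=
  (CC N t).map (fun x => x / (gg N t : ℤ))

lemma CP_smul (N : ℕ) (t) : (gg N t : ℤ) • CP N t = CC N t := by
  have h1 : (gg N t : ℤ) ∣ t.2.1 1 0 := Int.gcd_dvd_left _ _
  have h2 : (gg N t : ℤ) ∣ N := Int.gcd_dvd_right _ _
  have h3 : ∀ i j, (gg N t : ℤ) ∣ CC N t i j := by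
    rw [CC_eq]
    have h4 : (gg N t : ℤ) ∣ N * t.2.1 0 0 - t.1.2 * t.2.1 1 0 :=
      dvd_sub (h2.mul_right _) (h1.mul_left _)
    intro i j
    fin_cases i <;> fin_cases j
    · exact h4
    · exact dvd_add (h4.mul_left _) (h2.mul_right _)
    · exact h1
    · exact dvd_add (h1.mul_right _) (h2.mul_left _)
  ext i j
  simp only [Matrix.smul_apply, smul_eq_mul, CP, Matrix.map_apply]
  exact Int.mul_ediv_cancel' (h3 i j)

lemma CP_det {N : ℕ} (hN : 1 ≤ N) (t) : (CP N t).det = ((N / gg N t : ℕ) : ℤ)^2 := by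
  have h1 := CC_det N t
  rw [← CP_smul, Matrix.det_smul] at h1
  have h2 : (N:ℤ) = gg N t * ((N / gg N t : ℕ) : ℤ) := by
    exact_mod_cast (Nat.mul_div_cancel' (gg_dvd N t)).symm
  have h3 : (gg N t : ℤ) ≠ 0 := by exact_mod_cast (gg_pos hN t).ne'
  rw [h2, mul_pow] at h1
  simp only [Fintype.card_fin] at h1
  exact mul_left_cancel₀ (pow_ne_zero 2 h3) h1

lemma CP_dist {N : ℕ} (hN : 1 ≤ N) (t) (w : ℍ) : dist (iGL (CP N t) • w) w =
    dist (t.2 • iGL (AA N t.1.1) • w) (iGL (AA N t.1.2) • w) := by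
  have hN' : (0:ℤ) < N := by exact_mod_cast hN
  have hq : 0 < (CP N t).det := by
    rw [CP_det hN]
    have : 0 < N / gg N t := Nat.div_pos (Nat.le_of_dvd (by omega) (gg_dvd N t)) (gg_pos hN t)
    positivity
  have hA : ∀ b, 0 < (AA N b).det := fun b => by rw [det_AA]; exact hN'
  have hadj : ∀ b, 0 < (AA N b).adjugate.det := fun b => by
    rw [Matrix.det_adjugate, det_AA]; simpa using hN'
  rw [← iGL_scal hq (g := gg N t) (by exact_mod_cast gg_pos hN t), CP_smul, CC]
  rw [iGL_mul (hadj _).ne' (by rw [Matrix.det_mul, t.2.2, one_mul]; exact (hA _).ne'),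
    iGL_mul (by rw [t.2.2]; exact one_ne_zero) (hA _).ne', mul_smul, mul_smul, iGL_SL]
  conv_lhs => rw [← iGL_adj_smul (hA t.1.2) w]
  rw [iGL_dist (hadj _), iGL_adj_smul (hA _)]

def Phi (N : ℕ) (t : (Fin N × Fin N) × SL(2, ℤ)) : (ℕ × ℕ) × Matrix (Fin 2) (Fin 2) ℤ :=
  ((gg N t, t.1.1 / (N / gg N t)), CP N t)

lemma Phi_inj {N : ℕ} (hN : 1 ≤ N) : Function.Injective (Phi N) := by
  intro t u htu
  have hN' : (N:ℤ) ≠ 0 := by exact_mod_cast (by omega : N ≠ 0)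
  have hg : gg N t = gg N u := congrArg (fun v => v.1.1) htu
  have hi : (t.1.1 : ℕ) / (N / gg N t) = u.1.1 / (N / gg N u) := congrArg (fun v => v.1.2) htu
  have hC : CP N t = CP N u := congrArg (fun v => v.2) htu
  have hCC : CC N t = CC N u := by rw [← CP_smul, ← CP_smul, hg, hC]
  have hgp := gg_pos hN t
  have hgd := gg_dvd N t
  have hgdef : gg N t = Int.gcd (t.2.1 1 0) N := rfl
  have hdt := t.2.2
  have hdu := u.2.2
  rw [Matrix.det_fin_two] at hdt hdu
  rw [CC_eq, CC_eq] at hCC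
  rw [← hg] at hi
  obtain ⟨⟨b, b'⟩, γ⟩ := t
  obtain ⟨⟨d, d'⟩, η⟩ := u
  simp only at *
  have e00 : (N:ℤ) * γ.1 0 0 - b' * γ.1 1 0 = N * η.1 0 0 - d' * η.1 1 0 := congrFun (congrFun hCC 0) 0
  have e01 : (b:ℤ) * (N * γ.1 0 0 - b' * γ.1 1 0) + N * (N * γ.1 0 1 - b' * γ.1 1 1)
    = d * (N * η.1 0 0 - d' * η.1 1 0) + N * (N * η.1 0 1 - d' * η.1 1 1) := congrFun (congrFun hCC 0) 1
  have e10 : γ.1 1 0 = η.1 1 0 := congrFun (congrFun hCC 1) 0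
  have e11 : γ.1 1 0 * b + γ.1 1 1 * N = η.1 1 0 * d + η.1 1 1 * N := congrFun (congrFun hCC 1) 1
  set g := gg N ((b, b'), γ) with hgset
  -- b = d
  have hbd : (b:ℕ) = d := by
    obtain ⟨M, hM⟩ := hgd
    have hMd : N / g = M := by rw [hM]; exact Nat.mul_div_cancel_left _ hgp
    rw [hMd] at hi
    obtain ⟨k, hk⟩ : (g:ℤ) ∣ γ.1 1 0 := by rw [hgdef]; exact Int.gcd_dvd_left _ _
    have hcop : IsCoprime k (M:ℤ) := by
      rw [Int.isCoprime_iff_gcd_eq_one]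
      have h5 := Int.gcd_div_gcd_div_gcd (i := γ.1 1 0) (j := N) (by rw [← hgdef]; exact hgp)
      rw [← hgdef] at h5
      have hg0 : (g:ℤ) ≠ 0 := by exact_mod_cast hgp.ne'
      have h6 : γ.1 1 0 / (g:ℤ) = k := by rw [hk]; exact Int.mul_ediv_cancel_left _ hg0
      have h7 : (N:ℤ) / (g:ℤ) = M := by
        have : (N:ℤ) = g * M := by exact_mod_cast hM
        rw [this]; exact Int.mul_ediv_cancel_left _ hg0
      rwa [h6, h7] at h5
    have h8 : (M:ℤ) ∣ (b:ℤ) - d := by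
      have hg0 : (g:ℤ) ≠ 0 := by exact_mod_cast hgp.ne'
      have hMZ : (N:ℤ) = g * M := by exact_mod_cast hM
      rw [← e10, hk, hMZ] at e11
      have h9 : k * ((b:ℤ) - d) = M * (η.1 1 1 - γ.1 1 1) := by
        apply mul_left_cancel₀ hg0
        linear_combination e11
      exact hcop.symm.dvd_of_dvd_mul_left ⟨_, h9⟩
    have h10 : (b:ℕ) % M = d % M := by
      have : (d:ℤ) ≡ b [ZMOD M] := Int.modEq_iff_dvd.2 h8
      exact ((Int.natCast_modEq_iff).1 this).symm
    rw [← Nat.div_add_mod (b:ℕ) M, ← Nat.div_add_mod (d:ℕ) M, hi, h10]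
  have hbdZ : (b:ℤ) = d := by exact_mod_cast hbd
  have e11' : γ.1 1 1 = η.1 1 1 := by
    rw [e10, hbdZ] at e11
    exact mul_right_cancel₀ hN' (by linarith)
  have e01' : (N:ℤ) * γ.1 0 1 - b' * γ.1 1 1 = N * η.1 0 1 - d' * η.1 1 1 := by
    rw [e00, hbdZ] at e01
    exact mul_left_cancel₀ hN' (by linarith)
  rw [← e10] at e00
  rw [← e11'] at e01'
  have hdvd : (N:ℤ) ∣ (b':ℤ) - d' := by
    refine ⟨(γ.1 0 0 - η.1 0 0) * (-γ.1 0 1) + (γ.1 0 1 - η.1 0 1) * γ.1 0 0, ?_⟩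
    linear_combination (γ.1 0 1) * e00 - (γ.1 0 0) * e01' - ((b':ℤ) - d') * hdt
  have hb' : (b':ℕ) = d' := by
    have : (d':ℤ) ≡ b' [ZMOD N] := Int.modEq_iff_dvd.2 hdvd
    have h2 := ((Int.natCast_modEq_iff).1 this).symm
    exact Nat.ModEq.eq_of_lt_of_lt h2 b'.2 d'.2
  have hbZ : (b':ℤ) = d' := by exact_mod_cast hb'
  have e00' : γ.1 0 0 = η.1 0 0 := by
    rw [hbZ] at e00
    exact mul_left_cancel₀ hN' (by linarith)
  have e01'' : γ.1 0 1 = η.1 0 1 := by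
    rw [hbZ] at e01'
    exact mul_left_cancel₀ hN' (by linarith)
  have hγ : γ = η := by
    ext i j
    fin_cases i <;> fin_cases j
    · exact e00'
    · exact e01''
    · exact e10
    · exact e11'
  rw [Fin.ext hbd, Fin.ext hb', hγ]

lemma PC_le {N : ℕ} (hN : 1 ≤ N) (r : ℝ) (w : ℍ) :
    PC N r w ≤ ∑ g ∈ N.divisors, (g : ENNReal) * MM (N / g) r w := by
  classical
  set G : (ℕ × ℕ) × Matrix (Fin 2) (Fin 2) ℤ → ENNReal := fun v =>
    if v.1.1 ∈ N.divisors ∧ v.1.2 < v.1.1 then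
      {w : ℍ | v.2.det = ((N / v.1.1 : ℕ):ℤ)^2 ∧ dist (iGL v.2 • w) w ≤ r}.indicator 1 w else 0 with hG
  have e1 : PC N r w = ∑' t : (Fin N × Fin N) × SL(2, ℤ), G (Phi N t) := by
    rw [ENNReal.tsum_prod', tsum_fintype, Fintype.sum_prod_type]
    unfold PC
    refine Finset.sum_congr rfl fun b _ => Finset.sum_congr rfl fun b' _ => tsum_congr fun γ => ?_
    have h1 : gg N ((b, b'), γ) ∈ N.divisors := Nat.mem_divisors.2 ⟨gg_dvd _ _, by omega⟩
    have h2 : (b:ℕ) / (N / gg N ((b, b'), γ)) < gg N ((b, b'), γ) := by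
      rw [Nat.div_lt_iff_lt_mul (Nat.div_pos (Nat.le_of_dvd (by omega) (gg_dvd N _)) (gg_pos hN _)),
        Nat.mul_div_cancel' (gg_dvd _ _)]
      exact b.2
    simp only [hG, Phi]
    rw [if_pos ⟨h1, h2⟩]
    simp only [Set.indicator_apply, Set.mem_ofPred_eq, CP_det hN, CP_dist hN, true_and]
  have e2 : ∑' v, G v = ∑ g ∈ N.divisors, (g : ENNReal) * MM (N / g) r w := by
    rw [ENNReal.tsum_prod', ENNReal.tsum_prod', tsum_eq_sum (s := N.divisors)]
    · refine Finset.sum_congr rfl fun g hg => ?_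
      rw [tsum_eq_sum (s := Finset.range g)]
      · have : ∀ i ∈ Finset.range g, ∑' A, G ((g, i), A) = MM (N / g) r w := by
          intro i hi
          unfold MM
          refine tsum_congr fun A => ?_
          simp only [hG]
          rw [if_pos ⟨hg, Finset.mem_range.1 hi⟩]
        rw [Finset.sum_congr rfl this, Finset.sum_const, Finset.card_range, nsmul_eq_mul]
      · intro i hi
        rw [Finset.mem_range] at hi
        simp [hG, hi]
    · intro g hg
      have : ∀ i A, G ((g, i), A) = 0 := fun i A => if_neg fun h => hg h.1
      simp [this]
  rw [e1, ← e2]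
  exact ENNReal.tsum_comp_le_tsum_of_injective (Phi_inj hN) G

lemma measurable_PC (N : ℕ) (r : ℝ) : Measurable (PC N r) := by
  unfold PC
  refine Finset.measurable_sum _ fun b _ => Finset.measurable_sum _ fun b' _ => Measurable.tsum fun γ => 
    measurable_one.indicator ?_
  have h1 : Measurable fun w : ℍ => γ • iGL (AA N b) • w := 
    (measurable_const_smul γ).comp (measurable_const_smul (iGL (AA N b)))
  exact measurableSet_le (h1.dist (measurable_const_smul (iGL (AA N b')))) measurable_const

lemma PC_lintegral {R : ℕ} (hR : 1 ≤ R) {δ : ℝ} (hδ : 0 < δ) : ∃ C : ℝ, 0 ≤ C ∧ ∀ N : ℕ, 1 ≤ N → ∀ r : ℝ,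
    0 ≤ r → r^2 * N ≤ 4 → ∫⁻ w in KK R, PC N r w ≤ ENNReal.ofReal (C * (N:ℝ)^(1+2*δ)) := by
  obtain ⟨C, hC, h⟩ := MM_lintegral hR hδ
  obtain ⟨C0, hC0, hdiv⟩ := divisor_bound δ hδ
  refine ⟨C0 * C, by positivity, fun N hN r hr0 hr => ?_⟩
  have hN' : (1:ℝ) ≤ N := by exact_mod_cast hN
  calc ∫⁻ w in KK R, PC N r w ≤ ∫⁻ w in KK R, ∑ g ∈ N.divisors, (g : ENNReal) * MM (N / g) r w :=
        lintegral_mono fun w => PC_le hN r w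
    _ = ∑ g ∈ N.divisors, (g : ENNReal) * ∫⁻ w in KK R, MM (N / g) r w := by
        rw [lintegral_finsetSum _ fun g _ => (measurable_MM (N/g) r).const_mul _]
        exact Finset.sum_congr rfl fun g _ => lintegral_const_mul _ (measurable_MM (N/g) r)
    _ ≤ ∑ g ∈ N.divisors, ENNReal.ofReal (C * (N:ℝ)^(1+δ)) := by
        refine Finset.sum_le_sum fun g hg => ?_
        have hgd := (Nat.mem_divisors.1 hg).1
        have hg0 : 0 < g := Nat.pos_of_mem_divisors hg
        have hq : 1 ≤ N / g := Nat.div_pos (Nat.le_of_dvd (by omega) hgd) hg0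
        have hle : ((N / g : ℕ) : ℝ) ≤ N := by exact_mod_cast Nat.div_le_self N g
        have h1 := h (N / g) hq r hr0 (le_trans (by gcongr) hr)
        calc (g : ENNReal) * ∫⁻ w in KK R, MM (N / g) r w 
            ≤ ENNReal.ofReal g * ENNReal.ofReal (C * ((N / g : ℕ):ℝ)^(1+δ)) := by
              rw [ENNReal.ofReal_natCast]; gcongr
          _ = ENNReal.ofReal (g * (C * ((N / g : ℕ):ℝ)^(1+δ))) := by
              exact (ENNReal.ofReal_mul (by positivity)).symm
          _ ≤ _ := by
              apply ENNReal.ofReal_le_ofReal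
              have hqr : (0:ℝ) < ((N / g : ℕ):ℝ) := by exact_mod_cast hq
              have hNe : (N:ℝ) = g * ((N / g : ℕ):ℝ) := by exact_mod_cast (Nat.mul_div_cancel' hgd).symm
              rw [Real.rpow_add hqr, Real.rpow_add (by positivity : (0:ℝ) < N), Real.rpow_one, Real.rpow_one]
              have h2 : ((N / g : ℕ):ℝ)^δ ≤ (N:ℝ)^δ := Real.rpow_le_rpow hqr.le hle hδ.le
              calc _ = C * (g * ((N / g : ℕ):ℝ) * ((N / g : ℕ):ℝ)^δ) := by ring
                _ ≤ C * (g * ((N / g : ℕ):ℝ) * (N:ℝ)^δ) := by gcongr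
                _ = _ := by rw [← hNe]
    _ = ENNReal.ofReal (N.divisors.card * (C * (N:ℝ)^(1+δ))) := by
        rw [Finset.sum_const, nsmul_eq_mul, ENNReal.ofReal_mul (p := (N.divisors.card:ℝ)) (by positivity), ENNReal.ofReal_natCast]
    _ ≤ _ := by
        apply ENNReal.ofReal_le_ofReal
        have h2 := hdiv N (by omega)
        calc (N.divisors.card:ℝ) * (C * (N:ℝ)^(1+δ)) ≤ C0 * (N:ℝ)^δ * (C * (N:ℝ)^(1+δ)) := by gcongr
          _ = C0 * C * ((N:ℝ)^δ * (N:ℝ)^(1+δ)) := by ring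
          _ = _ := by rw [← Real.rpow_add (by positivity)]; congr 2; ring

lemma vol_ball_iGL {A : Matrix (Fin 2) (Fin 2) ℤ} (h : 0 < A.det) (w : ℍ) (r : ℝ) :
    volume (Metric.closedBall (iGL A • w) r) = volume (Metric.closedBall w r) := by
  rw [← measure_preimage_smul (volume : Measure ℍ) (iGL A) (Metric.closedBall (iGL A • w) r)]
  congr 1
  ext z
  simp only [Set.mem_preimage, Metric.mem_closedBall, iGL_dist h]

lemma exists_lift (h : ℍ → ENNReal) : ∃ F : XX → ENNReal, ∀ z, F (mkX z) = ∑' γ : SL(2, ℤ), h (γ • z) := by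
  choose o ho using mkX_surj
  refine ⟨fun x => ∑' γ : SL(2, ℤ), h (γ • o x), fun z => ?_⟩
  obtain ⟨γ0, h0⟩ := mkX_eq (ho (mkX z))
  simp only
  rw [← h0]
  simp_rw [← mul_smul]
  exact (Equiv.mulRight γ0).tsum_eq (fun γ => h (γ • z))

lemma CS_support {α : Type*} [MeasurableSpace α] (μ : Measure α) {F : α → ENNReal} (hF : Measurable F) :
    (∫⁻ x, F x ∂μ)^2 ≤ (∫⁻ x, F x * F x ∂μ) * μ {x | F x ≠ 0} := by
  have hS : MeasurableSet {x | F x ≠ 0} := (hF (measurableSet_singleton 0)).compl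
  have h1 := ENNReal.lintegral_mul_le_Lp_mul_Lq μ Real.HolderConjugate.two_two hF.aemeasurable
    ((measurable_one.indicator hS : Measurable ({x | F x ≠ 0}.indicator (1 : α → ENNReal)))).aemeasurable
  have e1 : ∫⁻ x, (F * {x | F x ≠ 0}.indicator (1 : α → ENNReal)) x ∂μ = ∫⁻ x, F x ∂μ := by
    refine lintegral_congr fun x => ?_
    rw [Pi.mul_apply]
    by_cases hx : F x = 0
    · simp [hx]
    · rw [Set.indicator_of_mem (by exact hx)]; simp
  have e2 : ∫⁻ x, ({x | F x ≠ 0}.indicator (1 : α → ENNReal) x)^(2:ℝ) ∂μ = μ {x | F x ≠ 0} := by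
    rw [← lintegral_indicator_one hS]
    refine lintegral_congr fun x => ?_
    by_cases hx : F x = 0
    · rw [Set.indicator_of_notMem (by simpa using hx)]; simp
    · rw [Set.indicator_of_mem (by exact hx)]; simp
  have e3 : ∫⁻ x, F x ^ (2:ℝ) ∂μ = ∫⁻ x, F x * F x ∂μ := by
    refine lintegral_congr fun x => ?_
    rw [ENNReal.rpow_two, pow_two]
  rw [e1, e2, e3] at h1
  calc (∫⁻ x, F x ∂μ)^2 ≤ ((∫⁻ x, F x * F x ∂μ)^(1/2:ℝ) * (μ {x | F x ≠ 0})^(1/2:ℝ))^2 := by gcongr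
    _ = _ := by
      rw [mul_pow, ← ENNReal.rpow_two, ← ENNReal.rpow_two, ← ENNReal.rpow_mul, ← ENNReal.rpow_mul]
      norm_num

lemma second_moment {N : ℕ} (w : ℍ) (hN : 1 ≤ N) {ε : ℝ} (hε : 0 < ε) : ∃ S : Set XX, MeasurableSet S ∧
    (∀ z, mkX z ∈ S → ∃ b : Fin N, ∃ γ : SL(2, ℤ), dist (γ • z) (iGL (AA N b) • w) ≤ ε) ∧
    (N:ENNReal)^2 * volume (Metric.closedBall w ε) ≤ PC N (2 * ε) w * muX S := by
  have hdet : ∀ b, 0 < (AA N b).det := fun b => by rw [det_AA]; exact_mod_cast hN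
  set v := volume (Metric.closedBall w ε) with hv
  have hvtop : v ≠ ⊤ := (isCompact_closedBall w ε).measure_lt_top.ne
  set Bb : Fin N → Set ℍ := fun b => Metric.closedBall (iGL (AA N b) • w) ε with hBb
  have hBm : ∀ b, MeasurableSet (Bb b) := fun b => measurableSet_closedBall
  have hBv : ∀ b, volume (Bb b) = v := fun b => vol_ball_iGL (hdet b) w ε
  set h : ℍ → ENNReal := fun z => ∑ b : Fin N, (Bb b).indicator 1 z with hh
  have hhm : Measurable h := Finset.measurable_sum _ fun b _ => measurable_one.indicator (hBm b)
  obtain ⟨F, hF⟩ := exists_lift h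
  have hFm : Measurable F := by
    rw [measurable_X]
    simp_rw [hF]
    exact Measurable.tsum fun γ => hhm.comp (measurable_const_smul γ)
  have hFmk : Measurable fun z => F (mkX z) := measurable_X.1 hFm
  have hIntg : ∫⁻ x, F x ∂muX = N * v := by
    rw [lintegral_muX_unfold F h hhm hF, hh, lintegral_finsetSum _ fun b _ => measurable_one.indicator (hBm b)]
    have : ∀ b ∈ Finset.univ, ∫⁻ z, (Bb b).indicator 1 z = v := fun b _ => by
      rw [lintegral_indicator_one (hBm b), hBv]
    rw [Finset.sum_congr rfl this]
    simp
  have hint2 : ∫⁻ x, F x * F x ∂muX ≤ v * PC N (2 * ε) w := by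
    have hu := lintegral_muX_unfold (fun x => F x * F x) (fun z => h z * F (mkX z)) (hhm.mul hFmk) (fun z => by
      simp_rw [mkX_smul]
      rw [ENNReal.tsum_mul_right, ← hF])
    rw [hu]
    have hexp : ∀ z, h z * F (mkX z) = ∑ b : Fin N, ∑ b' : Fin N, ∑' γ : SL(2, ℤ), 
        (Bb b ∩ (fun z => γ • z) ⁻¹' (Bb b')).indicator 1 z := by
      intro z
      rw [hF]
      have h1 : ∑' γ : SL(2, ℤ), h (γ • z) = ∑ b' : Fin N, ∑' γ : SL(2, ℤ), (Bb b').indicator 1 (γ • z) := by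
        rw [hh]
        exact Summable.tsum_finsetSum fun _ _ => ENNReal.summable
      rw [h1, hh]
      simp only
      rw [Finset.sum_mul_sum]
      refine Finset.sum_congr rfl fun b _ => Finset.sum_congr rfl fun b' _ => ?_
      rw [← ENNReal.tsum_mul_left]
      refine tsum_congr fun γ => ?_
      rw [Set.inter_indicator_one]
      rfl
    simp_rw [hexp]
    have hmI : ∀ b b' (γ : SL(2, ℤ)), MeasurableSet (Bb b ∩ (fun z => γ • z) ⁻¹' (Bb b')) := fun b b' γ =>
      (hBm b).inter ((measurable_const_smul γ) (hBm b'))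
    have hmI2 : ∀ b b' (γ : SL(2, ℤ)), Measurable fun z => (Bb b ∩ (fun z => γ • z) ⁻¹' (Bb b')).indicator (1 : ℍ → ENNReal) z := 
      fun b b' γ => measurable_one.indicator (hmI b b' γ)
    rw [lintegral_finsetSum _ fun b _ => Finset.measurable_sum _ fun b' _ => Measurable.tsum fun γ => hmI2 b b' γ]
    rw [PC, Finset.mul_sum]
    refine Finset.sum_le_sum fun b _ => ?_
    rw [lintegral_finsetSum _ fun b' _ => Measurable.tsum fun γ => hmI2 b b' γ, Finset.mul_sum]
    refine Finset.sum_le_sum fun b' _ => ?_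
    rw [lintegral_tsum fun γ => (hmI2 b b' γ).aemeasurable, ← ENNReal.tsum_mul_left]
    refine ENNReal.tsum_le_tsum fun γ => ?_
    rw [lintegral_indicator_one (hmI b b' γ)]
    by_cases hw : dist (γ • iGL (AA N b) • w) (iGL (AA N b') • w) ≤ 2 * ε
    · rw [Set.indicator_of_mem (by exact hw), Pi.one_apply, mul_one, ← hBv b]
      exact measure_mono Set.inter_subset_left
    · have : Bb b ∩ (fun z => γ • z) ⁻¹' (Bb b') = ∅ := by
        ext z
        simp only [Set.mem_empty_iff_false, iff_false]
        rintro ⟨hz1, hz2⟩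
        apply hw
        have d1 : dist z (iGL (AA N b) • w) ≤ ε := hz1
        have d2 : dist (γ • z) (iGL (AA N b') • w) ≤ ε := hz2
        rw [dist_comm] at d1
        have d4 := dist_triangle (γ • iGL (AA N b) • w) (γ • z) (iGL (AA N b') • w)
        rw [SL2Z_dist] at d4
        linarith
      rw [this]; simp
  refine ⟨{x | F x ≠ 0}, (hFm (measurableSet_singleton 0)).compl, ?_, ?_⟩
  · intro z hz
    have hz' : F (mkX z) ≠ 0 := hz
    rw [hF] at hz'
    by_contra hcon
    push Not at hcon
    apply hz'
    rw [ENNReal.tsum_eq_zero]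
    intro γ
    rw [hh]
    refine Finset.sum_eq_zero fun b _ => ?_
    rw [Set.indicator_of_notMem]
    intro hmem
    exact absurd hmem (not_le.2 (hcon b γ))
  · have hCS := CS_support muX hFm
    rw [hIntg] at hCS
    have h3 : v * ((N:ENNReal)^2 * v) ≤ v * (PC N (2 * ε) w * muX {x | F x ≠ 0}) := by
      calc v * ((N:ENNReal)^2 * v) = (N * v)^2 := by ring
        _ ≤ _ := hCS
        _ ≤ (v * PC N (2 * ε) w) * muX {x | F x ≠ 0} := by gcongr
        _ = _ := by ring
    by_cases hv0 : v = 0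
    · rw [hv0, mul_zero]; exact zero_le
    exact (ENNReal.mul_le_mul_iff_right hv0 hvtop).1 h3

lemma vol_ball_ge {R : ℕ} (hR : 1 ≤ R) {w : ℍ} (hw : w ∈ KK R) {ε : ℝ} (h0 : 0 < ε) (h1 : ε ≤ 1) :
    ENNReal.ofReal (ε^2 / (16 * R^4)) ≤ volume (Metric.closedBall w ε) := by
  have hR' : (1:ℝ) ≤ R := by exact_mod_cast hR
  set t := ε / (4 * R) with ht
  have ht0 : 0 < t := by positivity
  have htR : 4 * R * t = ε := by rw [ht]; field_simp
  have hy1 := hw.2.1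
  have hy2 := hw.2.2
  have hyR : 1 ≤ w.im * R := by rwa [div_le_iff₀ (by positivity)] at hy1
  have htRle : t * R ≤ 1 / 4 := by nlinarith
  rw [volume_eq_map, Measure.map_apply measurable_mkH measurableSet_closedBall]
  have hsub : Set.Icc (w.re - t) (w.re + t) ×ˢ Set.Icc (w.im - t) (w.im + t) ⊆ mkH ⁻¹' (Metric.closedBall w ε) := by
    rintro ⟨x, y⟩ ⟨⟨hx1, hx2⟩, ⟨hyy1, hyy2⟩⟩
    simp only at hx1 hx2 hyy1 hyy2
    have hylow : 1 / (2 * R) ≤ y := by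
      rw [div_le_iff₀ (by positivity)]
      have : (w.im - t) * (2 * R) ≤ y * (2 * R) := by gcongr
      nlinarith
    have hypos : 0 < y := lt_of_lt_of_le (by positivity) hylow
    rw [Set.mem_preimage, Metric.mem_closedBall]
    refine (dist_le_dist_coe_div_sqrt _ _).trans ?_
    rw [mkH_im (by exact hypos)]
    have hs : 1 / (2 * (R:ℝ)) ≤ √(y * w.im) := by
      apply Real.le_sqrt_of_sq_le
      have h3 : 1 / (2 * (R:ℝ)) ≤ w.im := le_trans (by gcongr; linarith) hy1
      rw [pow_two]
      exact mul_le_mul hylow h3 (by positivity) hypos.le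
    have hd : dist ((mkH (x, y) : ℍ) : ℂ) w ≤ 2 * t := by
      rw [mkH_of_pos (by exact hypos), Complex.dist_eq]
      refine (Complex.norm_le_abs_re_add_abs_im _).trans ?_
      have a1 : |x - w.re| ≤ t := abs_le.2 ⟨by linarith, by linarith⟩
      have a2 : |y - w.im| ≤ t := abs_le.2 ⟨by linarith, by linarith⟩
      simp only [Complex.sub_re, Complex.sub_im]
      exact (add_le_add a1 a2).trans (by linarith)
    rw [div_le_iff₀ (lt_of_lt_of_le (by positivity) hs)]
    refine hd.trans ?_
    calc 2 * t = ε * (1 / (2 * R)) := by rw [← htR]; field_simp; norm_num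
      _ ≤ _ := by gcongr
  refine le_trans ?_ (measure_mono hsub)
  rw [Measure.prod_prod, Real.volume_Icc]
  have hnu : ENNReal.ofReal (1 / (4 * R^2)) * ENNReal.ofReal (2 * t) ≤ nuY (Set.Icc (w.im - t) (w.im + t)) := by
    have hwt : 0 < w.im - t := by nlinarith
    rw [← lintegral_indicator_one measurableSet_Icc, lintegral_nuY _ (measurable_one.indicator measurableSet_Icc)]
    calc _ = ∫⁻ y in Set.Icc (w.im - t) (w.im + t), ENNReal.ofReal (1 / (4 * R^2)) := by
          rw [setLIntegral_const, Real.volume_Icc]; congr 2; ring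
      _ ≤ ∫⁻ y in Set.Icc (w.im - t) (w.im + t), ENNReal.ofReal (1 / y ^ 2) * (Set.Icc (w.im - t) (w.im + t)).indicator 1 y := by
          refine setLIntegral_mono' measurableSet_Icc fun y hy => ?_
          rw [Set.indicator_of_mem hy, Pi.one_apply, mul_one]
          apply ENNReal.ofReal_le_ofReal
          have hypos : 0 < y := lt_of_lt_of_le hwt hy.1
          have : y ≤ 2 * R := by have := hy.2; nlinarith
          apply one_div_le_one_div_of_le (by positivity)
          nlinarith
      _ ≤ _ := lintegral_mono_set (fun y hy => lt_of_lt_of_le hwt hy.1)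
  calc _ = ENNReal.ofReal (2 * t) * (ENNReal.ofReal (1 / (4 * R^2)) * ENNReal.ofReal (2 * t)) := by
        rw [← ENNReal.ofReal_mul (by positivity), ← ENNReal.ofReal_mul (by positivity)]
        congr 1
        rw [ht]; field_simp; norm_num
    _ ≤ _ := by
        rw [show w.re + t - (w.re - t) = 2 * t by ring]
        gcongr

lemma ae_of_muX {P : XX → Prop} (h : ∀ᵐ x ∂muX, P x) : ∀ᵐ z : ℍ, P (mkX z) := by
  obtain ⟨E, hsub, hE, hE0⟩ := exists_measurable_superset_of_null h
  have hT : MeasurableSet (mkX ⁻¹' E) := measurable_mkX hE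
  have h1 := lintegral_muX (E.indicator 1) (measurable_one.indicator hE)
  rw [lintegral_indicator_one hE, hE0] at h1
  have hmE : Measurable fun z => E.indicator (1 : XX → ENNReal) (mkX z) :=
    measurable_X.1 (measurable_one.indicator hE)
  have h2 := (lintegral_eq_zero_iff (measurable_phi.mul hmE)).1 h1.symm
  have h3 := unfold_lintegral (fun z => E.indicator (1 : XX → ENNReal) (mkX z)) hmE
  have h4 : ∫⁻ z, phi z * ∑' γ : SL(2, ℤ), E.indicator (1 : XX → ENNReal) (mkX (γ • z)) = 0 := by
    rw [lintegral_congr_ae (g := fun _ => 0), lintegral_zero]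
    filter_upwards [h2] with z hz
    simp_rw [mkX_smul]
    rw [← ENNReal.tsum_mul_left]
    have hz' : phi z * E.indicator (1 : XX → ENNReal) (mkX z) = 0 := hz
    rw [hz']; simp
  rw [h4] at h3
  have h5 := (lintegral_eq_zero_iff hmE).1 h3.symm
  filter_upwards [h5] with z hz
  by_contra hP
  have : mkX z ∈ E := hsub hP
  have hz' : E.indicator (1 : XX → ENNReal) (mkX z) = 0 := hz
  rw [Set.indicator_of_mem this] at hz'
  exact one_ne_zero hz'

/-- The pair `(z, w)` has a good approximation at stage `s`. -/
def Good (p m s : ℕ) (z w : ℍ) : Prop :=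
  ∃ C : Matrix (Fin 2) (Fin 2) ℤ, C.det = (p:ℤ)^(2 * ((m + 1) * s)) ∧ dist (iGL C • z) w ≤ ((p:ℝ)^(m * s))⁻¹

lemma exists_delta {p : ℕ} (hp : p.Prime) {m : ℕ} (hm : 1 ≤ m) {ρ : ℝ} (h0 : 0 < ρ) (h1 : ρ < 1) :
    ∃ δ : ℝ, 0 < δ ∧ ∃ θ : ℝ, 1 < θ ∧ θ^3 = ρ⁻¹ ∧ ∀ s : ℕ, ((p^(2 * (m * s)) : ℕ) : ℝ)^δ = θ^s := by
  have hp1 : (1:ℝ) < p := by exact_mod_cast hp.one_lt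
  have hlp := Real.log_pos hp1
  have hlr := Real.log_neg h0 h1
  have hm' : (0:ℝ) < m := by exact_mod_cast hm
  refine ⟨-Real.log ρ / (6 * m * Real.log p), by apply div_pos <;> [linarith; positivity],
    Real.exp (-Real.log ρ / 3), by rw [Real.one_lt_exp_iff]; linarith, ?_, fun s => ?_⟩
  · rw [← Real.exp_nat_mul, ← Real.exp_log (inv_pos.2 h0), Real.log_inv]; congr 1; push_cast; ring
  · rw [← Real.exp_nat_mul, Real.rpow_def_of_pos (by exact_mod_cast pow_pos hp.pos _)]
    congr 1
    push_cast
    rw [Real.log_pow]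
    push_cast
    field_simp
    ring

lemma stepA {p : ℕ} (hp : p.Prime) {m : ℕ} (hm : 1 ≤ m) {ρ : ℝ} (h0 : 0 < ρ) (h1 : ρ < 1) {R : ℕ} (hR : 1 ≤ R) :
    ∀ᵐ w ∂(volume.restrict (KK R)), ∀ᶠ s : ℕ in Filter.atTop,
      PC (p^(2 * (m * s))) (2 * ((p:ℝ)^(m * s))⁻¹) w ≤ ENNReal.ofReal (((p:ℝ)^(m * s))^2 * (ρ⁻¹)^s) := by
  obtain ⟨δ, hδ, θ, hθ, hθ3, hpow⟩ := exists_delta hp hm h0 h1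
  obtain ⟨C, hC, hP⟩ := PC_lintegral hR hδ
  have hp0 : (0:ℝ) < p := by exact_mod_cast hp.pos
  have hθ0 : 0 < θ := by linarith
  set a : ℕ → ENNReal := fun s => ENNReal.ofReal (((p:ℝ)^(m * s))^2 * (ρ⁻¹)^s) with ha
  have hbound : ∀ s, (volume.restrict (KK R)) {w | a s ≤ PC (p^(2 * (m * s))) (2 * ((p:ℝ)^(m * s))⁻¹) w} ≤
      ENNReal.ofReal (C * (θ⁻¹)^s) := by
    intro s
    have hq : (0:ℝ) < (p:ℝ)^(m * s) := by positivity
    have hN : 1 ≤ p^(2 * (m * s)) := Nat.one_le_pow _ _ hp.pos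
    have hNr : ((p^(2 * (m * s)) : ℕ) : ℝ) = ((p:ℝ)^(m*s))^2 := by push_cast; rw [← pow_mul]; congr 1; ring
    have hIntg := hP (p^(2 * (m * s))) hN (2 * ((p:ℝ)^(m * s))⁻¹) (by positivity) (by
      rw [hNr]; apply le_of_eq; field_simp; norm_num)
    refine (meas_ge_le_lintegral_div (measurable_PC _ _).aemeasurable (ε := a s) ?_ ?_).trans ?_
    · rw [ha]; simp only; rw [Ne, ENNReal.ofReal_eq_zero, not_le]; positivity
    · exact ENNReal.ofReal_ne_top
    · refine (ENNReal.div_le_div_right hIntg _).trans ?_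
      rw [ha]; simp only
      rw [← ENNReal.ofReal_div_of_pos (by positivity)]
      apply ENNReal.ofReal_le_ofReal
      apply le_of_eq
      rw [Real.rpow_add (by rw [hNr]; positivity), Real.rpow_one, mul_comm 2 δ, Real.rpow_mul (by positivity), hpow, hNr,
        ← hθ3, Real.rpow_two]
      simp only [inv_pow]
      field_simp
      ring
  have hsum : Summable fun s : ℕ => C * (θ⁻¹)^s :=
    (summable_geometric_of_lt_one (by positivity) (inv_lt_one_of_one_lt₀ hθ)).mul_left C
  have htsum : ∑' s, (volume.restrict (KK R)) {w | a s ≤ PC (p^(2 * (m * s))) (2 * ((p:ℝ)^(m * s))⁻¹) w} ≠ ⊤ :=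
    ne_top_of_le_ne_top hsum.tsum_ofReal_ne_top (ENNReal.tsum_le_tsum hbound)
  filter_upwards [ae_eventually_notMem htsum] with w hw
  filter_upwards [hw] with s hs
  exact (not_le.1 hs).le

lemma stepB {p : ℕ} (hp : p.Prime) {m : ℕ} {R : ℕ} (hR : 1 ≤ R) {w : ℍ} (hw : w ∈ KK R)
    (hPC : ∀ᶠ s : ℕ in Filter.atTop,
      PC (p^(2 * (m * s))) (2 * ((p:ℝ)^(m * s))⁻¹) w ≤ ENNReal.ofReal (((p:ℝ)^(m * s))^2 * ((rho p (1/16))⁻¹)^s)) :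
    ∀ᵐ z : ℍ, ∀ᶠ s in Filter.atTop, Good p m s z w := by
  set ρ := rho p (1/16) with hρ
  have h0 : 0 < ρ := rho_pos hp _
  have h1 : ρ < 1 := rho_lt hp (by norm_num) (by norm_num)
  have hp1 : (1:ℝ) < p := by exact_mod_cast hp.one_lt
  have hp0 : (0:ℝ) < p := by linarith
  have hR' : (1:ℝ) ≤ R := by exact_mod_cast hR
  have hN : ∀ s, 1 ≤ p^(2 * (m * s)) := fun s => Nat.one_le_pow _ _ hp.pos
  have hq : ∀ s, (0:ℝ) < (p:ℝ)^(m * s) := fun s => by positivity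
  have hNr : ∀ s, ((p^(2 * (m * s)) : ℕ) : ℝ) = ((p:ℝ)^(m*s))^2 := fun s => by push_cast; rw [← pow_mul]; congr 1; ring
  choose S hSm hS1 hS2 using fun s => second_moment (N := p^(2 * (m * s))) w (hN s) (inv_pos.2 (hq s))
  have hlow : ∀ᶠ s in Filter.atTop, ρ^s / (16 * R^4) ≤ muX.real (S s) := by
    filter_upwards [hPC] with s hs
    have hv := vol_ball_ge hR hw (inv_pos.2 (hq s)) (inv_le_one_of_one_le₀ (one_le_pow₀ hp1.le))
    have h2 : ENNReal.ofReal ((((p:ℝ)^(m*s))^2)^2 * ((((p:ℝ)^(m*s))⁻¹)^2 / (16 * R^4))) ≤ 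
        ENNReal.ofReal (((p:ℝ)^(m * s))^2 * (ρ⁻¹)^s * muX.real (S s)) := by
      calc _ = ((p^(2 * (m * s)) : ℕ) : ENNReal)^2 * ENNReal.ofReal ((((p:ℝ)^(m*s))⁻¹)^2 / (16 * R^4)) := by
            rw [ENNReal.ofReal_mul (by positivity), ← hNr, ENNReal.ofReal_pow (by positivity), ENNReal.ofReal_natCast]
        _ ≤ _ := by gcongr
        _ ≤ _ := hS2 s
        _ ≤ ENNReal.ofReal (((p:ℝ)^(m * s))^2 * (ρ⁻¹)^s) * muX (S s) := by gcongr
        _ = _ := by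
            rw [ENNReal.ofReal_mul (p := ((p:ℝ)^(m * s))^2 * (ρ⁻¹)^s) (by positivity), ofReal_measureReal]
    have h3 := (ENNReal.ofReal_le_ofReal_iff (by positivity)).1 h2
    have h4 : (((p:ℝ)^(m*s))^2)^2 * ((((p:ℝ)^(m*s))⁻¹)^2 / (16 * R^4)) = 
      ((p:ℝ)^(m * s))^2 * (ρ⁻¹)^s * (ρ^s / (16 * R^4)) := by
      rw [inv_pow ρ]
      field_simp
    rw [h4] at h3
    exact le_of_mul_le_mul_left h3 (by positivity)
  set miss : ℕ → Set XX := fun s => {x | (TX p)^[2 * s] ((S s).indicator 1) x = 0} with hmiss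
  set M := muX.real Set.univ with hM
  obtain ⟨s0, hs0⟩ := Filter.eventually_atTop.1 hlow
  have hmb : ∀ s, muX (miss (s + s0)) ≤ ENNReal.ofReal (16 * R^4 * M^2 * (ρ^3)^(s + s0)) := by
    intro s
    set t := s + s0
    have hl := hs0 t (by omega)
    have hpos : 0 < muX.real (S t) := lt_of_lt_of_le (by positivity) hl
    have hb := miss_bound p hp (hSm t) (2 * t)
    rw [← ofReal_measureReal]
    apply ENNReal.ofReal_le_ofReal
    have hb2 : muX.real (miss t) * muX.real (S t) ≤ M^2 * ρ^(2 * (2 * t)) := by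
      have : (muX.real (miss t) * muX.real (S t)) * muX.real (S t) ≤ (M^2 * ρ^(2 * (2 * t))) * muX.real (S t) := by
        calc _ = muX.real (miss t) * (muX.real (S t))^2 := by ring
          _ ≤ _ := hb
      exact le_of_mul_le_mul_right this hpos
    have hb3 : muX.real (miss t) * (ρ^t / (16 * R^4)) ≤ M^2 * ρ^(2 * (2 * t)) :=
      le_trans (by gcongr) hb2
    have hb4 : M^2 * ρ^(2 * (2 * t)) = (16 * R^4 * M^2 * (ρ^3)^t) * (ρ^t / (16 * R^4)) := by
      have : ρ^(2 * (2 * t)) = (ρ^3)^t * ρ^t := by rw [← pow_mul, ← pow_add]; congr 1; ring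
      rw [this]; field_simp
    rw [hb4] at hb3
    exact le_of_mul_le_mul_right hb3 (by positivity)
  have hsum : Summable fun s : ℕ => 16 * R^4 * M^2 * (ρ^3)^(s + s0) := by
    have h5 : Summable fun s : ℕ => (ρ^3)^s :=
      summable_geometric_of_lt_one (by positivity) (pow_lt_one₀ h0.le h1 (by norm_num))
    exact ((summable_nat_add_iff s0).2 h5).mul_left _
  have htsum : ∑' s, muX (miss (s + s0)) ≠ ⊤ :=
    ne_top_of_le_ne_top hsum.tsum_ofReal_ne_top (ENNReal.tsum_le_tsum hmb)
  have hae := ae_of_muX (ae_eventually_notMem htsum)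
  filter_upwards [hae] with z hz
  have hz2 : ∀ᶠ s in Filter.atTop, mkX z ∉ miss s := by
    obtain ⟨s1, hs1⟩ := Filter.eventually_atTop.1 hz
    refine Filter.eventually_atTop.2 ⟨s1 + s0, fun s hs => ?_⟩
    have := hs1 (s - s0) (by omega)
    rwa [Nat.sub_add_cancel (by omega)] at this
  filter_upwards [hz2] with s hs
  obtain ⟨A, hAdet, hAS⟩ := TX_ne_zero p hp (2 * s) z hs
  obtain ⟨b, γ, hd⟩ := hS1 s _ hAS
  have hpZ : (0:ℤ) < p := by exact_mod_cast hp.pos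
  have hA : 0 < A.det := by rw [hAdet]; positivity
  have hB : 0 < (AA (p^(2 * (m * s))) b).det := by rw [det_AA]; exact_mod_cast hN s
  have hadj : (AA (p^(2 * (m * s))) b).adjugate.det = ((p^(2 * (m * s)) : ℕ) : ℤ) := by
    rw [Matrix.det_adjugate, det_AA]; simp
  have hadj0 : 0 < (AA (p^(2 * (m * s))) b).adjugate.det := by rw [hadj]; exact_mod_cast hN s
  refine ⟨(AA (p^(2 * (m * s))) b).adjugate * (γ.1 * A), ?_, ?_⟩
  · rw [Matrix.det_mul, Matrix.det_mul, hadj, γ.2, hAdet, one_mul]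
    push_cast
    rw [← pow_add]; congr 1; ring
  · rw [iGL_mul hadj0.ne' (by rw [Matrix.det_mul, γ.2, one_mul]; exact hA.ne'),
      iGL_mul (by rw [γ.2]; exact one_ne_zero) hA.ne', mul_smul, mul_smul, iGL_SL]
    rw [← iGL_adj_smul hB w, iGL_dist hadj0]
    exact hd

lemma ae_good {p : ℕ} (hp : p.Prime) {m : ℕ} (hm : 1 ≤ m) :
    ∀ᵐ w : ℍ, ∀ᵐ z : ℍ, ∀ᶠ s in Filter.atTop, Good p m s z w := by
  have h1 : ∀ᵐ w : ℍ, ∀ R : ℕ, w ∈ KK (R + 1) → ∀ᵐ z : ℍ, ∀ᶠ s in Filter.atTop, Good p m s z w := by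
    rw [ae_all_iff]
    intro R
    have hA := stepA hp hm (rho_pos hp (1/16)) (rho_lt hp (by norm_num) (by norm_num)) (R := R + 1) (by omega)
    rw [ae_restrict_iff' (measurableSet_KK _)] at hA
    filter_upwards [hA] with w hw hK
    exact stepB hp (by omega) hK (hw hK)
  filter_upwards [h1] with w hw
  obtain ⟨R, hR⟩ := exists_nat_ge (max |w.re| (max w.im (1 / w.im)))
  have r1 := (le_max_left _ _).trans hR
  have r2 := ((le_max_left _ _).trans (le_max_right _ _)).trans hR
  have r3 := ((le_max_right _ _).trans (le_max_right _ _)).trans hR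
  refine hw R ⟨?_, ?_, ?_⟩
  · push_cast; linarith
  · push_cast
    have := w.im_pos
    rw [div_le_iff₀ this] at r3
    rw [div_le_iff₀ (by positivity)]
    nlinarith
  · push_cast; linarith

lemma null_coe_image {s : Set ℍ} (h : volume s = 0) : volume ((fun z : ℍ => (z : ℂ)) '' s) = 0 := by
  obtain ⟨t, hst, ht, ht0⟩ := exists_measurable_superset_of_null h
  refine measure_mono_null (Set.image_mono hst) ?_
  have hm : MeasurableSet ((fun z : ℍ => (z : ℂ)) '' t) := measurableEmbedding_coe.measurableSet_image.2 ht
  rw [UpperHalfPlane.volume_eq_lintegral] at ht0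
  rw [lintegral_eq_zero_iff (by fun_prop)] at ht0
  rw [Filter.EventuallyEq, ae_restrict_iff' hm] at ht0
  rw [← compl_compl ((fun z : ℍ => (z : ℂ)) '' t)]
  have : ∀ᵐ x : ℂ, x ∈ ((fun z : ℍ => (z : ℂ)) '' t)ᶜ := by
    filter_upwards [ht0] with x hx hmem
    have h1 := hx hmem
    obtain ⟨z, -, rfl⟩ := hmem
    have hz : (0:ℝ) < z.im := z.im_pos
    have hz2 : ‖(z:ℂ).im‖₊ ≠ 0 := by
      rw [nnnorm_ne_zero_iff]; exact hz.ne'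
    simp at h1
    exact hz.ne' h1
  exact this

lemma measurable_good (p m s : ℕ) : MeasurableSet {q : ℍ × ℍ | Good p m s q.1 q.2} := by
  have : {q : ℍ × ℍ | Good p m s q.1 q.2} =
      ⋃ C : {C : Matrix (Fin 2) (Fin 2) ℤ // C.det = (p:ℤ)^(2 * ((m + 1) * s))},
        {q : ℍ × ℍ | dist (iGL C.1 • q.1) q.2 ≤ ((p:ℝ)^(m * s))⁻¹} := by
    ext q
    simp [Good]
  rw [this]
  refine MeasurableSet.iUnion fun C => ?_
  have h1 : Measurable fun q : ℍ × ℍ => iGL C.1 • q.1 := (measurable_const_smul (iGL C.1)).comp measurable_fst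
  exact measurableSet_le (h1.dist measurable_snd) measurable_const

def badSet (p m : ℕ) : Set (ℍ × ℍ) := {q | ¬ ∀ᶠ s in Filter.atTop, Good p m s q.1 q.2}

lemma measurable_badSet (p m : ℕ) : MeasurableSet (badSet p m) := by
  have : badSet p m = (⋃ a : ℕ, ⋂ b : ℕ, ⋂ _ : a ≤ b, {q : ℍ × ℍ | Good p m b q.1 q.2})ᶜ := by
    ext q
    simp [badSet, Filter.eventually_atTop]
  rw [this]
  exact (MeasurableSet.iUnion fun a => MeasurableSet.iInter fun b => MeasurableSet.iInter fun _ =>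
    measurable_good p m b).compl

lemma badSet_null {p : ℕ} (hp : p.Prime) {m : ℕ} (hm : 1 ≤ m) :
    volume ((Prod.map (fun z : ℍ => (z : ℂ)) (fun z : ℍ => (z : ℂ))) '' badSet p m) = 0 := by
  set E := (Prod.map (fun z : ℍ => (z : ℂ)) (fun z : ℍ => (z : ℂ))) '' badSet p m with hE
  have hEm : MeasurableSet E :=
    (measurableEmbedding_coe.prodMap measurableEmbedding_coe).measurableSet_image.2 (measurable_badSet p m)
  rw [Measure.volume_eq_prod, Measure.prod_apply_symm hEm, lintegral_eq_zero_iff (measurable_measure_prodMk_right hEm)]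
  have hg := null_coe_image (ae_iff.1 (ae_good hp hm))
  have hg' : ∀ᵐ y : ℂ, y ∉ (fun z : ℍ => (z : ℂ)) '' {w : ℍ | ¬ ∀ᵐ z : ℍ, ∀ᶠ s in Filter.atTop, Good p m s z w} :=
    measure_eq_zero_iff_ae_notMem.1 hg
  filter_upwards [hg'] with y hy
  show volume _ = 0
  by_cases hyy : ∃ w : ℍ, (w : ℂ) = y
  · obtain ⟨w, rfl⟩ := hyy
    have hw : ∀ᵐ z : ℍ, ∀ᶠ s in Filter.atTop, Good p m s z w := by
      by_contra hcon
      exact hy ⟨w, hcon, rfl⟩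
    refine measure_mono_null ?_ (null_coe_image (ae_iff.1 hw))
    rintro x ⟨⟨z, w'⟩, hq, hxy⟩
    simp only [Prod.map_apply, Prod.mk.injEq] at hxy
    have : w' = w := UpperHalfPlane.ext hxy.2
    subst this
    exact ⟨z, hq, hxy.1⟩
  · refine measure_mono_null (t := ∅) ?_ measure_empty
    rintro x ⟨⟨z, w'⟩, hq, hxy⟩
    simp only [Prod.map_apply, Prod.mk.injEq] at hxy
    exact hyy ⟨w', hxy.2⟩

lemma good_gamma {p : ℕ} (hp : p.Prime) {m s : ℕ} {z w : ℍ} (h : Good p m s z w) :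
    ∃ γ : SL(2, ℚ), (∀ i j, IsZInvP p (γ.1 i j)) ∧ dist (γ⁻¹ • z) w ≤ ((p:ℝ)^(m * s))⁻¹ ∧
      ht p γ.1 ≤ (m + 1) * s := by
  obtain ⟨C, hdet, hd⟩ := h
  set k := (m + 1) * s with hk
  have hp0 : (p:ℚ) ≠ 0 := by exact_mod_cast hp.ne_zero
  have hpk : (p:ℚ)^k ≠ 0 := pow_ne_zero _ hp0
  have hpZ : (0:ℤ) < p := by exact_mod_cast hp.pos
  have hC : 0 < C.det := by rw [hdet]; positivity
  have hdq : (C 0 0 : ℚ) * C 1 1 - C 0 1 * C 1 0 = (p:ℚ)^(2 * k) := by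
    rw [Matrix.det_fin_two] at hdet
    exact_mod_cast hdet
  let g : SL(2, ℚ) := ⟨!![(C 0 0 : ℚ) / p^k, C 0 1 / p^k; C 1 0 / p^k, C 1 1 / p^k], by
    rw [Matrix.det_fin_two_of]
    rw [div_mul_div_comm, div_mul_div_comm, ← sub_div, hdq, div_eq_one_iff_eq (by positivity)]
    ring⟩
  have hgi : (g⁻¹ : SL(2, ℚ)).1 = !![(C 1 1 : ℚ) / p^k, -(C 0 1 / p^k); -(C 1 0 / p^k), C 0 0 / p^k] := by
    rw [Matrix.SpecialLinearGroup.coe_inv, Matrix.adjugate_fin_two]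
    rfl
  refine ⟨g⁻¹, ?_, ?_, ?_⟩
  · rw [hgi]
    intro i j
    fin_cases i <;> fin_cases j
    · exact ⟨C 1 1, k, by simp⟩
    · exact ⟨-C 0 1, k, by simp [neg_div]⟩
    · exact ⟨-C 1 0, k, by simp [neg_div]⟩
    · exact ⟨C 0 0, k, by simp⟩
  · rw [inv_inv]
    have : g • z = iGL C • z := by
      apply UpperHalfPlane.ext
      rw [coe_iGL_smul hC, UpperHalfPlane.coe_specialLinearGroup_apply]
      have hpc : ((p:ℂ))^k ≠ 0 := pow_ne_zero _ (by exact_mod_cast hp.ne_zero)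
      simp only [g, Matrix.SpecialLinearGroup.coe_mk, Matrix.of_apply, Matrix.cons_val', Matrix.cons_val_zero, Matrix.cons_val_one,
        Matrix.cons_val_fin_one]
      have e : ∀ a b : ℤ, ((algebraMap ℚ ℝ ((a:ℚ) / p^k) : ℝ) : ℂ) * z + ((algebraMap ℚ ℝ ((b:ℚ) / p^k) : ℝ) : ℂ) =
          ((a:ℂ) * z + b) / p^k := by
        intro a b
        simp
        ring
      rw [e, e, div_div_div_cancel_right₀ hpc]
    rw [this]
    exact hd
  · apply Nat.sInf_le
    show IsIntMat _
    rw [hgi]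
    intro i j
    fin_cases i <;> fin_cases j
    · exact ⟨C 1 1, by simp; field_simp⟩
    · exact ⟨-C 0 1, by simp; field_simp⟩
    · exact ⟨-C 1 0, by simp; field_simp⟩
    · exact ⟨C 0 0, by simp; field_simp⟩

lemma final_pair {p : ℕ} (hp : p.Prime) {z w : ℍ}
    (h : ∀ m : ℕ, 1 ≤ m → ∀ᶠ s in Filter.atTop, Good p m s z w) :
    ∀ ζ : ℝ, 1 < ζ → ∃ ε₀ > 0, ∀ ε : ℝ, 0 < ε → ε < ε₀ →
        ∃ γ : SL(2, ℚ), (∀ i j, IsZInvP p (γ.1 i j)) ∧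
          dist (γ⁻¹ • z) w ≤ ε ∧
          (ht p γ.1 : ℝ) ≤ ζ * Real.log ε⁻¹ / Real.log p := by
  intro ζ hζ
  have hp1 : (1:ℝ) < p := by exact_mod_cast hp.one_lt
  have hp0 : (0:ℝ) < p := by linarith
  have hlp := Real.log_pos hp1
  obtain ⟨n, hn⟩ := exists_nat_one_div_lt (sub_pos.2 hζ)
  obtain ⟨s0, hs0⟩ := Filter.eventually_atTop.1 (h (n + 1) (by omega))
  set m : ℕ := n + 1 with hm
  have hm0 : (0:ℝ) < m := by rw [hm]; push_cast; positivity
  have hn' : 1 / (m:ℝ) < ζ - 1 := by rw [hm]; push_cast; exact hn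
  set d := ζ - 1 - 1 / (m:ℝ) with hd
  have hd0 : 0 < d := by rw [hd]; linarith
  set L0 : ℝ := max ((m + 1) / d) (m * s0) with hL0
  refine ⟨Real.exp (-(L0 * Real.log p)), Real.exp_pos _, fun ε he hlt => ?_⟩
  set L := Real.log ε⁻¹ / Real.log p with hL
  have hLL : L0 < L := by
    rw [hL, lt_div_iff₀ hlp, Real.log_inv]
    have := Real.log_lt_log he hlt
    rw [Real.log_exp] at this
    linarith
  have h1 : (m + 1) / d < L := (le_max_left _ _).trans_lt hLL
  have h2 : m * s0 < L := (le_max_right _ _).trans_lt hLL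
  have hLpos : 0 < L := lt_trans (by positivity) h1
  set s := ⌈L / m⌉₊ with hs
  have hs1 : L / m ≤ s := Nat.le_ceil _
  have hs2 : (s:ℝ) < L / m + 1 := Nat.ceil_lt_add_one (by positivity)
  have hss : s0 ≤ s := by
    have : (s0:ℝ) < L / m := by rw [lt_div_iff₀ hm0]; linarith
    exact_mod_cast (this.le.trans hs1)
  obtain ⟨γ, hγ1, hγ2, hγ3⟩ := good_gamma hp (hs0 s hss)
  refine ⟨γ, hγ1, hγ2.trans ?_, ?_⟩
  · rw [inv_le_comm₀ (by positivity) he, ← Real.log_le_log_iff (by positivity) (by positivity), Real.log_pow]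
    rw [div_le_iff₀ hm0] at hs1
    have : Real.log ε⁻¹ = L * Real.log p := by rw [hL]; field_simp
    rw [this]
    push_cast
    nlinarith
  · have h3 : (ht p γ.1 : ℝ) ≤ (m + 1) * s := by exact_mod_cast hγ3
    rw [mul_div_assoc, ← hL]
    refine h3.trans ?_
    have h4 : ((m:ℝ) + 1) * s ≤ (m + 1) * (L / m + 1) := by gcongr
    refine h4.trans ?_
    rw [div_lt_iff₀ hd0] at h1
    have h5 : ((m:ℝ) + 1) * (L / m + 1) = L + L * (1 / m) + (m + 1) := by field_simp
    rw [h5]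
    have : ζ * L = L + L * (1 / m) + L * d := by rw [hd]; ring
    linarith

/-- The n = 2 case of the main theorem: the Diophantine exponent of the
`SL₂(ℤ[1/p])`-action on the hyperbolic plane satisfies `κ ≤ 1`: for almost every pair
`(z, w) ∈ ℍ × ℍ` and every `ζ > 1`, for all sufficiently small `ε > 0` there is
`γ ∈ SL₂(ℤ[1/p])` with `dist (γ⁻¹ • z, w) ≤ ε` and `ht γ ≤ ζ · log (ε⁻¹) / log p`. -/
theorem stmt0 (p : ℕ) (hp : p.Prime) :
    volume {q : ℂ × ℂ | ∃ z w : ℍ, ((z : ℂ), (w : ℂ)) = q ∧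
      ¬ (∀ ζ : ℝ, 1 < ζ → ∃ ε₀ > 0, ∀ ε : ℝ, 0 < ε → ε < ε₀ →
        ∃ γ : SL(2, ℚ), (∀ i j, IsZInvP p (γ.1 i j)) ∧
          dist (γ⁻¹ • z) w ≤ ε ∧
          (ht p γ.1 : ℝ) ≤ ζ * Real.log ε⁻¹ / Real.log p)} = 0 := by
  refine measure_mono_null (t := ⋃ n : ℕ, (Prod.map (fun z : ℍ => (z : ℂ)) (fun z : ℍ => (z : ℂ))) '' badSet p (n + 1))
    ?_ (measure_iUnion_null fun n => badSet_null hp (by omega))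
  rintro q ⟨z, w, rfl, hq⟩
  by_contra hcon
  apply hq
  apply final_pair hp
  intro m hm
  by_contra hbad
  apply hcon
  rw [Set.mem_iUnion]
  refine ⟨m - 1, (z, w), ?_, rfl⟩
  rw [Nat.sub_add_cancel hm]
  exact hbad
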